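/- Let δ > 0 and define f : [0,1] → ℝ by f(x) = |log x|^δ for x ∈ (0,1] and f(0) = 0. Then f ∈ L¹(ν) and there exist positive constants c1, c2, κ1, κ2 such that for every integer n ≥ 1, c1 e^{−κ1 n^{γ/(1+γδ)}} ≤ ν({x ∈ [0,1] : |S_n(f)(x)| > n}) ≤ c2 e^{−κ2 n^{γ/(1+γδ)}}, where S_n(f)(x) = Σ_{k=0}^{n−1} f(T^k(x)) − n ∫ f dν. -/

import Mathlib

open MeasureTheory Set

/-- The interval map `T` of the example: `T(x) = x (1 + c / |log x|^β)` on `(0, 1/2]`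
with `β = 1/γ - 1`, `c = (log 2)^β`, `T(x) = 2x - 1` on `(1/2, 1]`, and `T(0) = 0`. -/
noncomputable def Tmap (γ : ℝ) (x : ℝ) : ℝ :=
  if x ≤ 0 then 0
  else if x ≤ 1 / 2 then x * (1 + (Real.log 2) ^ (1 / γ - 1) / |Real.log x| ^ (1 / γ - 1))
  else 2 * x - 1

/-- The unbounded observable `f(x) = |log x|^δ` for `x ∈ (0,1]`, `f(0) = 0`. -/
noncomputable def logObs (δ : ℝ) (x : ℝ) : ℝ :=
  if x ≤ 0 then 0 else |Real.log x| ^ δ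

section
open MeasureTheory Set

namespace LD

/-- displacement factor in logarithmic coordinate -/
noncomputable def sF (β l : ℝ) : ℝ := (Real.log 2) ^ β / l ^ β

/-- derivative of the left branch in the logarithmic coordinate -/
noncomputable def dF (β l : ℝ) : ℝ := 1 + sF β l + β * sF β l / l

noncomputable def qF (β : ℝ) : ℝ := 16 * (β + β ^ 2)

lemma log2_pos : 0 < Real.log 2 := Real.log_pos (by norm_num)
lemma log2_lt : Real.log 2 < 1 := by have := Real.log_two_lt_d9; linarith
lemma log2_gt : 2/3 < Real.log 2 := by have := Real.log_two_gt_d9; linarith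

lemma sF_pos (β : ℝ) {l : ℝ} (hl : 0 < l) : 0 < sF β l :=
  div_pos (Real.rpow_pos_of_pos log2_pos _) (Real.rpow_pos_of_pos hl _)

lemma sF_anti {β : ℝ} (hβ : 0 ≤ β) {l l' : ℝ} (hl : 0 < l) (h : l ≤ l') : sF β l' ≤ sF β l := by
  unfold sF
  have := Real.rpow_pos_of_pos hl β
  have h2 := Real.rpow_pos_of_pos log2_pos β
  gcongr

lemma sF_le_one {β : ℝ} (hβ : 0 ≤ β) {l : ℝ} (hl : Real.log 2 ≤ l) : sF β l ≤ 1 := by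
  refine (sF_anti hβ log2_pos hl).trans ?_
  unfold sF
  rw [div_self (Real.rpow_pos_of_pos log2_pos _).ne']

lemma sF_log2 (β : ℝ) : sF β (Real.log 2) = 1 := by
  unfold sF
  rw [div_self (Real.rpow_pos_of_pos log2_pos _).ne']

lemma hasDerivAt_sF (β : ℝ) {l : ℝ} (hl : 0 < l) : HasDerivAt (sF β) (-(β * sF β l / l)) l := by
  have h1 : HasDerivAt (fun l : ℝ => l ^ β) (β * l ^ (β - 1)) l :=
    Real.hasDerivAt_rpow_const (Or.inl hl.ne')
  have h2 := (hasDerivAt_const l ((Real.log 2) ^ β)).div h1 (Real.rpow_pos_of_pos hl _).ne'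
  refine h2.congr_deriv ?_
  have := (Real.rpow_pos_of_pos hl β).ne'
  unfold sF
  rw [Real.rpow_sub_one hl.ne']
  field_simp
  ring

lemma dF_pos {β : ℝ} (hβ : 0 ≤ β) {l : ℝ} (hl : 0 < l) : 1 < dF β l := by
  have := sF_pos β hl
  have : 0 ≤ β * sF β l / l := by positivity
  unfold dF; linarith

lemma dF_anti {β : ℝ} (hβ : 0 ≤ β) {l l' : ℝ} (hl : 0 < l) (h : l ≤ l') : dF β l' ≤ dF β l := by
  have h1 := sF_anti hβ hl h
  have h2 := sF_pos β hl
  unfold dF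
  gcongr

/-- the key monotonicity -/
lemma key_mono {β : ℝ} (hβ : 0 ≤ β) :
    MonotoneOn (fun l => qF β * (Real.log (2 + (l - Real.log (1 + sF β l))) - Real.log (2 + l)) +
      Real.log (dF β l) - Real.log (1 + sF β l)) (Ici (Real.log 2)) := by
  have hd : ∀ l, Real.log 2 ≤ l → HasDerivAt
    (fun l => qF β * (Real.log (2 + (l - Real.log (1 + sF β l))) - Real.log (2 + l)) +
      Real.log (dF β l) - Real.log (1 + sF β l))
    (qF β * ((1 - (-(β * sF β l / l)) / (1 + sF β l)) / (2 + (l - Real.log (1 + sF β l))) 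
       - 1 / (2 + l)) + (-(β * sF β l / l) + (β * (-(β * sF β l / l)) * l - β * sF β l * 1) / l ^ 2)
        / dF β l - (-(β * sF β l / l)) / (1 + sF β l)) l := by
    intro l hl
    have hl0 : 0 < l := log2_pos.trans_le hl
    have hs := sF_pos β hl0
    have h0 := hasDerivAt_sF β hl0
    have h1 : HasDerivAt (fun l => Real.log (1 + sF β l)) ((-(β * sF β l / l)) / (1 + sF β l)) l :=
      (h0.const_add 1).log (by positivity)
    have hlam : Real.log (1 + sF β l) ≤ Real.log 2 :=
      Real.log_le_log (by positivity) (by linarith [sF_le_one hβ hl])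
    have h2 := (((hasDerivAt_id' l).sub h1).const_add 2).log
      (show 2 + (l - Real.log (1 + sF β l)) ≠ 0 by linarith)
    have h3 := ((hasDerivAt_id' l).const_add 2).log (by linarith)
    have h4 : HasDerivAt (dF β) (-(β * sF β l / l) + (β * (-(β * sF β l / l)) * l - β * sF β l * 1) / l ^ 2) l :=
      (h0.const_add 1).add ((h0.const_mul β).div (hasDerivAt_id' l) hl0.ne')
    have h5 := h4.log (by linarith [dF_pos hβ hl0])
    exact (((h2.sub h3).const_mul _).add h5).sub h1
  refine monotoneOn_of_hasDerivWithinAt_nonneg (convex_Ici _) 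
    (fun l hl => (hd l hl).continuousAt.continuousWithinAt)
    (fun l hl => (hd l (interior_subset hl)).hasDerivWithinAt) ?_
  intro l hl
  have hl := interior_subset hl
  simp only [mem_Ici] at hl
  have hl0 : 0 < l := log2_pos.trans_le hl
  have hs := sF_pos β hl0
  have hs1 := sF_le_one hβ hl
  set s := sF β l
  have hlam : Real.log (1 + s) ≤ Real.log 2 :=
      Real.log_le_log (by positivity) (by linarith)
  have hlam0 : s / (1 + s) ≤ Real.log (1 + s) := by
    have := Real.one_sub_inv_le_log_of_pos (show 0 < 1 + s by positivity)
    refine le_trans (le_of_eq ?_) this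
    field_simp
    ring
  set m := Real.log (1 + s)
  have hq : 0 ≤ qF β := by unfold qF; positivity
  set t := s / (1 + s) with ht
  have ht0 : 0 < t := by positivity
  have e1 : t / (2 + l) ^ 2 ≤ (1 - (-(β * s / l)) / (1 + s)) / (2 + (l - m)) - 1 / (2 + l) := by
    have h1 : 0 < 2 + (l - m) := by linarith
    have h2 : 0 ≤ β * s / l / (1 + s) := by positivity
    have : (1:ℝ) / (2 + (l - m)) ≤ (1 - (-(β * s / l)) / (1 + s)) / (2 + (l - m)) := by
      gcongr
      rw [neg_div]; linarith
    have h3 : t / (2 + l) ^ 2 ≤ 1 / (2 + (l - m)) - 1 / (2 + l) := by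
      have : 1 / (2 + (l - m)) - 1 / (2 + l) = m / ((2 + (l - m)) * (2 + l)) := by
        field_simp; ring
      rw [this, pow_two]
      have : 0 ≤ m := ht0.le.trans hlam0
      gcongr
      linarith
    linarith
  have e2 : - (β * t / l) - (β + β ^ 2) * t / l ^ 2 ≤ (-(β * s / l) + (β * (-(β * s / l)) * l - β * s * 1) / l ^ 2)
        / dF β l := by
    have : (-(β * s / l) + (β * (-(β * s / l)) * l - β * s * 1) / l ^ 2) = 
      -(β * s / l + (β + β ^ 2) * s / l ^ 2) := by field_simp; ring
    rw [this, neg_div, ← neg_add', neg_le_neg_iff]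
    have h1 : (1 + s) ≤ dF β l := by
      unfold dF
      have : 0 ≤ β * s / l := by positivity
      show 1 + s ≤ 1 + s + β * s / l
      linarith
    calc _ ≤ (β * s / l + (β + β ^ 2) * s / l ^ 2) / (1 + s) := by gcongr
      _ = _ := by rw [ht]; field_simp
  have e3 : -(β * s / l) / (1 + s) = - (β * t / l) := by rw [ht]; field_simp
  have e4 : (β + β ^ 2) * t / l ^ 2 ≤ qF β * (t / (2 + l) ^ 2) := by
    have : (2 + l) ^ 2 ≤ 16 * l ^ 2 := by
      have : 2 + l ≤ 4 * l := by linarith [log2_gt]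
      nlinarith
    unfold qF
    rw [div_le_iff₀ (by positivity), show 16 * (β + β ^ 2) * (t / (2 + l) ^ 2) * l ^ 2 = 
      (β + β ^ 2) * t * (16 * l ^ 2 / (2 + l) ^ 2) by field_simp]
    have : 1 ≤ 16 * l ^ 2 / (2 + l) ^ 2 := by rw [le_div_iff₀ (by positivity)]; linarith
    have h : 0 ≤ (β + β ^ 2) * t := by positivity
    nlinarith
  have := mul_le_mul_of_nonneg_left e1 hq
  show 0 ≤ qF β * ((1 - (-(β * s / l)) / (1 + s)) / (2 + (l - m)) - 1 / (2 + l)) + _ / dF β l - (-(β * s / l)) / (1 + s)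
  rw [e3] at this ⊢
  linarith

/-- the weight -/
noncomputable def wF (β x : ℝ) : ℝ := x * (2 - Real.log x) ^ (-(qF β))
/-- square root of the weight -/
noncomputable def vF (β x : ℝ) : ℝ := Real.sqrt (wF β x)

lemma wF_pos (β : ℝ) {x : ℝ} (hx : 0 < x) (hx1 : x ≤ 1) : 0 < wF β x := by
  have : Real.log x ≤ 0 := Real.log_nonpos hx.le hx1
  have : 0 < 2 - Real.log x := by linarith
  exact mul_pos hx (Real.rpow_pos_of_pos this _)

lemma log_wF (β : ℝ) {x : ℝ} (hx : 0 < x) (hx1 : x ≤ 1) :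
    Real.log (wF β x) = Real.log x - qF β * Real.log (2 - Real.log x) := by
  have : Real.log x ≤ 0 := Real.log_nonpos hx.le hx1
  have h : 0 < 2 - Real.log x := by linarith
  unfold wF
  rw [Real.log_mul hx.ne' (Real.rpow_pos_of_pos h _).ne', Real.log_rpow h]
  ring

/-- monotonicity for the right branch -/
lemma right_mono {β : ℝ} (hβ : 0 ≤ β) {x y : ℝ} (hx : 0 < x) (hxy : x ≤ y) (hy : y ≤ 1) :
    wF β x * (wF β ((1 + y) / 2)) ^ 2 ≤ wF β y * (wF β ((1 + x) / 2)) ^ 2 := by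
  have hq : 0 ≤ qF β := by unfold qF; positivity
  set F : ℝ → ℝ := fun x => (Real.log x - 2 * Real.log ((1 + x) / 2)) + 
    qF β * (2 * Real.log (2 - Real.log ((1 + x) / 2)) - Real.log (2 - Real.log x)) with hF
  have hd : ∀ x ∈ Ioc (0:ℝ) 1, HasDerivAt F ((1 / x - 2 * ((1/2) / ((1 + x) / 2))) +
      qF β * (2 * (-((1/2) / ((1 + x) / 2)) / (2 - Real.log ((1 + x) / 2))) - (-(1/x)) / (2 - Real.log x))) x := by
    intro x hx
    have h1 := (hasDerivAt_id' x).log hx.1.ne'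
    have h2 := (((hasDerivAt_id' x).const_add 1).div_const 2).log (by have := hx.1; positivity)
    have l1 : Real.log x ≤ 0 := Real.log_nonpos hx.1.le hx.2
    have l2 : Real.log ((1 + x) / 2) ≤ 0 := Real.log_nonpos (by linarith [hx.1]) (by linarith [hx.2])
    have h3 := (h1.const_sub 2).log (by linarith)
    have h4 := (h2.const_sub 2).log (by linarith)
    exact (h1.sub (h2.const_mul 2)).add (((h4.const_mul 2).sub h3).const_mul (qF β))
  have hm : MonotoneOn F (Ioc 0 1) := by
    refine monotoneOn_of_hasDerivWithinAt_nonneg (convex_Ioc _ _) 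
      (fun l hl => (hd l hl).continuousAt.continuousWithinAt)
      (fun l hl => (hd l (interior_subset hl)).hasDerivWithinAt) ?_
    intro x hx
    have hx := interior_subset hx
    have hx0 := hx.1
    have hx1 := hx.2
    have l1 : Real.log x ≤ 0 := Real.log_nonpos hx.1.le hx.2
    have l2 : Real.log ((1 + x) / 2) ≤ 0 := Real.log_nonpos (by linarith [hx.1]) (by linarith [hx.2])
    have a1 : 0 ≤ (1 / x - 2 * ((1/2) / ((1 + x) / 2))) := by
      have : 2 * ((1/2) / ((1 + x) / 2)) = 1 / ((1 + x) / 2) := by field_simp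
      rw [this, sub_nonneg]
      gcongr
      linarith
    have a2 : x * (2 - Real.log x) ≤ (1 + x) / 2 * (2 - Real.log ((1 + x) / 2)) := by
      have hG : MonotoneOn (fun t => t * (2 - Real.log t)) (Ioc 0 1) := by
        have hd' : ∀ t ∈ Ioc (0:ℝ) 1, HasDerivAt (fun t => t * (2 - Real.log t)) (1 * (2 - Real.log t) + t * (-(1/t))) t := by
          intro t ht
          exact (hasDerivAt_id' t).mul (((hasDerivAt_id' t).log ht.1.ne').const_sub 2)
        refine monotoneOn_of_hasDerivWithinAt_nonneg (convex_Ioc _ _) 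
          (fun l hl => (hd' l hl).continuousAt.continuousWithinAt)
          (fun l hl => (hd' l (interior_subset hl)).hasDerivWithinAt) ?_
        intro t ht
        have ht := interior_subset ht
        have : Real.log t ≤ 0 := Real.log_nonpos ht.1.le ht.2
        have h2 : t * (-(1/t)) = -1 := by have := ht.1.ne'; field_simp
        rw [h2]; linarith
      exact hG hx ⟨by linarith, by linarith⟩ (by linarith)
    have a3 : 0 ≤ (2 * (-((1/2) / ((1 + x) / 2)) / (2 - Real.log ((1 + x) / 2))) - (-(1/x)) / (2 - Real.log x)) := by
      have e1 : 2 * (-((1/2) / ((1 + x) / 2)) / (2 - Real.log ((1 + x) / 2))) = 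
        - (1 / ((1 + x) / 2 * (2 - Real.log ((1 + x) / 2)))) := by
        have : 2 - Real.log ((1 + x) / 2) ≠ 0 := by linarith
        field_simp
      have e2 : (-(1/x)) / (2 - Real.log x) = - (1 / (x * (2 - Real.log x))) := by
        have : 2 - Real.log x ≠ 0 := by linarith
        field_simp
      rw [e1, e2, sub_neg_eq_add, neg_add_eq_sub, sub_nonneg]
      have : 0 < x * (2 - Real.log x) := mul_pos hx0 (by linarith)
      gcongr
    have := mul_nonneg hq a3
    linarith
  have hFF := hm ⟨hx, hxy.trans hy⟩ ⟨hx.trans_le hxy, hy⟩ hxy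
  have hy0 := hx.trans_le hxy
  have hx1 := hxy.trans hy
  have p1 := wF_pos β hx hx1
  have p2 := wF_pos β hy0 hy
  have p3 := wF_pos β (x := (1 + x)/2) (by linarith) (by linarith)
  have p4 := wF_pos β (x := (1 + y)/2) (by linarith) (by linarith)
  rw [← Real.log_le_log_iff (by positivity) (by positivity), Real.log_mul (by positivity) (by positivity),
    Real.log_mul (by positivity) (by positivity), Real.log_pow, Real.log_pow, log_wF β hx hx1, log_wF β hy0 hy,
    log_wF β (by linarith) (by linarith), log_wF β (by linarith) (by linarith)]
  simp only [hF] at hFF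
  push_cast
  linarith

end LD
end

section
open MeasureTheory Set

namespace LD

noncomputable def be (γ : ℝ) : ℝ := 1 / γ - 1

lemma be_nonneg {γ : ℝ} (hγ0 : 0 < γ) (hγ1 : γ ≤ 1) : 0 ≤ be γ := by
  unfold be
  rw [sub_nonneg]
  exact (one_le_div hγ0).2 hγ1

lemma T_nonpos (γ : ℝ) {x : ℝ} (hx : x ≤ 0) : Tmap γ x = 0 := by simp [Tmap, hx]

lemma neglog_ge {x : ℝ} (hx : x ∈ Ioc (0:ℝ) (1/2)) : Real.log 2 ≤ - Real.log x := by
  have := Real.log_le_log hx.1 hx.2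
  rw [one_div, Real.log_inv] at this
  linarith

lemma T_left (γ : ℝ) {x : ℝ} (hx : x ∈ Ioc (0:ℝ) (1/2)) :
    Tmap γ x = x * (1 + sF (be γ) (- Real.log x)) := by
  have h1 := neglog_ge hx
  have h2 := log2_pos
  have : |Real.log x| = - Real.log x := abs_of_neg (by linarith)
  simp only [Tmap, not_le.2 hx.1, hx.2, if_true, if_false, this, sF, be]

lemma T_right (γ : ℝ) {x : ℝ} (hx : 1/2 < x) : Tmap γ x = 2 * x - 1 := by
  have : ¬ x ≤ 0 := by linarith
  simp only [Tmap, this, not_le.2 hx, if_false]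

lemma T_half (γ : ℝ) : Tmap γ (1/2) = 1 := by
  rw [T_left γ ⟨by norm_num, le_rfl⟩, one_div, Real.log_inv, neg_neg, sF_log2]
  norm_num

section
variable {γ : ℝ}

lemma T_left_le (hγ0 : 0 < γ) (hγ1 : γ ≤ 1) {x : ℝ} (hx : x ∈ Ioc (0:ℝ) (1/2)) : Tmap γ x ≤ 2 * x := by
  rw [T_left γ hx]
  have := sF_le_one (be_nonneg hγ0 hγ1) (neglog_ge hx)
  nlinarith [hx.1]

lemma T_left_ge {x : ℝ} (hx : x ∈ Ioc (0:ℝ) (1/2)) : x < Tmap γ x := by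
  rw [T_left γ hx]
  have := sF_pos (be γ) (log2_pos.trans_le (neglog_ge hx))
  nlinarith [hx.1]

lemma T_mem (hγ0 : 0 < γ) (hγ1 : γ ≤ 1) {x : ℝ} (hx : x ∈ Ioc (0:ℝ) 1) : Tmap γ x ∈ Ioc (0:ℝ) 1 := by
  by_cases h : x ≤ 1/2
  · exact ⟨hx.1.trans (T_left_ge ⟨hx.1, h⟩), by linarith [T_left_le hγ0 hγ1 ⟨hx.1, h⟩]⟩
  · push Not at h
    rw [T_right γ h]
    exact ⟨by linarith, by linarith [hx.2]⟩

lemma T_iter_mem (hγ0 : 0 < γ) (hγ1 : γ ≤ 1) {x : ℝ} (hx : x ∈ Ioc (0:ℝ) 1) (n : ℕ) : (Tmap γ)^[n] x ∈ Ioc (0:ℝ) 1 := by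
  induction n with
  | zero => simpa using hx
  | succ n ih => rw [Function.iterate_succ_apply']; exact T_mem hγ0 hγ1 ih

lemma neglog_T {x : ℝ} (hx : x ∈ Ioc (0:ℝ) (1/2)) :
    - Real.log (Tmap γ x) = - Real.log x - Real.log (1 + sF (be γ) (- Real.log x)) := by
  have := sF_pos (be γ) (log2_pos.trans_le (neglog_ge hx))
  rw [T_left γ hx, Real.log_mul hx.1.ne' (by positivity)]
  ring

lemma T_expand (hγ0 : 0 < γ) (hγ1 : γ ≤ 1) {x y : ℝ} (hx : x ∈ Ioc (0:ℝ) (1/2)) (hy : y ∈ Ioc (0:ℝ) (1/2)) (hxy : x ≤ y) :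
    y - x ≤ Tmap γ y - Tmap γ x := by
  rw [T_left γ hx, T_left γ hy]
  have h1 := sF_pos (be γ) (log2_pos.trans_le (neglog_ge hx))
  have h2 : sF (be γ) (- Real.log x) ≤ sF (be γ) (- Real.log y) :=
    sF_anti (be_nonneg hγ0 hγ1) (log2_pos.trans_le (neglog_ge hy)) (neg_le_neg (Real.log_le_log hx.1 hxy))
  have := hx.1
  have : x * sF (be γ) (- Real.log x) ≤ y * sF (be γ) (- Real.log y) := by gcongr; linarith
  nlinarith

lemma T_injOn (hγ0 : 0 < γ) (hγ1 : γ ≤ 1) : InjOn (Tmap γ) (Ioc 0 (1/2)) := by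
  intro x hx y hy h
  rcases le_total x y with h1 | h1
  · have := T_expand hγ0 hγ1 hx hy h1; linarith
  · have := T_expand hγ0 hγ1 hy hx h1; linarith

lemma T_deriv {x : ℝ} (hx : x ∈ Ioc (0:ℝ) (1/2)) :
    HasDerivWithinAt (Tmap γ) (dF (be γ) (- Real.log x)) (Ioc 0 (1/2)) x := by
  have hl := log2_pos.trans_le (neglog_ge hx)
  have h1 : HasDerivAt (fun x => - Real.log x) (-(1/x)) x := ((hasDerivAt_id' x).log hx.1.ne').neg
  have h2 := (hasDerivAt_sF (be γ) hl).comp x h1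
  have h3 := (hasDerivAt_id' x).mul (h2.const_add 1)
  refine (h3.hasDerivWithinAt.congr_deriv ?_).congr (fun y hy => T_left γ hy) (T_left γ hx)
  unfold dF
  have := hx.1.ne'
  have := hl.ne'
  simp only [Function.comp]
  field_simp

lemma T_image (hγ0 : 0 < γ) (hγ1 : γ ≤ 1) : Tmap γ '' (Ioc 0 (1/2)) = Ioc 0 1 := by
  apply Subset.antisymm
  · rintro _ ⟨x, hx, rfl⟩
    exact T_mem hγ0 hγ1 ⟨hx.1, by linarith [hx.2]⟩
  · intro y hy
    have hsub : Icc (y/2) (1/2) ⊆ Ioc (0:ℝ) (1/2) := fun z hz => ⟨by linarith [hz.1, hy.1], hz.2⟩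
    have hc : ContinuousOn (Tmap γ) (Icc (y/2) (1/2)) :=
      fun z hz => ((T_deriv (hsub hz)).continuousWithinAt).mono hsub
    have := intermediate_value_Icc (by linarith [hy.2]) hc
    have h1 := T_left_le hγ0 hγ1 (x := y/2) ⟨by linarith [hy.1], by linarith [hy.2]⟩
    obtain ⟨z, hz, rfl⟩ := this ⟨by linarith, by rw [T_half]; exact hy.2⟩
    exact ⟨z, hsub hz, rfl⟩

lemma T_meas : Measurable (Tmap γ) := by
  unfold Tmap
  refine Measurable.ite measurableSet_Iic measurable_const (Measurable.ite measurableSet_Iic ?_ ?_)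
  · fun_prop
  · fun_prop

lemma left_mono (hγ0 : 0 < γ) (hγ1 : γ ≤ 1) {x y : ℝ} (hx : x ∈ Ioc (0:ℝ) (1/2)) (hy : y ∈ Ioc (0:ℝ) (1/2)) (hxy : x ≤ y) :
    wF (be γ) (Tmap γ x) * (dF (be γ) (- Real.log y) * wF (be γ) y) ≤
    wF (be γ) (Tmap γ y) * (dF (be γ) (- Real.log x) * wF (be γ) x) := by
  have hβ := be_nonneg hγ0 hγ1
  have lx := neglog_ge hx
  have ly := neglog_ge hy
  have lxy := Real.log_le_log hx.1 hxy
  have hk := key_mono hβ (mem_Ici.2 ly) (mem_Ici.2 lx) (by linarith)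
  have x1 : x ∈ Ioc (0:ℝ) 1 := ⟨hx.1, by linarith [hx.2]⟩
  have y1 : y ∈ Ioc (0:ℝ) 1 := ⟨hy.1, by linarith [hy.2]⟩
  have tx := T_mem hγ0 hγ1 x1
  have ty := T_mem hγ0 hγ1 y1
  have p1 := wF_pos (be γ) tx.1 tx.2
  have p2 := wF_pos (be γ) ty.1 ty.2
  have p3 := wF_pos (be γ) x1.1 x1.2
  have p4 := wF_pos (be γ) y1.1 y1.2
  have d1 := dF_pos hβ (log2_pos.trans_le lx)
  have d2 := dF_pos hβ (log2_pos.trans_le ly)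
  have d1' : 0 < dF (be γ) (- Real.log x) := by linarith
  have d2' : 0 < dF (be γ) (- Real.log y) := by linarith
  rw [← Real.log_le_log_iff (by positivity) (by positivity), Real.log_mul (by positivity) (by positivity),
    Real.log_mul (by positivity) (by positivity), Real.log_mul (by positivity) (by positivity),
    Real.log_mul (by positivity) (by positivity), log_wF _ tx.1 tx.2, log_wF _ ty.1 ty.2,
    log_wF _ x1.1 x1.2, log_wF _ y1.1 y1.2]
  have ex := neglog_T (γ := γ) hx
  have ey := neglog_T (γ := γ) hy
  have ex' : Real.log (Tmap γ x) = -(- Real.log x - Real.log (1 + sF (be γ) (- Real.log x))) := by linarith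
  have ey' : Real.log (Tmap γ y) = -(- Real.log y - Real.log (1 + sF (be γ) (- Real.log y))) := by linarith
  rw [ex', ey']
  simp only [sub_neg_eq_add] at *
  rw [show 2 - Real.log x = 2 + - Real.log x by ring, show 2 - Real.log y = 2 + - Real.log y by ring]
  linarith

/-- escape from the left branch -/
lemma exists_escape (hγ0 : 0 < γ) (hγ1 : γ ≤ 1) {x : ℝ} (hx : x ∈ Ioc (0:ℝ) 1) : ∃ n, 1/2 < (Tmap γ)^[n] x := by
  by_contra hcon
  push Not at hcon
  have hx2 : x ∈ Ioc (0:ℝ) (1/2) := ⟨hx.1, by simpa using hcon 0⟩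
  set s := sF (be γ) (- Real.log x)
  have hs : 0 < s := sF_pos (be γ) (log2_pos.trans_le (neglog_ge hx2))
  have key : ∀ n, x * (1 + s) ^ n ≤ (Tmap γ)^[n] x := by
    intro n
    induction n with
    | zero => simp
    | succ n ih =>
      have hm : (Tmap γ)^[n] x ∈ Ioc (0:ℝ) (1/2) := ⟨(T_iter_mem hγ0 hγ1 hx n).1, hcon n⟩
      rw [Function.iterate_succ_apply', T_left γ hm]
      have h1 : x ≤ (Tmap γ)^[n] x := by
        refine le_trans ?_ ih
        have : 1 ≤ (1 + s) ^ n := one_le_pow₀ (by linarith)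
        nlinarith [hx.1]
      have h2 : s ≤ sF (be γ) (- Real.log ((Tmap γ)^[n] x)) :=
        sF_anti (be_nonneg hγ0 hγ1) (log2_pos.trans_le (neglog_ge hm)) (neg_le_neg (Real.log_le_log hx.1 h1))
      rw [pow_succ, ← mul_assoc]
      have := hm.1
      have := hx.1
      gcongr
  obtain ⟨n, hn⟩ := pow_unbounded_of_one_lt (1/(2*x)) (show 1 < 1 + s by linarith)
  have := key n
  have h3 := hcon n
  have := hx.1
  rw [div_lt_iff₀ (by positivity)] at hn
  nlinarith

end
end LD
end

section
open MeasureTheory Set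
open scoped ENNReal

namespace LD

/-- Lebesgue measure on the unit interval -/
noncomputable def mI : Measure ℝ := volume.restrict (Ioc 0 1)

instance : IsProbabilityMeasure mI := ⟨by simp [mI]⟩

lemma mI_compl : mI (Ioc (0:ℝ) 1)ᶜ = 0 := by
  simp [mI, Measure.restrict_apply measurableSet_Ioc.compl]

lemma ae_mI : ∀ᵐ x ∂mI, x ∈ Ioc (0:ℝ) 1 := ae_restrict_mem measurableSet_Ioc

lemma wF_mono {β : ℝ} (hβ : 0 ≤ β) : MonotoneOn (wF β) (Ioc 0 1) := by
  intro x hx y hy hxy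
  have hq : 0 ≤ qF β := by unfold qF; positivity
  have h1 : Real.log x ≤ Real.log y := Real.log_le_log hx.1 hxy
  have h2 : Real.log y ≤ 0 := Real.log_nonpos hy.1.le hy.2
  unfold wF
  have : (2 - Real.log x) ^ (-(qF β)) ≤ (2 - Real.log y) ^ (-(qF β)) :=
    Real.rpow_le_rpow_of_nonpos (by linarith) (by linarith) (by linarith)
  have h3 : 0 ≤ (2 - Real.log x) ^ (-(qF β)) := Real.rpow_nonneg (by linarith) _
  have := hy.1
  gcongr

lemma enn_aux {A B : ℝ≥0∞} {a1 a2 b1 b2 : ℝ} (h1 : 0 < a1) (h2 : 0 < a2) (hb1 : 0 ≤ b1) (hb2 : 0 ≤ b2)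
    (hab : A * ENNReal.ofReal a1 ≤ B * ENNReal.ofReal a2) (h : b1 * a2 ≤ b2 * a1) :
    A * ENNReal.ofReal b1 ≤ B * ENNReal.ofReal b2 := by
  have e1 : A * ENNReal.ofReal b1 = A * ENNReal.ofReal a1 * ENNReal.ofReal (b1 / a1) := by
    rw [mul_assoc, ← ENNReal.ofReal_mul h1.le, mul_div_cancel₀ _ h1.ne']
  have e2 : B * ENNReal.ofReal b2 = B * ENNReal.ofReal a2 * ENNReal.ofReal (b2 / a2) := by
    rw [mul_assoc, ← ENNReal.ofReal_mul h2.le, mul_div_cancel₀ _ h2.ne']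
  rw [e1, e2]
  refine mul_le_mul' hab (ENNReal.ofReal_le_ofReal ?_)
  rw [div_le_div_iff₀ h1 h2]
  exact h

def IsW (γ : ℝ) (g : ℝ → ℝ≥0∞) : Prop :=
  AntitoneOn g (Ioc 0 1) ∧ MonotoneOn (fun x => g x * ENNReal.ofReal (wF (be γ) x)) (Ioc 0 1)

/-- distortion constant -/
noncomputable def cD (γ : ℝ) : ℝ := wF (be γ) 1 / wF (be γ) (1/2)

def MW (γ : ℝ) (ρ : Measure ℝ) : Prop := ∃ g, IsW γ g ∧ ρ = mI.withDensity g

def MK (γ : ℝ) (ρ : Measure ℝ) : Prop :=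
  ∃ g, IsW γ g ∧ (∀ x ∈ Ioc (0:ℝ) 1, g x ≤ ENNReal.ofReal (2 * cD γ) * g 1) ∧ ρ = mI.withDensity g

def MP (γ : ℝ) (ρ : Measure ℝ) : Prop :=
  ∃ g, AntitoneOn g (Ioc 0 1) ∧
    MonotoneOn (fun x => g x * ENNReal.ofReal (vF (be γ) x)) (Ioc 0 1) ∧
    (∀ x ∈ Ioc (0:ℝ) 1, g x ≤ ENNReal.ofReal (cD γ) * g 1) ∧ ρ = mI.withDensity g

lemma one_mem : (1:ℝ) ∈ Ioc (0:ℝ) 1 := ⟨one_pos, le_rfl⟩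
lemma half_mem : (1/2:ℝ) ∈ Ioc (0:ℝ) 1 := ⟨by norm_num, by norm_num⟩

variable {γ : ℝ}

lemma one_le_cD (hγ0 : 0 < γ) (hγ1 : γ ≤ 1) : 1 ≤ cD γ := by
  unfold cD
  rw [one_le_div (wF_pos _ (by norm_num) (by norm_num))]
  exact wF_mono (be_nonneg hγ0 hγ1) half_mem one_mem (by norm_num)

/-- generic change of variables for a branch -/
lemma push_branch {s0 : Set ℝ} (hs0 : MeasurableSet s0) (hsub : s0 ⊆ Ioc 0 1) {d : ℝ → ℝ}
    (hd : ∀ y ∈ s0, HasDerivWithinAt (Tmap γ) (d y) s0 y) (hd0 : ∀ y ∈ s0, 0 < d y)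
    (hinj : InjOn (Tmap γ) s0) (himg : Tmap γ '' s0 = Ioc 0 1) {g g' : ℝ → ℝ≥0∞}
    (hg : ∀ y ∈ s0, ENNReal.ofReal (d y) * g' (Tmap γ y) = g y) :
    ((mI.withDensity g).restrict s0).map (Tmap γ) = mI.withDensity g' := by
  ext E hE
  rw [Measure.map_apply T_meas hE, Measure.restrict_apply (T_meas hE),
    withDensity_apply _ ((T_meas hE).inter hs0), withDensity_apply _ hE, mI,
    Measure.restrict_restrict ((T_meas hE).inter hs0), Measure.restrict_restrict hE]
  have e1 : Tmap γ ⁻¹' E ∩ s0 ∩ Ioc 0 1 = Tmap γ ⁻¹' E ∩ s0 := by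
    apply inter_eq_left.2
    exact inter_subset_right.trans hsub
  have e2 : E ∩ Ioc 0 1 = Tmap γ '' (Tmap γ ⁻¹' E ∩ s0) := by
    rw [image_preimage_inter, himg]
  rw [e1, e2, lintegral_image_eq_lintegral_abs_deriv_mul ((T_meas hE).inter hs0)
    (fun y hy => (hd y hy.2).mono inter_subset_right) (hinj.mono inter_subset_right)]
  refine setLIntegral_congr_fun ((T_meas hE).inter hs0) ?_
  intro y hy
  simp only [abs_of_pos (hd0 y hy.2), hg y hy.2]

lemma MW_left (hγ0 : 0 < γ) (hγ1 : γ ≤ 1) {ρ : Measure ℝ} (h : MW γ ρ) :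
    MW γ ((ρ.restrict (Ioc 0 (1/2))).map (Tmap γ)) := by
  obtain ⟨g, ⟨hg1, hg2⟩, rfl⟩ := h
  have hβ := be_nonneg hγ0 hγ1
  have himg := T_image hγ0 hγ1
  have hinj := T_injOn hγ0 hγ1
  set S : ℝ → ℝ := Function.invFunOn (Tmap γ) (Ioc 0 (1/2))
  have hS : ∀ x ∈ Ioc (0:ℝ) 1, S x ∈ Ioc (0:ℝ) (1/2) := by
    intro x hx
    rw [← himg] at hx
    exact Function.invFunOn_mem hx
  have hTS : ∀ x ∈ Ioc (0:ℝ) 1, Tmap γ (S x) = x := by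
    intro x hx
    rw [← himg] at hx
    exact Function.invFunOn_eq hx
  have hST : ∀ y ∈ Ioc (0:ℝ) (1/2), S (Tmap γ y) = y := fun y hy => hinj.leftInvOn_invFunOn hy
  have hSm : MonotoneOn S (Ioc 0 1) := by
    intro x hx y hy hxy
    by_contra hcon
    push Not at hcon
    have := T_expand hγ0 hγ1 (hS y hy) (hS x hx) hcon.le
    rw [hTS x hx, hTS y hy] at this
    linarith
  have hsub : Ioc (0:ℝ) (1/2) ⊆ Ioc 0 1 := Ioc_subset_Ioc_right (by norm_num)
  have hd : ∀ y ∈ Ioc (0:ℝ) (1/2), 0 < dF (be γ) (- Real.log y) := fun y hy => by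
    linarith [dF_pos hβ (log2_pos.trans_le (neglog_ge hy))]
  refine ⟨fun x => g (S x) * ENNReal.ofReal (dF (be γ) (- Real.log (S x)))⁻¹, ⟨?_, ?_⟩, ?_⟩
  · intro x hx y hy hxy
    have h1 := hSm hx hy hxy
    have h2 := hg1 (hsub (hS x hx)) (hsub (hS y hy)) h1
    have h3 := dF_anti hβ (log2_pos.trans_le (neglog_ge (hS y hy))) (neg_le_neg (Real.log_le_log (hS x hx).1 h1))
    have := hd _ (hS x hx)
    dsimp only
    gcongr
  · intro x hx y hy hxy
    have h1 := hSm hx hy hxy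
    have h2 := hg2 (hsub (hS x hx)) (hsub (hS y hy)) h1
    have h3 := left_mono hγ0 hγ1 (hS x hx) (hS y hy) h1
    rw [hTS x hx, hTS y hy] at h3
    dsimp only at h2 ⊢
    have p1 := hd _ (hS x hx)
    have p2 := hd _ (hS y hy)
    have w1 := wF_pos (be γ) hx.1 hx.2
    have w2 := wF_pos (be γ) hy.1 hy.2
    rw [mul_assoc, mul_assoc, ← ENNReal.ofReal_mul (by positivity), ← ENNReal.ofReal_mul (by positivity)]
    refine enn_aux (wF_pos _ (hS x hx).1 (hsub (hS x hx)).2) (wF_pos _ (hS y hy).1 (hsub (hS y hy)).2) 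
      (by positivity) (by positivity) h2 ?_
    rw [inv_mul_eq_div, inv_mul_eq_div, div_mul_eq_mul_div, div_mul_eq_mul_div, div_le_div_iff₀ p1 p2]
    linarith
  · refine push_branch measurableSet_Ioc hsub (fun y hy => T_deriv hy) hd hinj himg ?_
    intro y hy
    have p1 := hd y hy
    rw [hST y hy, mul_comm, mul_assoc, ← ENNReal.ofReal_mul (by positivity), inv_mul_cancel₀ p1.ne']
    simp

lemma MP_right (hγ0 : 0 < γ) (hγ1 : γ ≤ 1) {ρ : Measure ℝ} (h : MW γ ρ) :
    MP γ ((ρ.restrict (Ioc (1/2) 1)).map (Tmap γ)) := by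
  obtain ⟨g, ⟨hg1, hg2⟩, rfl⟩ := h
  have hβ := be_nonneg hγ0 hγ1
  have hY : ∀ x ∈ Ioc (0:ℝ) 1, (1 + x) / 2 ∈ Ioc (0:ℝ) 1 := fun x hx => 
    ⟨by linarith [hx.1], by linarith [hx.2]⟩
  refine ⟨fun x => g ((1 + x) / 2) * ENNReal.ofReal (1/2), ?_, ?_, ?_, ?_⟩
  · intro x hx y hy hxy
    have := hg1 (hY x hx) (hY y hy) (by linarith)
    dsimp only
    gcongr
  · intro x hx y hy hxy
    have h2 := hg2 (hY x hx) (hY y hy) (by linarith)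
    dsimp only at h2 ⊢
    have h3 := right_mono hβ hx.1 hxy hy.2
    have w1 := wF_pos (be γ) hx.1 hx.2
    have w2 := wF_pos (be γ) hy.1 hy.2
    have w3 := wF_pos (be γ) (hY x hx).1 (hY x hx).2
    have w4 := wF_pos (be γ) (hY y hy).1 (hY y hy).2
    rw [mul_assoc, mul_assoc, mul_comm (ENNReal.ofReal (1/2)), mul_comm (ENNReal.ofReal (1/2)), ← mul_assoc, ← mul_assoc]
    gcongr ?_ * _
    refine enn_aux w3 w4 (Real.sqrt_nonneg _) (Real.sqrt_nonneg _) h2 ?_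
    have := Real.sqrt_le_sqrt h3
    rw [Real.sqrt_mul w1.le, Real.sqrt_mul w2.le, Real.sqrt_sq w3.le, Real.sqrt_sq w4.le] at this
    exact this
  · intro x hx
    have h2 := hg2 (hY x hx) one_mem (hY x hx).2
    dsimp only at h2 ⊢
    norm_num
    have hw := wF_pos (be γ) half_mem.1 half_mem.2
    have h3 : g ((1 + x) / 2) * ENNReal.ofReal (wF (be γ) (1/2)) ≤ g 1 * ENNReal.ofReal (wF (be γ) 1) := by
      refine le_trans ?_ h2
      gcongr
      exact wF_mono hβ half_mem (hY x hx) (by linarith [hx.1])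
    rw [← mul_assoc]
    gcongr
    have := enn_aux (b1 := 1) (b2 := cD γ) hw (wF_pos (be γ) one_pos le_rfl) zero_le_one 
      (by linarith [one_le_cD hγ0 hγ1]) h3 (by unfold cD; field_simp; rfl)
    simpa [mul_comm] using this
  · refine push_branch measurableSet_Ioc (Ioc_subset_Ioc_left (by norm_num)) (d := fun _ => 2) ?_ (fun _ _ => two_pos) ?_ ?_ ?_
    · intro y hy
      have : HasDerivWithinAt (fun x : ℝ => 2 * x - 1) 2 (Ioc (1/2) 1) y := by
        simpa using (((hasDerivAt_id' y).const_mul 2).sub_const 1).hasDerivWithinAt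
      exact this.congr (fun z hz => T_right γ hz.1) (T_right γ hy.1)
    · intro x hx y hy h
      rw [T_right γ hx.1, T_right γ hy.1] at h
      linarith
    · apply Subset.antisymm
      · rintro _ ⟨x, hx, rfl⟩
        rw [T_right γ hx.1]
        exact ⟨by linarith [hx.1], by linarith [hx.2]⟩
      · intro y hy
        refine ⟨(1 + y) / 2, ⟨by linarith [hy.1], by linarith [hy.2]⟩, ?_⟩
        rw [T_right γ (by linarith [hy.1])]; ring
    · intro y hy
      rw [T_right γ hy.1, show (1 + (2 * y - 1)) / 2 = y by ring, mul_comm, mul_assoc, ← ENNReal.ofReal_mul (by norm_num)]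
      norm_num

lemma MP.MK (hγ0 : 0 < γ) (hγ1 : γ ≤ 1) {ρ : Measure ℝ} (h : MP γ ρ) : MK γ ρ := by
  obtain ⟨g, h1, h2, h3, rfl⟩ := h
  have hc := one_le_cD hγ0 hγ1
  refine ⟨g, ⟨h1, ?_⟩, ?_, rfl⟩
  · intro x hx y hy hxy
    have hv := h2 hx hy hxy
    have w1 := wF_pos (be γ) hx.1 hx.2
    have w2 := wF_pos (be γ) hy.1 hy.2
    have := wF_mono (be_nonneg hγ0 hγ1) hx hy hxy
    have e : ∀ x ∈ Ioc (0:ℝ) 1, wF (be γ) x = vF (be γ) x * vF (be γ) x := fun x hx => 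
      (Real.mul_self_sqrt (wF_pos (be γ) hx.1 hx.2).le).symm
    have hvm : vF (be γ) x ≤ vF (be γ) y := Real.sqrt_le_sqrt this
    dsimp only at hv ⊢
    rw [e x hx, e y hy, ENNReal.ofReal_mul (show 0 ≤ vF (be γ) x from Real.sqrt_nonneg _),
      ENNReal.ofReal_mul (show 0 ≤ vF (be γ) y from Real.sqrt_nonneg _),
      ← mul_assoc, ← mul_assoc]
    gcongr
  · intro x hx
    refine (h3 x hx).trans ?_
    gcongr
    linarith

lemma MK.MW {ρ : Measure ℝ} (h : MK γ ρ) : MW γ ρ := by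
  obtain ⟨g, h1, _, h3⟩ := h
  exact ⟨g, h1, h3⟩

lemma MK_mI (hγ0 : 0 < γ) (hγ1 : γ ≤ 1) : MK γ mI := by
  refine ⟨fun _ => 1, ⟨fun _ _ _ _ _ => le_rfl, ?_⟩, ?_, by simp⟩
  · intro x hx y hy hxy
    dsimp only
    gcongr
    exact wF_mono (be_nonneg hγ0 hγ1) hx hy hxy
  · intro x hx
    simp only [mul_one]
    rw [ENNReal.one_le_ofReal]
    linarith [one_le_cD hγ0 hγ1]

lemma aemeas_anti {g : ℝ → ℝ≥0∞} (h : AntitoneOn g (Ioc 0 1)) : AEMeasurable g mI :=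
  aemeasurable_restrict_of_antitoneOn measurableSet_Ioc h

lemma sum_withDensity {ι : Type*} [Countable ι] (g : ι → ℝ → ℝ≥0∞) (h : ∀ i, AntitoneOn (g i) (Ioc 0 1)) :
    Measure.sum (fun i => mI.withDensity (g i)) = mI.withDensity (fun x => ∑' i, g i x) := by
  ext E hE
  rw [Measure.sum_apply _ hE, withDensity_apply _ hE, lintegral_tsum (fun i => (aemeas_anti (h i)).restrict)]
  congr with i
  rw [withDensity_apply _ hE]

lemma MK_sum {ι : Type*} [Countable ι] {ρ : ι → Measure ℝ} (h : ∀ i, MK γ (ρ i)) : MK γ (Measure.sum ρ) := by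
  choose g h1 h2 h3 using h
  refine ⟨fun x => ∑' i, g i x, ⟨?_, ?_⟩, ?_, ?_⟩
  · intro x hx y hy hxy
    exact ENNReal.tsum_le_tsum fun i => (h1 i).1 hx hy hxy
  · intro x hx y hy hxy
    dsimp only
    rw [← ENNReal.tsum_mul_right, ← ENNReal.tsum_mul_right]
    exact ENNReal.tsum_le_tsum fun i => (h1 i).2 hx hy hxy
  · intro x hx
    dsimp only
    rw [← ENNReal.tsum_mul_left]
    exact ENNReal.tsum_le_tsum fun i => h2 i x hx
  · rw [← sum_withDensity g fun i => (h1 i).1]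
    congr with i : 1
    exact h3 i

lemma MP_sum {ι : Type*} [Countable ι] {ρ : ι → Measure ℝ} (h : ∀ i, MP γ (ρ i)) : MP γ (Measure.sum ρ) := by
  choose g h1 h1' h2 h3 using h
  refine ⟨fun x => ∑' i, g i x, ?_, ?_, ?_, ?_⟩
  · intro x hx y hy hxy
    exact ENNReal.tsum_le_tsum fun i => (h1 i) hx hy hxy
  · intro x hx y hy hxy
    dsimp only
    rw [← ENNReal.tsum_mul_right, ← ENNReal.tsum_mul_right]
    exact ENNReal.tsum_le_tsum fun i => (h1' i) hx hy hxy
  · intro x hx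
    dsimp only
    rw [← ENNReal.tsum_mul_left]
    exact ENNReal.tsum_le_tsum fun i => h2 i x hx
  · rw [← sum_withDensity g fun i => (h1 i)]
    congr with i : 1
    exact h3 i

lemma MK_smul {ρ : Measure ℝ} (h : MK γ ρ) (c : ℝ≥0∞) (hc : c ≠ ∞) : MK γ (c • ρ) := by
  obtain ⟨g, h1, h2, rfl⟩ := h
  refine ⟨c • g, ⟨?_, ?_⟩, ?_, (withDensity_smul' _ _ hc).symm⟩
  · intro x hx y hy hxy
    have := h1.1 hx hy hxy
    simp only [Pi.smul_apply, smul_eq_mul]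
    gcongr
  · intro x hx y hy hxy
    have := h1.2 hx hy hxy
    simp only [Pi.smul_apply, smul_eq_mul, mul_assoc] at this ⊢
    gcongr
  · intro x hx
    have := h2 x hx
    simp only [Pi.smul_apply, smul_eq_mul]
    calc c * g x ≤ c * (ENNReal.ofReal (2 * cD γ) * g 1) := by gcongr
      _ = _ := by ring

lemma mass_ge {g : ℝ → ℝ≥0∞} (h : AntitoneOn g (Ioc 0 1)) : g 1 ≤ (mI.withDensity g) univ := by
  rw [withDensity_apply _ MeasurableSet.univ, Measure.restrict_univ]
  calc g 1 = ∫⁻ x, g 1 ∂mI := by simp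
    _ ≤ _ := by
      refine lintegral_mono_ae ?_
      filter_upwards [ae_mI] with x hx
      exact h hx one_mem hx.2

lemma mass_le {g : ℝ → ℝ≥0∞} {C : ℝ≥0∞} (h : ∀ x ∈ Ioc (0:ℝ) 1, g x ≤ C * g 1) :
    (mI.withDensity g) univ ≤ C * g 1 := by
  rw [withDensity_apply _ MeasurableSet.univ, Measure.restrict_univ]
  calc _ ≤ ∫⁻ x, C * g 1 ∂mI := by
        refine lintegral_mono_ae ?_
        filter_upwards [ae_mI] with x hx
        exact h x hx
    _ = _ := by simp

lemma MK_le {ρ : Measure ℝ} (h : MK γ ρ) : ρ ≤ (ENNReal.ofReal (2 * cD γ) * ρ univ) • mI := by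
  obtain ⟨g, h1, h2, rfl⟩ := h
  have h3 := mass_ge h1.1
  set M := (mI.withDensity g) univ
  rw [← withDensity_const]
  refine withDensity_mono ?_
  filter_upwards [ae_mI] with x hx
  refine (h2 x hx).trans ?_
  gcongr

lemma MK_ge {ρ : Measure ℝ} (h : MK γ ρ) : (ρ univ) • mI ≤ ENNReal.ofReal (2 * cD γ) • ρ := by
  obtain ⟨g, h1, h2, rfl⟩ := h
  have h3 := mass_le h2
  set M := (mI.withDensity g) univ
  rw [← withDensity_const, ← withDensity_smul' _ _ ENNReal.ofReal_ne_top]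
  refine withDensity_mono ?_
  filter_upwards [ae_mI] with x hx
  refine h3.trans ?_
  simp only [Pi.smul_apply, smul_eq_mul]
  gcongr
  exact h1.1 hx one_mem hx.2

/-- regeneration rate -/
noncomputable def kR (γ : ℝ) : ℝ := 1 / (2 * cD γ)

/-- regeneration -/
lemma MP_regen (hγ0 : 0 < γ) (hγ1 : γ ≤ 1) {ρ : Measure ℝ} (h : MP γ ρ) (hfin : ρ univ ≠ ∞) :
    ∃ ρ', MK γ ρ' ∧ ρ = (ENNReal.ofReal (kR γ) * ρ univ) • mI + ρ' := by
  obtain ⟨g, h1, h2, h3, rfl⟩ := h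
  have hC := one_le_cD hγ0 hγ1
  have m1 := mass_ge h1
  have m2 := mass_le h3
  set M := (mI.withDensity g) univ
  have hg1 : g 1 ≠ ∞ := (m1.trans_lt (lt_top_iff_ne_top.2 hfin)).ne
  set c := ENNReal.ofReal (kR γ) * M with hc
  have hc2 : 2 * c ≤ g 1 := by
    calc 2 * c ≤ 2 * (ENNReal.ofReal (kR γ) * (ENNReal.ofReal (cD γ) * g 1)) := by
          rw [hc]; gcongr
      _ = (2 * (ENNReal.ofReal (kR γ) * ENNReal.ofReal (cD γ))) * g 1 := by ring
      _ = 1 * g 1 := by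
        congr 1
        have : (2:ℝ≥0∞) = ENNReal.ofReal 2 := by simp
        rw [this, ← ENNReal.ofReal_mul (by unfold kR; positivity), ← ENNReal.ofReal_mul (by norm_num), kR]
        rw [show 2 * (1 / (2 * cD γ) * cD γ) = 1 by field_simp]
        simp
      _ = g 1 := one_mul _
  have hcfin : c ≠ ∞ := ENNReal.mul_ne_top ENNReal.ofReal_ne_top hfin
  have hge : ∀ x ∈ Ioc (0:ℝ) 1, 2 * c ≤ g x := fun x hx => hc2.trans (h1 hx one_mem hx.2)
  have hcg : ∀ x ∈ Ioc (0:ℝ) 1, c ≤ g x := fun x hx => by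
    refine le_trans ?_ (hge x hx)
    rw [two_mul]; exact le_self_add
  have hgfin : ∀ x ∈ Ioc (0:ℝ) 1, g x ≠ ∞ := fun x hx =>
    ((h3 x hx).trans_lt (ENNReal.mul_lt_top ENNReal.ofReal_lt_top (lt_top_iff_ne_top.2 hg1))).ne
  refine ⟨mI.withDensity (fun x => g x - c), ⟨fun x => g x - c, ⟨?_, ?_⟩, ?_, rfl⟩, ?_⟩
  · intro x hx y hy hxy
    exact tsub_le_tsub_right (h1 hx hy hxy) c
  · intro x hx y hy hxy
    have hv := h2 hx hy hxy
    have gx := hge x hx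
    have gy := hge y hy
    have fx := hgfin x hx
    have fy := hgfin y hy
    have w1 := wF_pos (be γ) hx.1 hx.2
    have w2 := wF_pos (be γ) hy.1 hy.2
    have e : ∀ x ∈ Ioc (0:ℝ) 1, wF (be γ) x = vF (be γ) x * vF (be γ) x := fun x hx => 
      (Real.mul_self_sqrt (wF_pos (be γ) hx.1 hx.2).le).symm
    have hvm : vF (be γ) x ≤ vF (be γ) y := Real.sqrt_le_sqrt (wF_mono (be_nonneg hγ0 hγ1) hx hy hxy)
    have v1 : 0 < vF (be γ) x := Real.sqrt_pos.2 w1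
    have v2 : 0 < vF (be γ) y := Real.sqrt_pos.2 w2
    have cx := hcg x hx
    have cy := hcg y hy
    dsimp only at hv ⊢
    rw [e x hx, e y hy]
    generalize vF (be γ) x = a at *
    generalize vF (be γ) y = b at *
    generalize g x = p at *
    generalize g y = q at *
    clear_value c
    lift p to NNReal using fx
    lift q to NNReal using fy
    lift c to NNReal using hcfin
    rw [← ENNReal.coe_sub, ← ENNReal.coe_sub]
    have hp : (p : ℝ≥0∞) = ENNReal.ofReal p := by simp
    have hq : (q : ℝ≥0∞) = ENNReal.ofReal q := by simp
    rw [hp, hq, ← ENNReal.ofReal_mul (by positivity), ← ENNReal.ofReal_mul (by positivity),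
      ENNReal.ofReal_le_ofReal_iff (by positivity)] at hv
    have cx' : c ≤ p := by exact_mod_cast cx
    have cy' : c ≤ q := by exact_mod_cast cy
    have gy' : 2 * c ≤ q := by exact_mod_cast gy
    rw [← ENNReal.ofReal_coe_nnreal, ← ENNReal.ofReal_coe_nnreal, NNReal.coe_sub cx', NNReal.coe_sub cy']
    have hpc : (c:ℝ) ≤ p := by exact_mod_cast cx'
    have hqc : (c:ℝ) ≤ q := by exact_mod_cast cy'
    have hqc2 : 2 * (c:ℝ) ≤ q := by exact_mod_cast gy'
    rw [← ENNReal.ofReal_mul (by linarith), ← ENNReal.ofReal_mul (by linarith)]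
    apply ENNReal.ofReal_le_ofReal
    have hc0 : (0:ℝ) ≤ c := c.2
    have k1 : (p:ℝ) * a * a ≤ q * b * a := by gcongr
    have k2 : 0 ≤ (b - a) * (q * b - c * (a + b)) := by
      apply mul_nonneg (by linarith)
      nlinarith
    nlinarith
  · intro x hx
    dsimp only
    calc g x - c ≤ g x := tsub_le_self
      _ ≤ ENNReal.ofReal (cD γ) * g 1 := h3 x hx
      _ ≤ ENNReal.ofReal (cD γ) * (2 * (g 1 - c)) := by
        gcongr
        rw [two_mul]
        calc g 1 = (g 1 - c) + c := (tsub_add_cancel_of_le (hcg 1 one_mem)).symm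
          _ ≤ _ := by
            gcongr
            refine ENNReal.le_sub_of_add_le_left hcfin ?_
            rw [← two_mul]; exact hc2
      _ = _ := by
        rw [← mul_assoc, mul_comm (ENNReal.ofReal (cD γ)) 2, ENNReal.ofReal_mul (by norm_num : (0:ℝ) ≤ 2)]
        simp
  · rw [← withDensity_const, ← withDensity_add_left measurable_const]
    refine withDensity_congr_ae ?_
    filter_upwards [ae_mI] with x hx
    simp only [Pi.add_apply]
    exact (add_tsub_cancel_of_le (hcg x hx)).symm

end LD
end

section
open MeasureTheory Set
open scoped ENNReal

namespace LD

noncomputable def kk (γ x : ℝ) : ℕ := sInf {n | 1/2 < (Tmap γ)^[n] x}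
noncomputable def GG (γ x : ℝ) : ℝ := (Tmap γ)^[kk γ x + 1] x
def JJ (γ : ℝ) (k : ℕ) : Set ℝ := {x | x ∈ Ioc (0:ℝ) 1 ∧ kk γ x = k}

variable {γ : ℝ}

lemma kk_gt {x : ℝ} (hx : 1/2 < x) : kk γ x = 0 := by
  unfold kk
  rw [Nat.sInf_eq_zero]
  left; simpa using hx

lemma kk_le {x : ℝ} (hγ0 : 0 < γ) (hγ1 : γ ≤ 1) (hx : x ∈ Ioc (0:ℝ) (1/2)) : kk γ x = kk γ (Tmap γ x) + 1 := by
  unfold kk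
  have h := Nat.sInf_add (n := 1) (p := fun n => 1/2 < (Tmap γ)^[n] x) (by
    rw [Nat.one_le_iff_ne_zero]
    intro h0
    rw [Nat.sInf_eq_zero] at h0
    rcases h0 with h0 | h0
    · have : 1/2 < x := h0
      linarith [hx.2]
    · obtain ⟨n, hn⟩ := exists_escape hγ0 hγ1 (x := x) ⟨hx.1, by linarith [hx.2]⟩
      have : n ∈ (∅ : Set ℕ) := h0 ▸ hn
      exact this)
  exact h.symm

lemma GG_gt {x : ℝ} (hx : 1/2 < x) : GG γ x = Tmap γ x := by
  simp [GG, kk_gt hx]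

lemma GG_le {x : ℝ} (hγ0 : 0 < γ) (hγ1 : γ ≤ 1) (hx : x ∈ Ioc (0:ℝ) (1/2)) : GG γ x = GG γ (Tmap γ x) := by
  unfold GG
  rw [kk_le hγ0 hγ1 hx, Function.iterate_succ_apply _ (_ + 1)]

lemma GG_mem (hγ0 : 0 < γ) (hγ1 : γ ≤ 1) {x : ℝ} (hx : x ∈ Ioc (0:ℝ) 1) : GG γ x ∈ Ioc (0:ℝ) 1 :=
  T_iter_mem hγ0 hγ1 hx _

lemma GG_iter_mem (hγ0 : 0 < γ) (hγ1 : γ ≤ 1) {x : ℝ} (hx : x ∈ Ioc (0:ℝ) 1) (n : ℕ) : (GG γ)^[n] x ∈ Ioc (0:ℝ) 1 := by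
  induction n with
  | zero => exact hx
  | succ n ih => rw [Function.iterate_succ_apply']; exact GG_mem hγ0 hγ1 ih

lemma T_iter_meas (n : ℕ) : Measurable (Tmap γ)^[n] := T_meas.iterate n

lemma kk_meas : Measurable (kk γ) := by
  apply measurable_to_countable'
  intro n
  have : kk γ ⁻¹' {n} = ({x | 1/2 < (Tmap γ)^[n] x} ∩ ⋂ j ∈ Finset.range n, {x | (Tmap γ)^[j] x ≤ 1/2}) ∪
      ({x | n = 0} ∩ ⋂ j, {x | (Tmap γ)^[j] x ≤ 1/2}) := by
    ext x
    simp only [mem_preimage, mem_singleton_iff, mem_union, mem_inter_iff, mem_iInter, mem_ofPred_eq, Finset.mem_range]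
    constructor
    · intro h
      by_cases hne : ({n | 1/2 < (Tmap γ)^[n] x} : Set ℕ).Nonempty
      · left
        refine ⟨h ▸ Nat.sInf_mem hne, fun j hj => ?_⟩
        have := Nat.notMem_of_lt_sInf (s := {n | 1/2 < (Tmap γ)^[n] x}) (m := j) (by unfold kk at h; omega)
        simpa using this
      · right
        rw [not_nonempty_iff_eq_empty] at hne
        refine ⟨?_, fun j => ?_⟩
        · rw [← h, kk, hne]; simp
        · by_contra hj
          push Not at hj
          have : j ∈ (∅ : Set ℕ) := hne ▸ hj
          exact this
    · rintro (⟨h1, h2⟩ | ⟨h1, h2⟩)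
      · apply le_antisymm
        · exact Nat.sInf_le h1
        · by_contra hlt
          push Not at hlt
          have := h2 _ hlt
          have hm : kk γ x ∈ {n | 1/2 < (Tmap γ)^[n] x} := Nat.sInf_mem ⟨n, h1⟩
          have hm' : 1/2 < (Tmap γ)^[kk γ x] x := hm
          linarith
      · subst h1
        unfold kk
        rw [Nat.sInf_eq_zero]
        right
        ext j
        simpa using h2 j
  rw [this]
  refine MeasurableSet.union (MeasurableSet.inter ?_ ?_) (MeasurableSet.inter ?_ ?_)
  · exact measurableSet_lt measurable_const (T_iter_meas n)
  · exact Finset.measurableSet_biInter _ fun j _ => measurableSet_le (T_iter_meas j) measurable_const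
  · exact MeasurableSet.const _
  · exact MeasurableSet.iInter fun j => measurableSet_le (T_iter_meas j) measurable_const

lemma meas_count {α : Type*} [MeasurableSpace α] {H : ℕ → ℝ → α} (hH : ∀ n, Measurable (H n)) {k : ℝ → ℕ} (hk : Measurable k) 
    {g : ℝ → ℝ} (hg : Measurable g) : Measurable (fun x => H (k x) (g x)) := by
  have : Measurable (fun p : ℕ × ℝ => H p.1 p.2) := measurable_from_prod_countable_right hH
  exact this.comp (hk.prodMk hg)

lemma GG_meas : Measurable (GG γ) :=
  meas_count (H := fun n x => (Tmap γ)^[n+1] x) (fun _ => T_iter_meas _) kk_meas measurable_id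

lemma GG_iter_meas (n : ℕ) : Measurable (GG γ)^[n] := GG_meas.iterate n

lemma JJ_meas (k : ℕ) : MeasurableSet (JJ γ k) :=
  measurableSet_Ioc.inter (kk_meas (measurableSet_singleton k))

lemma JJ_zero (hγ0 : 0 < γ) (hγ1 : γ ≤ 1) : JJ γ 0 = Ioc (1/2) 1 := by
  ext x
  constructor
  · rintro ⟨h1, h2⟩
    refine ⟨?_, h1.2⟩
    by_contra hx
    push Not at hx
    rw [kk_le hγ0 hγ1 ⟨h1.1, hx⟩] at h2
    omega
  · rintro ⟨h1, h2⟩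
    exact ⟨⟨by linarith, h2⟩, kk_gt h1⟩

lemma JJ_succ (hγ0 : 0 < γ) (hγ1 : γ ≤ 1) (k : ℕ) : JJ γ (k+1) = Tmap γ ⁻¹' (JJ γ k) ∩ Ioc 0 (1/2) := by
  ext x
  constructor
  · rintro ⟨h1, h2⟩
    have hx : x ≤ 1/2 := by
      by_contra hx
      push Not at hx
      rw [kk_gt hx] at h2; omega
    rw [kk_le hγ0 hγ1 ⟨h1.1, hx⟩] at h2
    exact ⟨⟨T_mem hγ0 hγ1 h1, by omega⟩, h1.1, hx⟩
  · rintro ⟨⟨h1, h2⟩, h3⟩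
    refine ⟨⟨h3.1, by linarith [h3.2]⟩, ?_⟩
    rw [kk_le hγ0 hγ1 h3, h2]

lemma push_J (hγ0 : 0 < γ) (hγ1 : γ ≤ 1) (k : ℕ) : ∀ ρ : Measure ℝ, MW γ ρ → 
    MP γ ((ρ.restrict (JJ γ k)).map (GG γ)) := by
  induction k with
  | zero =>
    intro ρ h
    rw [JJ_zero hγ0 hγ1]
    have := MP_right hγ0 hγ1 h
    rwa [Measure.map_congr (g := Tmap γ)]
    filter_upwards [ae_restrict_mem measurableSet_Ioc] with x hx
    exact GG_gt hx.1
  | succ k ih =>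
    intro ρ h
    have := ih _ (MW_left hγ0 hγ1 h)
    rw [JJ_succ hγ0 hγ1]
    rw [Measure.restrict_map T_meas (JJ_meas k), Measure.map_map GG_meas T_meas,
      Measure.restrict_restrict (T_meas (JJ_meas k))] at this
    rwa [Measure.map_congr (g := GG γ ∘ Tmap γ)]
    filter_upwards [ae_restrict_mem ((T_meas (JJ_meas k)).inter measurableSet_Ioc)] with x hx
    exact GG_le hγ0 hγ1 hx.2

lemma MW_compl {ρ : Measure ℝ} (h : MW γ ρ) : ρ (Ioc (0:ℝ) 1)ᶜ = 0 := by
  obtain ⟨g, _, rfl⟩ := h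
  exact withDensity_absolutelyContinuous _ _ mI_compl

lemma JJ_union : (⋃ k, JJ γ k) = Ioc 0 1 := by
  ext x; simp [JJ]

lemma JJ_disj : Pairwise (Function.onFun Disjoint (JJ γ)) := by
  intro i j hij
  refine Set.disjoint_left.2 ?_
  rintro x ⟨_, h1⟩ ⟨_, h2⟩
  omega

lemma sum_JJ {ρ : Measure ℝ} (h : ρ (Ioc (0:ℝ) 1)ᶜ = 0) : ρ = Measure.sum (fun k => ρ.restrict (JJ γ k)) := by
  rw [← Measure.restrict_iUnion JJ_disj JJ_meas, JJ_union]
  symm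
  rw [Measure.restrict_eq_self_of_ae_mem]
  exact h

lemma push_MP (hγ0 : 0 < γ) (hγ1 : γ ≤ 1) {ρ : Measure ℝ} (h : MW γ ρ) : MP γ (ρ.map (GG γ)) := by
  rw [sum_JJ (γ := γ) (MW_compl h), Measure.map_sum GG_meas.aemeasurable]
  exact MP_sum fun k => push_J hγ0 hγ1 k ρ h

lemma push_MK (hγ0 : 0 < γ) (hγ1 : γ ≤ 1) {ρ : Measure ℝ} (h : MK γ ρ) : MK γ (ρ.map (GG γ)) :=
  (push_MP hγ0 hγ1 h.MW).MK hγ0 hγ1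

lemma push_MK_iter (hγ0 : 0 < γ) (hγ1 : γ ≤ 1) {ρ : Measure ℝ} (h : MK γ ρ) (n : ℕ) : MK γ (ρ.map (GG γ)^[n]) := by
  induction n with
  | zero => simpa using h
  | succ n ih => 
    rw [Function.iterate_succ', ← Measure.map_map GG_meas (GG_iter_meas n)]
    exact push_MK hγ0 hγ1 ih

/-- itinerary -/
noncomputable def itin (γ : ℝ) : ℕ → ℝ → List ℕ
  | 0, _ => []
  | b+1, x => kk γ x :: itin γ b (GG γ x)

lemma itin_meas {α : Type*} [MeasurableSpace α] (b : ℕ) : ∀ F : List ℕ → α, Measurable (fun x => F (itin γ b x)) := by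
  induction b with
  | zero =>
    intro F
    show Measurable (fun _ : ℝ => F [])
    exact measurable_const
  | succ b ih =>
    intro F
    exact meas_count (H := fun n x => F (n :: itin γ b x)) (fun n => ih (fun l => F (n :: l))) kk_meas GG_meas

lemma itin_drop (M q : ℕ) : ∀ x, itin γ q ((GG γ)^[M] x) = (itin γ (M+q) x).drop M := by
  induction M with
  | zero => intro x; simp
  | succ M ih =>
    intro x
    rw [Function.iterate_succ_apply, ih, show M + 1 + q = (M + q) + 1 by ring]
    rfl

lemma MK_cyl (hγ0 : 0 < γ) (hγ1 : γ ≤ 1) (b : ℕ) : ∀ (F : List ℕ → ℝ≥0∞) (_ : ∀ l, F l ≠ ∞) (ρ : Measure ℝ) (_ : MK γ ρ),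
    MK γ ((ρ.withDensity (fun x => F (itin γ b x))).map (GG γ)^[b]) := by
  induction b with
  | zero =>
    intro F hF ρ h
    simp only [itin, Function.iterate_zero, Measure.map_id, withDensity_const]
    exact MK_smul h _ (hF _)
  | succ b ih =>
    intro F hF ρ h
    have e : ρ.withDensity (fun x => F (itin γ (b+1) x)) = 
        Measure.sum (fun k => (ρ.restrict (JJ γ k)).withDensity (fun x => F (k :: itin γ b (GG γ x)))) := by
      conv_lhs => rw [sum_JJ (γ := γ) (MW_compl h.MW), withDensity_sum]
      congr with k : 1
      refine withDensity_congr_ae ?_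
      filter_upwards [ae_restrict_mem (JJ_meas k)] with x hx
      simp only [itin, hx.2]
    rw [e, Measure.map_sum (GG_iter_meas _).aemeasurable]
    refine MK_sum fun k => ?_
    have h2 := ih (fun l => F (k :: l)) (fun l => hF _) _ ((push_J hγ0 hγ1 k ρ h.MW).MK hγ0 hγ1)
    have hm : Measurable (fun x => F (k :: itin γ b x)) := itin_meas b (fun l => F (k :: l))
    convert h2 using 1
    rw [Function.iterate_succ, ← Measure.map_map (GG_iter_meas b) GG_meas]
    congr 1
    ext E hE
    rw [Measure.map_apply GG_meas hE, withDensity_apply _ (GG_meas hE), withDensity_apply _ hE,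
      Measure.restrict_map GG_meas hE, lintegral_map hm GG_meas]

lemma expand_J (hγ0 : 0 < γ) (hγ1 : γ ≤ 1) (k : ℕ) : ∀ x y : ℝ, x ∈ JJ γ k → y ∈ JJ γ k → 
    |x - y| ≤ |GG γ x - GG γ y| / 2 := by
  induction k with
  | zero =>
    intro x y hx hy
    rw [JJ_zero hγ0 hγ1] at hx hy
    rw [GG_gt hx.1, GG_gt hy.1, T_right γ hx.1, T_right γ hy.1,
      show 2 * x - 1 - (2 * y - 1) = 2 * (x - y) by ring, abs_mul]
    norm_num
  | succ k ih =>
    intro x y hx hy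
    rw [JJ_succ hγ0 hγ1] at hx hy
    have := ih _ _ hx.1 hy.1
    rw [← GG_le hγ0 hγ1 hx.2, ← GG_le hγ0 hγ1 hy.2] at this
    refine le_trans ?_ this
    rcases le_total x y with h | h
    · have h1 := T_expand hγ0 hγ1 hx.2 hy.2 h
      rw [abs_sub_comm, abs_sub_comm (Tmap γ x), abs_of_nonneg (by linarith), abs_of_nonneg (by linarith)]
      exact h1
    · have h1 := T_expand hγ0 hγ1 hy.2 hx.2 h
      rw [abs_of_nonneg (by linarith), abs_of_nonneg (by linarith)]
      exact h1

lemma itin_close (hγ0 : 0 < γ) (hγ1 : γ ≤ 1) (q : ℕ) : ∀ x y : ℝ, x ∈ Ioc (0:ℝ) 1 → y ∈ Ioc (0:ℝ) 1 → 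
    itin γ q x = itin γ q y → |x - y| ≤ (1/2)^q := by
  induction q with
  | zero =>
    intro x y hx hy _
    rw [pow_zero, abs_le]
    constructor <;> linarith [hx.1, hx.2, hy.1, hy.2]
  | succ q ih =>
    intro x y hx hy h
    simp only [itin, List.cons.injEq] at h
    have h1 := ih _ _ (GG_mem hγ0 hγ1 hx) (GG_mem hγ0 hγ1 hy) h.2
    have h2 := expand_J hγ0 hγ1 (kk γ y) x y ⟨hx, h.1⟩ ⟨hy, rfl⟩
    rw [pow_succ]; linarith

end LD
end

section
open MeasureTheory Set Filter Topology
open scoped ENNReal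

namespace LD

variable {γ : ℝ}

structure InvM (γ : ℝ) (ν : Measure ℝ) : Prop where
  prob : IsProbabilityMeasure ν
  supp : ν (Ioc (0:ℝ) 1)ᶜ = 0
  ac : ν ≪ volume
  inv : ∀ A : Set ℝ, MeasurableSet A → ν (Tmap γ ⁻¹' A) = ν A

noncomputable def muG (γ : ℝ) (ν : Measure ℝ) : Measure ℝ := (ν.restrict (Ioc (1/2) 1)).map (Tmap γ)

lemma muG_apply {ν : Measure ℝ} {E : Set ℝ} (hE : MeasurableSet E) :
    muG γ ν E = ν (Tmap γ ⁻¹' E ∩ Ioc (1/2) 1) := by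
  rw [muG, Measure.map_apply T_meas hE, Measure.restrict_apply (T_meas hE)]

lemma nu_split {ν : Measure ℝ} (h : ν (Ioc (0:ℝ) 1)ᶜ = 0) (A : Set ℝ) : 
    ν A = ν (A ∩ Ioc (1/2) 1) + ν (A ∩ Ioc 0 (1/2)) := by
  have e : ν A = ν (A ∩ Ioc 0 1) := by
    refine (measure_inter_conull ?_).symm
    exact h
  rw [e, ← measure_inter_add_sdiff (A ∩ Ioc 0 1) (measurableSet_Ioc (a := (1/2:ℝ)) (b := 1))]
  congr 2
  · ext x
    simp only [mem_inter_iff, mem_Ioc]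
    constructor
    · rintro ⟨⟨a, b⟩, c⟩; exact ⟨a, c⟩
    · rintro ⟨a, c⟩; exact ⟨⟨a, by linarith, c.2⟩, c⟩
  · ext x
    simp only [mem_inter_iff, mem_Ioc, Set.mem_sdiff, not_and, not_le]
    constructor
    · rintro ⟨⟨a, b⟩, c⟩
      refine ⟨a, b.1, ?_⟩
      by_contra hx
      push Not at hx
      linarith [c hx, b.2]
    · rintro ⟨a, c⟩; exact ⟨⟨a, c.1, by linarith⟩, fun hx => by linarith⟩

lemma muG_fin {ν : Measure ℝ} (h : InvM γ ν) : IsFiniteMeasure (muG γ ν) := by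
  have := h.prob
  unfold muG; infer_instance

lemma muG_inv (hγ0 : 0 < γ) (hγ1 : γ ≤ 1) {ν : Measure ℝ} (h : InvM γ ν) : (muG γ ν).map (GG γ) = muG γ ν := by
  have := h.prob
  ext E hE
  rw [Measure.map_apply GG_meas hE, muG_apply (GG_meas hE), muG_apply hE]
  have hD := GG_meas (γ := γ) hE
  have h1 := h.inv _ hD
  rw [nu_split h.supp (Tmap γ ⁻¹' (GG γ ⁻¹' E)), nu_split h.supp (GG γ ⁻¹' E)] at h1
  have e1 : Tmap γ ⁻¹' (GG γ ⁻¹' E) ∩ Ioc 0 (1/2) = GG γ ⁻¹' E ∩ Ioc 0 (1/2) := by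
    ext x
    simp only [mem_inter_iff, mem_preimage]
    refine and_congr_left fun hx => ?_
    rw [GG_le hγ0 hγ1 hx]
  have e2 : GG γ ⁻¹' E ∩ Ioc (1/2) 1 = Tmap γ ⁻¹' E ∩ Ioc (1/2) 1 := by
    ext x
    simp only [mem_inter_iff, mem_preimage]
    refine and_congr_left fun hx => ?_
    rw [GG_gt hx.1]
  rw [e1, e2] at h1
  exact (ENNReal.add_left_inj (measure_ne_top _ _)).1 h1

lemma muG_inv_iter (hγ0 : 0 < γ) (hγ1 : γ ≤ 1) {ν : Measure ℝ} (h : InvM γ ν) (n : ℕ) : 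
    (muG γ ν).map (GG γ)^[n] = muG γ ν := by
  induction n with
  | zero => simp
  | succ n ih => rw [Function.iterate_succ', ← Measure.map_map GG_meas (GG_iter_meas n), ih, muG_inv hγ0 hγ1 h]

def AA (γ : ℝ) (E : Set ℝ) (j : ℕ) : Set ℝ := (Tmap γ)^[j] ⁻¹' E ∩ {x | j ≤ kk γ x}

lemma kk_ge_meas (j : ℕ) : MeasurableSet {x | j ≤ kk γ x} := measurableSet_le measurable_const kk_meas

lemma AA_meas {E : Set ℝ} (hE : MeasurableSet E) (j : ℕ) : MeasurableSet (AA γ E j) :=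
  (T_iter_meas j hE).inter (kk_ge_meas j)

lemma AA_succ (hγ0 : 0 < γ) (hγ1 : γ ≤ 1) (E : Set ℝ) (j : ℕ) : 
    Tmap γ ⁻¹' (AA γ E j) ∩ Ioc 0 (1/2) = AA γ E (j+1) ∩ Ioc 0 1 := by
  ext x
  simp only [AA, mem_inter_iff, mem_preimage, mem_ofPred_eq]
  constructor
  · rintro ⟨⟨h1, h2⟩, h3⟩
    refine ⟨⟨h1, ?_⟩, h3.1, by linarith [h3.2]⟩
    rw [kk_le hγ0 hγ1 h3]; omega
  · rintro ⟨⟨h1, h2⟩, h3⟩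
    have hx : x ≤ 1/2 := by
      by_contra hx
      push Not at hx
      rw [kk_gt hx] at h2; omega
    rw [kk_le hγ0 hγ1 ⟨h3.1, hx⟩] at h2
    exact ⟨⟨h1, by omega⟩, h3.1, hx⟩

lemma nu_step (hγ0 : 0 < γ) (hγ1 : γ ≤ 1) {ν : Measure ℝ} (h : InvM γ ν) {E : Set ℝ} (hE : MeasurableSet E) (n : ℕ) :
    ν E = ∑ j ∈ Finset.range n, muG γ ν (AA γ E j) + ν (AA γ E n) := by
  induction n with
  | zero => simp [AA]
  | succ n ih =>
    rw [ih, Finset.sum_range_succ, add_assoc]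
    congr 1
    rw [muG_apply (AA_meas hE n), ← h.inv _ (AA_meas hE n), nu_split h.supp (Tmap γ ⁻¹' _), AA_succ hγ0 hγ1,
      measure_inter_conull (s := AA γ E (n+1)) h.supp]

lemma nu_kk_tendsto {ν : Measure ℝ} [IsFiniteMeasure ν] : Tendsto (fun n => ν {x | n ≤ kk γ x}) atTop (𝓝 0) := by
  have h := tendsto_measure_iInter_atTop (μ := ν) (s := fun n => {x | n ≤ kk γ x}) 
    (fun n => (kk_ge_meas n).nullMeasurableSet) (fun i j hij x hx => le_trans hij hx) ⟨0, measure_ne_top _ _⟩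
  have : (⋂ n, {x | n ≤ kk γ x}) = ∅ := by
    ext x
    simp only [mem_iInter, mem_ofPred_eq, mem_empty_iff_false, iff_false, not_forall, not_le]
    exact ⟨kk γ x + 1, by omega⟩
  rwa [this, measure_empty] at h

lemma kac (hγ0 : 0 < γ) (hγ1 : γ ≤ 1) {ν : Measure ℝ} (h : InvM γ ν) :
    ν = Measure.sum (fun j => ((muG γ ν).restrict {x | j ≤ kk γ x}).map (Tmap γ)^[j]) := by
  have := h.prob
  ext E hE
  rw [Measure.sum_apply _ hE]
  have e : ∀ j, (((muG γ ν).restrict {x | j ≤ kk γ x}).map (Tmap γ)^[j]) E = muG γ ν (AA γ E j) := fun j => by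
    rw [Measure.map_apply (T_iter_meas j) hE, Measure.restrict_apply (T_iter_meas j hE)]; rfl
  simp_rw [e]
  have h1 : Tendsto (fun n => ∑ j ∈ Finset.range n, muG γ ν (AA γ E j)) atTop (𝓝 (∑' j, muG γ ν (AA γ E j))) :=
    ENNReal.tendsto_nat_tsum _
  have h2 : Tendsto (fun n => ν (AA γ E n)) atTop (𝓝 0) :=
    tendsto_of_tendsto_of_tendsto_of_le_of_le tendsto_const_nhds (nu_kk_tendsto (γ := γ) (ν := ν)) (fun _ => zero_le) 
      (fun n => measure_mono inter_subset_right)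
  have h3 := h1.add h2
  rw [add_zero] at h3
  refine tendsto_nhds_unique ?_ h3
  simp_rw [← nu_step hγ0 hγ1 h hE]
  exact tendsto_const_nhds

lemma kac_lintegral (hγ0 : 0 < γ) (hγ1 : γ ≤ 1) {ν : Measure ℝ} (h : InvM γ ν) {u : ℝ → ℝ≥0∞} (hu : Measurable u) :
    ∫⁻ x, u x ∂ν = ∫⁻ x, ∑ j ∈ Finset.range (kk γ x + 1), u ((Tmap γ)^[j] x) ∂(muG γ ν) := by
  conv_lhs => rw [kac hγ0 hγ1 h]
  rw [lintegral_sum_measure]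
  have e : ∀ j, ∫⁻ x, u x ∂(((muG γ ν).restrict {x | j ≤ kk γ x}).map (Tmap γ)^[j]) = 
      ∫⁻ x, ({x | j ≤ kk γ x}.indicator (fun x => u ((Tmap γ)^[j] x))) x ∂(muG γ ν) := fun j => by
    rw [lintegral_map hu (T_iter_meas j), lintegral_indicator (kk_ge_meas j)]
  simp_rw [e]
  have hm : ∀ j, AEMeasurable ({x | j ≤ kk γ x}.indicator (fun x => u ((Tmap γ)^[j] x))) (muG γ ν) := fun j =>
    ((hu.comp (T_iter_meas j)).indicator (kk_ge_meas j)).aemeasurable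
  rw [← lintegral_tsum hm]
  refine lintegral_congr fun x => ?_
  rw [tsum_eq_sum (s := Finset.range (kk γ x + 1))]
  · refine Finset.sum_congr rfl fun j hj => ?_
    rw [Finset.mem_range] at hj
    rw [indicator_of_mem]
    show j ≤ kk γ x
    omega
  · intro j hj
    rw [Finset.mem_range] at hj
    rw [indicator_of_notMem]
    show ¬ j ≤ kk γ x
    omega

lemma muG_ne_zero (hγ0 : 0 < γ) (hγ1 : γ ≤ 1) {ν : Measure ℝ} (h : InvM γ ν) : muG γ ν univ ≠ 0 := by
  intro h0
  have := h.prob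
  have h1 := kac_lintegral hγ0 hγ1 h (u := fun _ => 1) measurable_const
  rw [Measure.measure_univ_eq_zero] at h0
  rw [h0] at h1
  simp at h1

lemma muG_le_nu (hγ0 : 0 < γ) (hγ1 : γ ≤ 1) {ν : Measure ℝ} (h : InvM γ ν) {E : Set ℝ} (hE : MeasurableSet E) :
    muG γ ν E ≤ ν E := by
  have := nu_step hγ0 hγ1 h hE 1
  rw [this]
  simp only [Finset.range_one, Finset.sum_singleton]
  refine le_trans (le_of_eq ?_) le_self_add
  simp [AA]

lemma muG_ac (hγ0 : 0 < γ) (hγ1 : γ ≤ 1) {ν : Measure ℝ} (h : InvM γ ν) : muG γ ν ≪ mI := by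
  refine Measure.AbsolutelyContinuous.mk fun E hE h0 => ?_
  have h1 : muG γ ν E ≤ ν E := muG_le_nu hγ0 hγ1 h hE
  have h2 : ν E = ν (E ∩ Ioc 0 1) := (measure_inter_conull (by exact h.supp)).symm
  have h3 : ν (E ∩ Ioc 0 1) = 0 := h.ac (by rwa [mI, Measure.restrict_apply hE] at h0)
  rw [h2, h3] at h1
  exact le_antisymm h1 zero_le

end LD
end

section
open MeasureTheory Set Filter Topology
open scoped ENNReal

namespace LD

variable {γ : ℝ}

lemma sub_le_of_sets {d1 d2 : ℝ → ℝ≥0∞} (h1 : AEMeasurable d1 mI) (h2 : AEMeasurable d2 mI) (hfin : ∫⁻ x, d2 x ∂mI ≠ ∞)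
    {η : ℝ≥0∞} (h : ∀ E, MeasurableSet E → ∫⁻ x in E, d1 x ∂mI ≤ ∫⁻ x in E, d2 x ∂mI + η) :
    ∫⁻ x, (d1 x - d2 x) ∂mI ≤ η := by
  set S := {x | h2.mk d2 x < h1.mk d1 x} with hS
  have hSm : MeasurableSet S := measurableSet_lt h2.measurable_mk h1.measurable_mk
  have e1 : ∫⁻ x, (d1 x - d2 x) ∂mI = ∫⁻ x in S, (h1.mk d1 x - h2.mk d2 x) ∂mI := by
    rw [← lintegral_indicator hSm]
    refine lintegral_congr_ae ?_
    filter_upwards [h1.ae_eq_mk, h2.ae_eq_mk] with x hx1 hx2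
    by_cases hx : x ∈ S
    · rw [indicator_of_mem hx, hx1, hx2]
    · rw [indicator_of_notMem hx, hx1, hx2]
      simp only [S, mem_ofPred_eq, not_lt] at hx
      exact tsub_eq_zero_of_le hx
  have e2 : ∀ E, ∫⁻ x in E, h1.mk d1 x ∂mI = ∫⁻ x in E, d1 x ∂mI := fun E => 
    lintegral_congr_ae (ae_restrict_of_ae h1.ae_eq_mk.symm)
  have e3 : ∀ E, ∫⁻ x in E, h2.mk d2 x ∂mI = ∫⁻ x in E, d2 x ∂mI := fun E => 
    lintegral_congr_ae (ae_restrict_of_ae h2.ae_eq_mk.symm)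
  rw [e1, lintegral_sub h2.measurable_mk, e2, e3]
  · rw [tsub_le_iff_left]
    exact h S hSm
  · rw [e3]
    exact ne_top_of_le_ne_top hfin (setLIntegral_le_lintegral _ _)
  · filter_upwards [ae_restrict_mem hSm] with x hx
    exact le_of_lt hx

lemma MK_closed {g : ℝ → ℝ≥0∞} (hg : Measurable g) (hfin : ∫⁻ x, g x ∂mI ≠ ∞)
    (h : ∀ η : ℝ≥0∞, 0 < η → ∃ ρ, MK γ ρ ∧ ∀ E, MeasurableSet E → 
      mI.withDensity g E ≤ ρ E + η ∧ ρ E ≤ mI.withDensity g E + η) : MK γ (mI.withDensity g) := by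
  have hη : ∀ n : ℕ, (0:ℝ≥0∞) < (1/2)^n := fun n => by
    rw [pos_iff_ne_zero]
    exact pow_ne_zero _ (by simp)
  choose ρ h1 h2 using fun n : ℕ => h ((1/2)^n) (hη n)
  choose d k1 k2 k3 using h1
  have hdm : ∀ n, AEMeasurable (d n) mI := fun n => aemeas_anti (k1 n).1
  have hfd : ∀ n, ∫⁻ x, d n x ∂mI ≠ ∞ := fun n => by
    have := (h2 n univ MeasurableSet.univ).2
    rw [k3 n, withDensity_apply _ MeasurableSet.univ, withDensity_apply _ MeasurableSet.univ, 
      Measure.restrict_univ] at this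
    refine ne_top_of_le_ne_top ?_ this
    refine ENNReal.add_ne_top.2 ⟨hfin, ?_⟩
    exact ENNReal.pow_ne_top (by simp)
  have b1 : ∀ n, ∫⁻ x, (d n x - g x) ∂mI ≤ (1/2)^n := fun n => by
    refine sub_le_of_sets (hdm n) hg.aemeasurable hfin fun E hE => ?_
    have := (h2 n E hE).2
    rwa [k3 n, withDensity_apply _ hE, withDensity_apply _ hE] at this
  have b2 : ∀ n, ∫⁻ x, (g x - d n x) ∂mI ≤ (1/2)^n := fun n => by
    refine sub_le_of_sets hg.aemeasurable (hdm n) (hfd n) fun E hE => ?_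
    have := (h2 n E hE).1
    rwa [k3 n, withDensity_apply _ hE, withDensity_apply _ hE] at this
  have hgeo : ∑' n : ℕ, ((1/2:ℝ≥0∞))^n ≠ ∞ := by
    rw [ENNReal.tsum_geometric]
    simp
  have hm1 : ∀ n, AEMeasurable (fun x => d n x - g x) mI := fun n => (hdm n).sub hg.aemeasurable
  have hm2 : ∀ n, AEMeasurable (fun x => g x - d n x) mI := fun n => hg.aemeasurable.sub (hdm n)
  have a1 : ∀ᵐ x ∂mI, ∑' n, (d n x - g x) < ∞ := by
    refine ae_lt_top' (AEMeasurable.tsum hm1) ?_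
    rw [lintegral_tsum hm1]
    exact ne_top_of_le_ne_top hgeo (ENNReal.tsum_le_tsum b1)
  have a2 : ∀ᵐ x ∂mI, ∑' n, (g x - d n x) < ∞ := by
    refine ae_lt_top' (AEMeasurable.tsum hm2) ?_
    rw [lintegral_tsum hm2]
    exact ne_top_of_le_ne_top hgeo (ENNReal.tsum_le_tsum b2)
  have a3 : ∀ᵐ x ∂mI, g x < ∞ := ae_lt_top hg hfin
  have a4 : ∀ᵐ x ∂mI, g x = limsup (fun n => d n x) atTop := by
    filter_upwards [a1, a2, a3] with x hx1 hx2 hx3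
    have t1 := ENNReal.tendsto_atTop_zero_of_tsum_ne_top hx1.ne
    have t2 := ENNReal.tendsto_atTop_zero_of_tsum_ne_top hx2.ne
    symm
    apply Tendsto.limsup_eq
    have u1 : Tendsto (fun n => g x + (d n x - g x)) atTop (𝓝 (g x)) := by
      simpa using tendsto_const_nhds.add t1
    have u2 : Tendsto (fun n => g x - (g x - d n x)) atTop (𝓝 (g x)) := by
      have := ENNReal.Tendsto.sub (tendsto_const_nhds (x := g x)) t2 (Or.inl hx3.ne)
      simpa using this
    refine tendsto_of_tendsto_of_tendsto_of_le_of_le u2 u1 (fun n => ?_) (fun n => ?_)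
    · dsimp only
      rw [tsub_le_iff_left]
      exact le_tsub_add
    · exact le_add_tsub
  refine ⟨fun x => limsup (fun n => d n x) atTop, ⟨?_, ?_⟩, ?_, ?_⟩
  · intro x hx y hy hxy
    exact limsup_le_limsup (Eventually.of_forall fun n => (k1 n).1 hx hy hxy)
  · intro x hx y hy hxy
    dsimp only
    rw [mul_comm, ← ENNReal.limsup_const_mul_of_ne_top ENNReal.ofReal_ne_top, mul_comm (limsup _ _), 
      ← ENNReal.limsup_const_mul_of_ne_top ENNReal.ofReal_ne_top]
    refine limsup_le_limsup (Eventually.of_forall fun n => ?_)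
    have := (k1 n).2 hx hy hxy
    dsimp only at this
    rwa [mul_comm, mul_comm (d n y)] at this
  · intro x hx
    dsimp only
    rw [← ENNReal.limsup_const_mul_of_ne_top ENNReal.ofReal_ne_top]
    exact limsup_le_limsup (Eventually.of_forall fun n => k2 n x hx)
  · exact withDensity_congr_ae a4

lemma cyl_approx (hγ0 : 0 < γ) (hγ1 : γ ≤ 1) {g : ℝ → ℝ≥0∞} (hg : Measurable g) (hfin : ∫⁻ x, g x ∂mI ≠ ∞) {η : ℝ≥0∞} (hη : 0 < η) :
    ∃ (q : ℕ) (F : List ℕ → ℝ≥0∞), (∀ l, F l ≠ ∞) ∧ ∀ E, MeasurableSet E →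
      ∫⁻ x in E, g x ∂mI ≤ ∫⁻ x in E, F (itin γ q x) ∂mI + η ∧ 
      ∫⁻ x in E, F (itin γ q x) ∂mI ≤ ∫⁻ x in E, g x ∂mI + η := by
  obtain ⟨η', hη'0, hη'⟩ : ∃ η' : ℝ, 0 < η' ∧ ENNReal.ofReal η' ≤ η / 2 := by
    by_cases h : η = ∞
    · exact ⟨1, one_pos, by simp [h, ENNReal.top_div]⟩
    · refine ⟨(η / 2).toReal, ENNReal.toReal_pos ?_ ?_, ENNReal.ofReal_toReal_le⟩
      · simp [hη.ne']
      · exact ENNReal.div_ne_top h (by simp)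
  have hinteg : Integrable (fun x => (g x).toReal) mI := integrable_toReal_of_lintegral_ne_top hg.aemeasurable hfin
  obtain ⟨gc, c1, c2, c3, -⟩ := hinteg.exists_hasCompactSupport_lintegral_sub_le (ε := η/2) (by simp [hη.ne'])
  have huc := c1.uniformContinuous_of_continuous c3
  rw [Metric.uniformContinuous_iff] at huc
  obtain ⟨τ, hτ0, hτ⟩ := huc η' hη'0
  obtain ⟨q, hq⟩ := exists_pow_lt_of_lt_one hτ0 (by norm_num : (1/2:ℝ) < 1)
  classical
  set F : List ℕ → ℝ≥0∞ := fun l => if h : ∃ y ∈ Ioc (0:ℝ) 1, itin γ q y = l then ENNReal.ofReal (gc h.choose) else 0 with hF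
  have key : ∀ᵐ x ∂mI, g x ≤ F (itin γ q x) + (‖(g x).toReal - gc x‖ₑ + ENNReal.ofReal η') ∧ 
      F (itin γ q x) ≤ g x + (‖(g x).toReal - gc x‖ₑ + ENNReal.ofReal η') := by
    filter_upwards [ae_lt_top hg hfin, ae_mI] with x hx hx1
    have hex : ∃ y ∈ Ioc (0:ℝ) 1, itin γ q y = itin γ q x := ⟨x, hx1, rfl⟩
    have hFx : F (itin γ q x) = ENNReal.ofReal (gc hex.choose) := by
      simp only [hF]
      rw [dif_pos hex]
    have hy := hex.choose_spec
    set y := hex.choose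
    have hd := hτ (a := x) (b := y) (by
      rw [Real.dist_eq]
      exact (itin_close hγ0 hγ1 q x y hx1 hy.1 hy.2.symm).trans_lt hq)
    rw [Real.dist_eq] at hd
    rw [hFx, ← ofReal_norm, ← ENNReal.ofReal_add (norm_nonneg _) hη'0.le, Real.norm_eq_abs]
    have hgx : g x = ENNReal.ofReal (g x).toReal := (ENNReal.ofReal_toReal hx.ne).symm
    have q1 := abs_lt.1 hd
    have q2 := le_abs_self ((g x).toReal - gc x)
    have q3 := neg_abs_le ((g x).toReal - gc x)
    constructor
    · conv_lhs => rw [hgx]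
      refine le_trans (ENNReal.ofReal_le_ofReal ?_) ENNReal.ofReal_add_le
      linarith
    · refine le_trans ?_ (le_of_eq (congrArg (· + ENNReal.ofReal (|(g x).toReal - gc x| + η')) hgx.symm))
      refine le_trans (ENNReal.ofReal_le_ofReal ?_) ENNReal.ofReal_add_le
      linarith
  have hFm : Measurable (fun x => F (itin γ q x)) := itin_meas q F
  have hsm : ∀ E : Set ℝ, ∫⁻ x in E, (‖(g x).toReal - gc x‖ₑ + ENNReal.ofReal η') ∂mI ≤ η := by
    intro E
    calc _ ≤ ∫⁻ x, (‖(g x).toReal - gc x‖ₑ + ENNReal.ofReal η') ∂mI := setLIntegral_le_lintegral _ _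
      _ = ∫⁻ x, ‖(g x).toReal - gc x‖ₑ ∂mI + ENNReal.ofReal η' := by
        rw [lintegral_add_right _ measurable_const]; simp
      _ ≤ η / 2 + η / 2 := by gcongr
      _ = η := ENNReal.add_halves η
  refine ⟨q, F, fun l => ?_, fun E hE => ⟨?_, ?_⟩⟩
  · simp only [hF]
    split_ifs <;> simp
  · calc _ ≤ ∫⁻ x in E, (F (itin γ q x) + (‖(g x).toReal - gc x‖ₑ + ENNReal.ofReal η')) ∂mI := 
          lintegral_mono_ae (ae_restrict_of_ae (key.mono fun x hx => hx.1))
      _ = ∫⁻ x in E, F (itin γ q x) ∂mI + ∫⁻ x in E, (‖(g x).toReal - gc x‖ₑ + ENNReal.ofReal η') ∂mI := 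
          lintegral_add_left hFm _
      _ ≤ _ := by gcongr; exact hsm E
  · calc _ ≤ ∫⁻ x in E, (g x + (‖(g x).toReal - gc x‖ₑ + ENNReal.ofReal η')) ∂mI := 
          lintegral_mono_ae (ae_restrict_of_ae (key.mono fun x hx => hx.2))
      _ = ∫⁻ x in E, g x ∂mI + ∫⁻ x in E, (‖(g x).toReal - gc x‖ₑ + ENNReal.ofReal η') ∂mI := 
          lintegral_add_left hg _
      _ ≤ _ := by gcongr; exact hsm E

lemma muG_MK (hγ0 : 0 < γ) (hγ1 : γ ≤ 1) {ν : Measure ℝ} (h : InvM γ ν) : MK γ (muG γ ν) := by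
  have := muG_fin h
  have hinv := muG_inv_iter hγ0 hγ1 h
  set μ := muG γ ν with hμ
  have hd : mI.withDensity (μ.rnDeriv mI) = μ := Measure.withDensity_rnDeriv_eq _ _ (muG_ac hγ0 hγ1 h)
  set g := μ.rnDeriv mI with hg
  have hgm : Measurable g := Measure.measurable_rnDeriv _ _
  have hfin : ∫⁻ x, g x ∂mI ≠ ∞ := by
    have h1 : (mI.withDensity g) univ ≠ ∞ := by rw [hd]; exact measure_ne_top _ _
    rwa [withDensity_apply _ MeasurableSet.univ, Measure.restrict_univ] at h1
  rw [← hd]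
  refine MK_closed hgm hfin fun η hη => ?_
  obtain ⟨q, F, hF, hE⟩ := cyl_approx (γ := γ) hγ0 hγ1 hgm hfin hη
  refine ⟨_, MK_cyl hγ0 hγ1 q F hF mI (MK_mI hγ0 hγ1), fun E hEm => ?_⟩
  have hEm' := GG_iter_meas (γ := γ) q hEm
  have h2 := hE _ hEm'
  have e : mI.withDensity g E = ∫⁻ x in (GG γ)^[q] ⁻¹' E, g x ∂mI := by
    rw [← withDensity_apply _ hEm', hd, ← Measure.map_apply (GG_iter_meas q) hEm, hinv q]
  rw [e, Measure.map_apply (GG_iter_meas q) hEm, withDensity_apply _ hEm']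
  exact h2

end LD
end

section
open MeasureTheory Set Filter Topology
open scoped ENNReal

namespace LD

variable {γ : ℝ}

noncomputable def uu (x : ℝ) : ℝ := 1 - Real.log x

lemma uu_ge {x : ℝ} (hx : x ∈ Ioc (0:ℝ) 1) : 1 ≤ uu x := by
  have := Real.log_nonpos hx.1.le hx.2
  unfold uu; linarith

lemma uu_meas : Measurable uu := measurable_const.sub Real.measurable_log

lemma uu_tail {v : ℝ} : mI {x | v < uu x} ≤ ENNReal.ofReal (Real.exp (1 - v)) := by
  have hm : MeasurableSet {x | v < uu x} := measurableSet_lt measurable_const uu_meas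
  rw [mI, Measure.restrict_apply hm]
  calc volume ({x | v < uu x} ∩ Ioc 0 1) ≤ volume (Ioo 0 (Real.exp (1 - v))) := by
        refine measure_mono ?_
        rintro x ⟨h1, h2⟩
        refine ⟨h2.1, ?_⟩
        have h1' : v < 1 - Real.log x := h1
        rw [← Real.log_lt_iff_lt_exp h2.1]
        linarith
    _ = _ := by simp

lemma log_half {s : ℝ} (h0 : 0 ≤ s) (h1 : s ≤ 1) : s / 2 ≤ Real.log (1 + s) := by
  have := Real.one_sub_inv_le_log_of_pos (show 0 < 1 + s by linarith)
  refine le_trans ?_ this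
  rw [le_sub_iff_add_le, ← le_sub_iff_add_le', inv_le_iff_one_le_mul₀ (by linarith)]
  nlinarith

noncomputable def K0 (γ : ℝ) : ℝ := 2 / (Real.log 2) ^ be γ

lemma K0_ge (hγ0 : 0 < γ) (hγ1 : γ ≤ 1) : 2 ≤ K0 γ := by
  unfold K0
  rw [le_div_iff₀ (Real.rpow_pos_of_pos log2_pos _)]
  have := Real.rpow_le_one log2_pos.le log2_lt.le (be_nonneg hγ0 hγ1)
  linarith

noncomputable def pp (γ δ : ℝ) : ℝ := 1 + be γ + δ

lemma grow_step (hγ0 : 0 < γ) (hγ1 : γ ≤ 1) {δ : ℝ} (hδ : 0 ≤ δ) {x : ℝ} (hx : x ∈ Ioc (0:ℝ) (1/2)) :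
    uu x ^ δ + K0 γ * uu (Tmap γ x) ^ pp γ δ ≤ K0 γ * uu x ^ pp γ δ := by
  have hβ := be_nonneg hγ0 hγ1
  have hl := neglog_ge hx
  have hx1 : x ∈ Ioc (0:ℝ) 1 := ⟨hx.1, by linarith [hx.2]⟩
  have hA := uu_ge hx1
  have hB := uu_ge (T_mem hγ0 hγ1 hx1)
  have hsp := sF_pos (be γ) (log2_pos.trans_le hl)
  have hs1 := sF_le_one hβ hl
  have hlog := log_half hsp.le hs1
  have hAB : uu (Tmap γ x) = uu x - Real.log (1 + sF (be γ) (- Real.log x)) := by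
    have := neglog_T (γ := γ) hx
    unfold uu; linarith
  have hs : (Real.log 2) ^ be γ / uu x ^ be γ ≤ sF (be γ) (- Real.log x) := by
    unfold sF
    have h1 : 0 < - Real.log x := log2_pos.trans_le hl
    have := Real.rpow_pos_of_pos h1 (be γ)
    have := Real.rpow_pos_of_pos log2_pos (be γ)
    gcongr
    unfold uu; linarith
  set A := uu x
  set B := uu (Tmap γ x)
  set L := (Real.log 2) ^ be γ with hLdef
  have hL : 0 < L := Real.rpow_pos_of_pos log2_pos _
  have hA0 : 0 < A := by linarith
  have hB0 : 0 < B := by linarith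
  have hp : pp γ δ = (be γ + δ) + 1 := by unfold pp; ring
  have e1 : A ^ pp γ δ = A ^ (be γ + δ) * A := by rw [hp, Real.rpow_add_one hA0.ne']
  have e2 : B ^ pp γ δ = B ^ (be γ + δ) * B := by rw [hp, Real.rpow_add_one hB0.ne']
  have e3 : B ^ (be γ + δ) ≤ A ^ (be γ + δ) := by
    apply Real.rpow_le_rpow hB0.le _ (by linarith)
    linarith
  have e4 : A ^ (be γ + δ) = A ^ be γ * A ^ δ := Real.rpow_add hA0 _ _
  have e5 : L / A ^ be γ / 2 ≤ A - B := by linarith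
  have hAb : 0 < A ^ be γ := Real.rpow_pos_of_pos hA0 _
  have hAd : 0 < A ^ δ := Real.rpow_pos_of_pos hA0 _
  have e6 : A ^ (be γ + δ) * (A - B) ≥ A ^ δ * L / 2 := by
    rw [e4]
    calc A ^ δ * L / 2 = A ^ be γ * A ^ δ * (L / A ^ be γ / 2) := by field_simp
      _ ≤ _ := by gcongr
  have e7 : A ^ pp γ δ - B ^ pp γ δ ≥ A ^ δ * L / 2 := by
    rw [e1, e2]; nlinarith
  have hK : K0 γ * (A ^ δ * L / 2) = A ^ δ := by unfold K0; rw [← hLdef]; field_simp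
  have hK0 : 0 < K0 γ := by unfold K0; positivity
  nlinarith [mul_le_mul_of_nonneg_left e7 hK0.le]

lemma grow (hγ0 : 0 < γ) (hγ1 : γ ≤ 1) {δ : ℝ} (hδ : 0 ≤ δ) {φ : ℝ → ℝ} {C : ℝ} (hC : 0 ≤ C) 
    (hφ : ∀ x ∈ Ioc (0:ℝ) 1, |φ x| ≤ C * uu x ^ δ) (n : ℕ) : ∀ x ∈ Ioc (0:ℝ) 1, n ≤ kk γ x + 1 → 
    |∑ j ∈ Finset.range n, φ ((Tmap γ)^[j] x)| ≤ C * (K0 γ * uu x ^ pp γ δ) := by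
  have hβ := be_nonneg hγ0 hγ1
  have hK := K0_ge hγ0 hγ1
  induction n with
  | zero =>
    intro x hx _
    have := uu_ge hx
    simp only [Finset.range_zero, Finset.sum_empty, abs_zero]
    positivity
  | succ n ih =>
    intro x hx hn
    rcases le_or_gt x (1/2) with h | h
    · rw [Finset.sum_range_succ']
      simp only [Function.iterate_succ_apply, Function.iterate_zero, id]
      have h1 := ih (Tmap γ x) (T_mem hγ0 hγ1 hx) (by rw [kk_le hγ0 hγ1 ⟨hx.1, h⟩] at hn; omega)
      have h2 := hφ x hx
      have h3 := grow_step hγ0 hγ1 hδ ⟨hx.1, h⟩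
      have h4 := mul_le_mul_of_nonneg_left h3 hC
      refine (abs_add_le _ _).trans ?_
      linarith
    · rw [kk_gt h] at hn
      have : n = 0 := by omega
      subst this
      have hu := uu_ge hx
      simp only [zero_add, Finset.range_one, Finset.sum_singleton, Function.iterate_zero, id]
      refine (hφ x hx).trans ?_
      gcongr
      have h1 : uu x ^ δ ≤ uu x ^ pp γ δ := Real.rpow_le_rpow_of_exponent_le hu (by unfold pp; linarith)
      have h2 : 0 ≤ uu x ^ pp γ δ := by positivity
      nlinarith

lemma uu_J (hγ0 : 0 < γ) (hγ1 : γ ≤ 1) (k : ℕ) : ∀ x y : ℝ, x ∈ JJ γ k → y ∈ JJ γ k → uu y ≤ uu x + Real.log 2 := by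
  induction k with
  | zero =>
    intro x y hx hy
    have hx1 := uu_ge hx.1
    rw [JJ_zero hγ0 hγ1] at hy
    have : Real.log (1/2) ≤ Real.log y := Real.log_le_log (by norm_num) hy.1.le
    rw [one_div, Real.log_inv] at this
    unfold uu at *
    linarith
  | succ k ih =>
    intro x y hx hy
    rcases le_or_gt x y with h | h
    · have := Real.log_le_log hx.1.1 h
      unfold uu
      linarith [log2_pos]
    · rw [JJ_succ hγ0 hγ1] at hx hy
      have h1 := ih _ _ hx.1 hy.1
      have hxl := neglog_T (γ := γ) hx.2
      have hyl := neglog_T (γ := γ) hy.2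
      have h2 : - Real.log x ≤ - Real.log y := neg_le_neg (Real.log_le_log hy.2.1 h.le)
      have h3 := sF_anti (be_nonneg hγ0 hγ1) (log2_pos.trans_le (neglog_ge hx.2)) h2
      have h4 := sF_pos (be γ) (log2_pos.trans_le (neglog_ge hy.2))
      have h5 : Real.log (1 + sF (be γ) (- Real.log y)) ≤ Real.log (1 + sF (be γ) (- Real.log x)) :=
        Real.log_le_log (by linarith) (by linarith)
      unfold uu at *
      linarith

lemma rpow_le_exp {r ε : ℝ} (hε : 0 < ε) : ∃ C : ℝ, 0 < C ∧ ∀ u : ℝ, 1 ≤ u → u ^ r ≤ C * Real.exp (ε * u) := by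
  obtain ⟨N, hN⟩ := exists_nat_ge r
  refine ⟨N.factorial / ε ^ N, by positivity, fun u hu => ?_⟩
  have h1 : u ^ r ≤ u ^ N := by
    rw [← Real.rpow_natCast]
    exact Real.rpow_le_rpow_of_exponent_le hu hN
  refine h1.trans ?_
  have h2 := Real.pow_div_factorial_le_exp (ε * u) (by positivity) N
  rw [div_le_iff₀ (by positivity), mul_pow] at h2
  rw [div_mul_eq_mul_div, le_div_iff₀ (by positivity)]
  linarith

lemma int_exp : Integrable (fun x => Real.exp (3/4 * uu x)) mI := by
  have h1 : IntervalIntegrable (fun x : ℝ => x ^ (-(3/4):ℝ)) volume 0 1 :=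
    intervalIntegral.intervalIntegrable_rpow' (by norm_num)
  rw [intervalIntegrable_iff_integrableOn_Ioc_of_le zero_le_one] at h1
  have h2 : Integrable (fun x : ℝ => Real.exp (3/4) * x ^ (-(3/4):ℝ)) mI := h1.const_mul _
  refine h2.congr ?_
  filter_upwards [ae_mI] with x hx
  rw [Real.rpow_def_of_pos hx.1, ← Real.exp_add]
  unfold uu
  congr 1; ring

lemma int_uu (r : ℝ) : Integrable (fun x => uu x ^ r * Real.exp (uu x / 2)) mI := by
  obtain ⟨C, hC, h⟩ := rpow_le_exp (r := r) (ε := 1/4) (by norm_num)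
  refine Integrable.mono' (int_exp.const_mul C) ?_ ?_
  · exact ((uu_meas.pow_const r).mul (Real.measurable_exp.comp (uu_meas.div_const 2))).aestronglyMeasurable
  · filter_upwards [ae_mI] with x hx
    have hu := uu_ge hx
    rw [Real.norm_of_nonneg (by positivity)]
    calc _ ≤ C * Real.exp (1/4 * uu x) * Real.exp (uu x / 2) := by
          gcongr; exact h _ hu
      _ = _ := by rw [mul_assoc, ← Real.exp_add]; congr 2; ring

lemma int_uu' (r : ℝ) : Integrable (fun x => uu x ^ r) mI := by
  refine Integrable.mono' (int_uu r) (uu_meas.pow_const r).aestronglyMeasurable ?_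
  filter_upwards [ae_mI] with x hx
  have hu := uu_ge hx
  rw [Real.norm_of_nonneg (by positivity)]
  refine le_mul_of_one_le_right (by positivity) (Real.one_le_exp (by positivity))

end LD
end

section
open MeasureTheory Set Filter Topology
open scoped ENNReal

namespace LD

variable {γ : ℝ}

lemma MK_int {ρ : Measure ℝ} (h : MK γ ρ) (hfin : ρ univ ≠ ∞) {u : ℝ → ℝ} (hu : Integrable u mI) : Integrable u ρ := by
  refine Integrable.mono_measure (hu.smul_measure (c := ENNReal.ofReal (2 * cD γ) * ρ univ) ?_) (MK_le h)
  exact ENNReal.mul_ne_top ENNReal.ofReal_ne_top hfin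

lemma MK_int_le (hγ0 : 0 < γ) (hγ1 : γ ≤ 1) {ρ : Measure ℝ} (h : MK γ ρ) (hfin : ρ univ ≠ ∞) {u : ℝ → ℝ} (hu : Integrable u mI) (hu0 : 0 ≤ u) : 
    ∫ x, u x ∂ρ ≤ 2 * cD γ * ρ.real univ * ∫ x, u x ∂mI := by
  have hc := one_le_cD hγ0 hγ1
  have hct : ENNReal.ofReal (2 * cD γ) * ρ univ ≠ ∞ := ENNReal.mul_ne_top ENNReal.ofReal_ne_top hfin
  calc ∫ x, u x ∂ρ ≤ ∫ x, u x ∂((ENNReal.ofReal (2 * cD γ) * ρ univ) • mI) := 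
        integral_mono_measure (MK_le h) (Eventually.of_forall hu0) (hu.smul_measure hct)
    _ = _ := by
      rw [integral_smul_measure, ENNReal.toReal_mul, ENNReal.toReal_ofReal (by linarith)]
      rfl

lemma kR_pos (hγ0 : 0 < γ) (hγ1 : γ ≤ 1) : 0 < kR γ := by
  have hc := one_le_cD hγ0 hγ1
  unfold kR; positivity

lemma kR_le (hγ0 : 0 < γ) (hγ1 : γ ≤ 1) : kR γ ≤ 1/2 := by
  have hc := one_le_cD hγ0 hγ1
  unfold kR
  rw [div_le_div_iff₀ (by linarith) (by norm_num)]
  linarith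

lemma regen (hγ0 : 0 < γ) (hγ1 : γ ≤ 1) {ρ : Measure ℝ} (h : MK γ ρ) (hfin : ρ univ ≠ ∞) :
    ∃ ρ', MK γ ρ' ∧ ρ.map (GG γ) = (ENNReal.ofReal (kR γ) * ρ univ) • mI + ρ' ∧ 
      ρ' univ = ENNReal.ofReal (1 - kR γ) * ρ univ := by
  have e : (ρ.map (GG γ)) univ = ρ univ := by
    rw [Measure.map_apply GG_meas MeasurableSet.univ, preimage_univ]
  obtain ⟨ρ', h1, h2⟩ := MP_regen hγ0 hγ1 (push_MP hγ0 hγ1 h.MW) (by rwa [e])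
  rw [e] at h2
  refine ⟨ρ', h1, h2, ?_⟩
  have h3 := congrArg (fun μ : Measure ℝ => μ univ) h2
  simp only [e, Measure.add_apply, Measure.smul_apply, measure_univ, smul_eq_mul, mul_one] at h3
  have h4 : ρ univ = ENNReal.ofReal (kR γ) * ρ univ + ENNReal.ofReal (1 - kR γ) * ρ univ := by
    rw [← add_mul, ← ENNReal.ofReal_add (kR_pos hγ0 hγ1).le (by linarith [kR_le hγ0 hγ1])]
    simp
  rw [h4] at h3
  have h5 : ENNReal.ofReal (kR γ) * ρ univ ≠ ∞ := ENNReal.mul_ne_top ENNReal.ofReal_ne_top hfin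
  have h6 := h3
  rw [← h4] at h6
  exact ((ENNReal.add_right_inj h5).1 (h4.symm.trans h6)).symm

lemma map_univ' {ρ : Measure ℝ} (n : ℕ) : (ρ.map (GG γ)^[n]) univ = ρ univ := by
  rw [Measure.map_apply (GG_iter_meas n) MeasurableSet.univ, preimage_univ]

lemma mix (hγ0 : 0 < γ) (hγ1 : γ ≤ 1) {u : ℝ → ℝ} (hu : Integrable u mI) (M : ℕ) : 
    ∀ ρ ρ' : Measure ℝ, MK γ ρ → MK γ ρ' → ρ univ ≠ ∞ → ρ univ = ρ' univ →
    |∫ x, u x ∂(ρ.map (GG γ)^[M]) - ∫ x, u x ∂(ρ'.map (GG γ)^[M])| ≤ 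
      (1 - kR γ) ^ M * ρ.real univ * (2 * (2 * cD γ * ∫ x, |u x| ∂mI)) := by
  induction M with
  | zero =>
    intro ρ ρ' h h' hf he
    have h1 := MK_int_le hγ0 hγ1 h hf hu.abs (fun x => abs_nonneg _)
    have h2 := MK_int_le hγ0 hγ1 h' (he ▸ hf) hu.abs (fun x => abs_nonneg _)
    have e : ρ'.real univ = ρ.real univ := by rw [measureReal_def, measureReal_def, he]
    rw [e] at h2
    simp only [Function.iterate_zero, Measure.map_id, pow_zero, one_mul]
    have h3 := abs_integral_le_integral_abs (f := u) (μ := ρ)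
    have h4 := abs_integral_le_integral_abs (f := u) (μ := ρ')
    have h5 := abs_sub (∫ x, u x ∂ρ) (∫ x, u x ∂ρ')
    linarith
  | succ M ih =>
    intro ρ ρ' h h' hf he
    obtain ⟨ρ1, a1, a2, a3⟩ := regen hγ0 hγ1 h hf
    obtain ⟨ρ1', b1, b2, b3⟩ := regen hγ0 hγ1 h' (he ▸ hf)
    have hf1 : ρ1 univ ≠ ∞ := by rw [a3]; exact ENNReal.mul_ne_top ENNReal.ofReal_ne_top hf
    have hfc : ENNReal.ofReal (kR γ) * ρ univ ≠ ∞ := ENNReal.mul_ne_top ENNReal.ofReal_ne_top hf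
    have he1 : ρ1 univ = ρ1' univ := by rw [a3, b3, he]
    have := ih ρ1 ρ1' a1 b1 hf1 he1
    have er : ρ1.real univ = (1 - kR γ) * ρ.real univ := by
      rw [measureReal_def, a3, ENNReal.toReal_mul, ENNReal.toReal_ofReal (by linarith [kR_le hγ0 hγ1])]; rfl
    have hm : Integrable u ((ENNReal.ofReal (kR γ) * ρ univ) • mI.map (GG γ)^[M]) := by
      refine Integrable.smul_measure ?_ hfc
      exact MK_int (push_MK_iter hγ0 hγ1 (MK_mI hγ0 hγ1) M) (by rw [map_univ']; simp) hu
    have k1 : ∫ x, u x ∂(ρ.map (GG γ)^[M+1]) = 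
        ∫ x, u x ∂((ENNReal.ofReal (kR γ) * ρ univ) • mI.map (GG γ)^[M]) + ∫ x, u x ∂(ρ1.map (GG γ)^[M]) := by
      rw [Function.iterate_succ, ← Measure.map_map (GG_iter_meas M) GG_meas, a2, Measure.map_add _ _ (GG_iter_meas M),
        Measure.map_smul, integral_add_measure hm]
      exact MK_int (push_MK_iter hγ0 hγ1 a1 M) (by rwa [map_univ']) hu
    have k2 : ∫ x, u x ∂(ρ'.map (GG γ)^[M+1]) = 
        ∫ x, u x ∂((ENNReal.ofReal (kR γ) * ρ univ) • mI.map (GG γ)^[M]) + ∫ x, u x ∂(ρ1'.map (GG γ)^[M]) := by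
      rw [Function.iterate_succ, ← Measure.map_map (GG_iter_meas M) GG_meas, b2, Measure.map_add _ _ (GG_iter_meas M),
        Measure.map_smul, ← he, integral_add_measure hm]
      exact MK_int (push_MK_iter hγ0 hγ1 b1 M) (by rw [map_univ', ← he1]; exact hf1) hu
    rw [er] at this
    rw [k1, k2, add_sub_add_left_eq_sub]
    refine this.trans (le_of_eq ?_)
    ring

lemma mix_mu (hγ0 : 0 < γ) (hγ1 : γ ≤ 1) {ν : Measure ℝ} (h : InvM γ ν) {u : ℝ → ℝ} (hu : Integrable u mI) {η : ℝ} (hη : 0 < η)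
    (hle : ∫ x, u x ∂(muG γ ν) ≤ η * (muG γ ν).real univ) : 
    ∃ M : ℕ, ∀ ρ : Measure ℝ, MK γ ρ → ρ univ ≠ ∞ → ∫ x, u x ∂(ρ.map (GG γ)^[M]) ≤ 2 * η * ρ.real univ := by
  have := muG_fin h
  have hk1 := kR_pos hγ0 hγ1
  have hk2 := kR_le hγ0 hγ1
  set D := 2 * (2 * cD γ * ∫ x, |u x| ∂mI)
  have ht : Tendsto (fun M : ℕ => (1 - kR γ) ^ M * D) atTop (𝓝 (0 * D)) :=
    (tendsto_pow_atTop_nhds_zero_of_lt_one (by linarith) (by linarith)).mul_const D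
  rw [zero_mul] at ht
  obtain ⟨M, hM⟩ := (ht.eventually (gt_mem_nhds hη)).exists
  refine ⟨M, fun ρ hρ hf => ?_⟩
  set μ := muG γ ν
  have h0 := muG_ne_zero hγ0 hγ1 h
  have hμf : μ univ ≠ ∞ := measure_ne_top _ _
  have hcf : ρ univ / μ univ ≠ ∞ := ENNReal.div_ne_top hf h0
  have h1 := mix hγ0 hγ1 hu M ρ ((ρ univ / μ univ) • μ) hρ (MK_smul (muG_MK hγ0 hγ1 h) _ hcf) hf 
    (by simp only [Measure.smul_apply, smul_eq_mul]; rw [ENNReal.div_mul_cancel h0 hμf])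
  rw [Measure.map_smul, muG_inv_iter hγ0 hγ1 h, integral_smul_measure, ENNReal.toReal_div] at h1
  have hw : 0 ≤ ρ.real univ := measureReal_nonneg
  have hμ0 : 0 < μ.real univ := ENNReal.toReal_pos h0 hμf
  have h2 : (ρ.real univ / μ.real univ) * ∫ x, u x ∂μ ≤ (ρ.real univ / μ.real univ) * (η * μ.real univ) :=
    mul_le_mul_of_nonneg_left hle (by positivity)
  have h3 : (ρ.real univ / μ.real univ) * (η * μ.real univ) = η * ρ.real univ := by field_simp
  have h4 := (abs_le.1 h1).2
  have h5 : (1 - kR γ) ^ M * ρ.real univ * D ≤ η * ρ.real univ := by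
    rw [mul_right_comm]
    gcongr
  simp only [smul_eq_mul] at h4
  change _ - (ρ.real univ / μ.real univ) * _ ≤ _ at h4
  linarith

noncomputable def ZZ (γ : ℝ) (φ : ℝ → ℝ) (x : ℝ) : ℝ := ∑ j ∈ Finset.range (kk γ x + 1), φ ((Tmap γ)^[j] x)

lemma ZZ_meas {φ : ℝ → ℝ} (hφ : Measurable φ) : Measurable (ZZ γ φ) :=
  meas_count (H := fun k x => ∑ j ∈ Finset.range (k + 1), φ ((Tmap γ)^[j] x)) 
    (fun _ => Finset.measurable_sum _ fun j _ => hφ.comp (T_iter_meas j)) kk_meas measurable_id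

lemma ZZ_bound (hγ0 : 0 < γ) (hγ1 : γ ≤ 1) {δ : ℝ} (hδ : 0 ≤ δ) {φ : ℝ → ℝ} {C : ℝ} (hC : 0 ≤ C) 
    (hφ : ∀ x ∈ Ioc (0:ℝ) 1, |φ x| ≤ C * uu x ^ δ) {x : ℝ} (hx : x ∈ Ioc (0:ℝ) 1) : 
    |ZZ γ φ x| ≤ C * (K0 γ * uu x ^ pp γ δ) :=
  grow hγ0 hγ1 hδ hC hφ _ x hx le_rfl

lemma ZZ_int (hγ0 : 0 < γ) (hγ1 : γ ≤ 1) {δ : ℝ} (hδ : 0 ≤ δ) {φ : ℝ → ℝ} (hm : Measurable φ) {C : ℝ} (hC : 0 ≤ C) 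
    (hφ : ∀ x ∈ Ioc (0:ℝ) 1, |φ x| ≤ C * uu x ^ δ) : Integrable (ZZ γ φ) mI := by
  refine Integrable.mono' (((int_uu' (pp γ δ)).const_mul (K0 γ)).const_mul C) (ZZ_meas hm).aestronglyMeasurable ?_
  filter_upwards [ae_mI] with x hx
  exact ZZ_bound hγ0 hγ1 hδ hC hφ hx

lemma kac_nonneg (hγ0 : 0 < γ) (hγ1 : γ ≤ 1) {ν : Measure ℝ} (h : InvM γ ν) {δ : ℝ} (hδ : 0 ≤ δ) {φ : ℝ → ℝ} (hm : Measurable φ) {C : ℝ} (hC : 0 ≤ C) 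
    (hφ : ∀ x ∈ Ioc (0:ℝ) 1, |φ x| ≤ C * uu x ^ δ) (h0 : ∀ x, 0 ≤ φ x) : 
    Integrable φ ν ∧ ∫ x, φ x ∂ν = ∫ x, ZZ γ φ x ∂(muG γ ν) := by
  have := muG_fin h
  have hZ : Integrable (ZZ γ φ) (muG γ ν) := MK_int (muG_MK hγ0 hγ1 h) (measure_ne_top _ _) (ZZ_int hγ0 hγ1 hδ hm hC hφ)
  have hZ0 : ∀ x, 0 ≤ ZZ γ φ x := fun x => Finset.sum_nonneg fun j _ => h0 _
  have e : ∫⁻ x, ENNReal.ofReal (φ x) ∂ν = ∫⁻ x, ENNReal.ofReal (ZZ γ φ x) ∂(muG γ ν) := by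
    rw [kac_lintegral hγ0 hγ1 h hm.ennreal_ofReal]
    refine lintegral_congr fun x => ?_
    rw [ZZ, ENNReal.ofReal_sum_of_nonneg fun j _ => h0 _]
  constructor
  · refine ⟨hm.aestronglyMeasurable, ?_⟩
    rw [hasFiniteIntegral_iff_ofReal (Eventually.of_forall h0), e, ← hasFiniteIntegral_iff_ofReal (Eventually.of_forall hZ0)]
    exact hZ.2
  · rw [integral_eq_lintegral_of_nonneg_ae (Eventually.of_forall h0) hm.aestronglyMeasurable, 
      integral_eq_lintegral_of_nonneg_ae (Eventually.of_forall hZ0) hZ.1, e]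

end LD
end

section
open MeasureTheory Set Filter Topology
open scoped ENNReal

namespace LD

variable {γ : ℝ}

/-- admissible observables -/
structure Obs (δ : ℝ) (φ : ℝ → ℝ) (C : ℝ) : Prop where
  meas : Measurable φ
  pos : 0 < C
  bd : ∀ x ∈ Ioc (0:ℝ) 1, |φ x| ≤ C * uu x ^ δ
  cont : ContinuousOn φ (Ioc 0 1)

lemma T_contOn : ContinuousOn (Tmap γ) (Ioc 0 (1/2)) := fun _ hx => (T_deriv hx).continuousWithinAt

lemma ZZ_cont (hγ0 : 0 < γ) (hγ1 : γ ≤ 1) {φ : ℝ → ℝ} (h : ContinuousOn φ (Ioc 0 1)) (k : ℕ) : 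
    ContinuousOn (fun x => ∑ j ∈ Finset.range (k+1), φ ((Tmap γ)^[j] x)) (JJ γ k) := by
  induction k with
  | zero =>
    simp only [zero_add, Finset.range_one, Finset.sum_singleton, Function.iterate_zero, id]
    exact h.mono fun x hx => hx.1
  | succ k ih =>
    simp only [Finset.sum_range_succ' _ (k+1), Function.iterate_succ_apply, Function.iterate_zero, id]
    rw [JJ_succ hγ0 hγ1]
    refine ContinuousOn.add ?_ ?_
    · exact ih.comp (T_contOn.mono inter_subset_right) (fun x hx => hx.1)
    · exact h.mono fun x hx => ⟨hx.2.1, by linarith [hx.2.2]⟩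

noncomputable def WW (γ : ℝ) (φ : ℝ → ℝ) (q : ℕ) (l : List ℕ) : ℝ :=
  sSup (ZZ γ φ '' {y | y ∈ Ioc (0:ℝ) 1 ∧ itin γ q y = l})

noncomputable def DD (γ δ C : ℝ) : ℝ := C * (K0 γ * 2 ^ pp γ δ)

lemma DD_pos (hγ0 : 0 < γ) (hγ1 : γ ≤ 1) {δ C : ℝ} (hC : 0 < C) : 0 < DD γ δ C := by
  have := K0_ge hγ0 hγ1
  unfold DD; positivity

lemma pp_ge (hγ0 : 0 < γ) (hγ1 : γ ≤ 1) {δ : ℝ} (hδ : 0 ≤ δ) : 1 ≤ pp γ δ := by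
  have := be_nonneg hγ0 hγ1
  unfold pp; linarith

lemma ZZ_cyl (hγ0 : 0 < γ) (hγ1 : γ ≤ 1) {δ : ℝ} (hδ : 0 ≤ δ) {φ : ℝ → ℝ} {C : ℝ} (h : Obs δ φ C) {x y : ℝ} 
    (hx : x ∈ Ioc (0:ℝ) 1) (hy : y ∈ Ioc (0:ℝ) 1) (hk : kk γ y = kk γ x) : 
    |ZZ γ φ y| ≤ DD γ δ C * uu x ^ pp γ δ := by
  have h1 := ZZ_bound hγ0 hγ1 hδ h.pos.le h.bd hy
  have h2 := uu_J hγ0 hγ1 _ x y ⟨hx, rfl⟩ ⟨hy, hk⟩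
  have h3 := uu_ge hx
  have h4 := uu_ge hy
  have hK := K0_ge hγ0 hγ1
  have hp := pp_ge hγ0 hγ1 hδ
  have h5 : uu y ^ pp γ δ ≤ (2 * uu x) ^ pp γ δ := 
    Real.rpow_le_rpow (by linarith) (by linarith [log2_lt]) (by linarith)
  rw [Real.mul_rpow (by norm_num) (by linarith)] at h5
  unfold DD
  calc _ ≤ _ := h1
    _ ≤ C * (K0 γ * (2 ^ pp γ δ * uu x ^ pp γ δ)) := by
      have := h.pos
      gcongr
    _ = _ := by ring

section

lemma WW_bdd (hγ0 : 0 < γ) (hγ1 : γ ≤ 1) {δ : ℝ} (hδ : 0 ≤ δ) {φ : ℝ → ℝ} {C : ℝ} (h : Obs δ φ C)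
    {q : ℕ} {x : ℝ} (hx : x ∈ Ioc (0:ℝ) 1) : 
    ∀ z ∈ ZZ γ φ '' {y | y ∈ Ioc (0:ℝ) 1 ∧ itin γ (q+1) y = itin γ (q+1) x}, |z| ≤ DD γ δ C * uu x ^ pp γ δ := by
  rintro _ ⟨y, ⟨hy, hk⟩, rfl⟩
  simp only [itin, List.cons.injEq] at hk
  exact ZZ_cyl hγ0 hγ1 hδ h hx hy hk.1

lemma ZZ_le_WW (hγ0 : 0 < γ) (hγ1 : γ ≤ 1) {δ : ℝ} (hδ : 0 ≤ δ) {φ : ℝ → ℝ} {C : ℝ} (h : Obs δ φ C)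
    {q : ℕ} {x : ℝ} (hx : x ∈ Ioc (0:ℝ) 1) : ZZ γ φ x ≤ WW γ φ (q+1) (itin γ (q+1) x) := 
  le_csSup ⟨DD γ δ C * uu x ^ pp γ δ, fun z hz => (abs_le.1 (WW_bdd hγ0 hγ1 hδ h hx z hz)).2⟩ ⟨x, ⟨hx, rfl⟩, rfl⟩

lemma WW_bound (hγ0 : 0 < γ) (hγ1 : γ ≤ 1) {δ : ℝ} (hδ : 0 ≤ δ) {φ : ℝ → ℝ} {C : ℝ} (h : Obs δ φ C)
    {q : ℕ} {x : ℝ} (hx : x ∈ Ioc (0:ℝ) 1) : |WW γ φ (q+1) (itin γ (q+1) x)| ≤ DD γ δ C * uu x ^ pp γ δ := by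
  rw [abs_le]
  constructor
  · refine le_trans ?_ (ZZ_le_WW hγ0 hγ1 hδ h hx)
    exact (abs_le.1 (ZZ_cyl hγ0 hγ1 hδ h hx hx rfl)).1
  · exact csSup_le ⟨_, ⟨x, ⟨hx, rfl⟩, rfl⟩⟩ fun z hz => (abs_le.1 (WW_bdd hγ0 hγ1 hδ h hx z hz)).2

lemma WW_tendsto (hγ0 : 0 < γ) (hγ1 : γ ≤ 1) {δ : ℝ} (hδ : 0 ≤ δ) {φ : ℝ → ℝ} {C : ℝ} (h : Obs δ φ C)
    {x : ℝ} (hx : x ∈ Ioc (0:ℝ) 1) : 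
    Tendsto (fun q => WW γ φ (q+1) (itin γ (q+1) x)) atTop (𝓝 (ZZ γ φ x)) := by
  have hc := ZZ_cont hγ0 hγ1 h.cont (kk γ x) x ⟨hx, rfl⟩
  rw [Metric.tendsto_atTop]
  intro ε hε
  rw [Metric.continuousWithinAt_iff] at hc
  obtain ⟨d, hd, hc⟩ := hc (ε/2) (by positivity)
  obtain ⟨N, hN⟩ := exists_pow_lt_of_lt_one hd (show (1/2:ℝ) < 1 by norm_num)
  refine ⟨N, fun q hq => ?_⟩
  have h1 := ZZ_le_WW (q := q) hγ0 hγ1 hδ h hx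
  have h2 : WW γ φ (q+1) (itin γ (q+1) x) ≤ ZZ γ φ x + ε/2 := by
    refine csSup_le ⟨_, ⟨x, ⟨hx, rfl⟩, rfl⟩⟩ ?_
    rintro _ ⟨y, ⟨hy, hk⟩, rfl⟩
    have h3 := itin_close hγ0 hγ1 (q+1) y x hy hx hk
    simp only [itin, List.cons.injEq] at hk
    have h4 : (1/2:ℝ)^(q+1) ≤ (1/2)^N := pow_le_pow_of_le_one (by norm_num) (by norm_num) (by omega)
    have h5 := hc (x := y) ⟨hy, hk.1⟩ (by rw [Real.dist_eq]; linarith)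
    rw [Real.dist_eq] at h5
    have h6 := (abs_lt.1 h5).2
    have e : ZZ γ φ y = ∑ j ∈ Finset.range (kk γ x + 1), φ ((Tmap γ)^[j] y) := by rw [ZZ, hk.1]
    rw [e, ZZ]
    linarith
  rw [Real.dist_eq, abs_lt]
  constructor <;> linarith

lemma WW_int (hγ0 : 0 < γ) (hγ1 : γ ≤ 1) {δ : ℝ} (hδ : 0 ≤ δ) {φ : ℝ → ℝ} {C : ℝ} (h : Obs δ φ C)
    {q : ℕ} : Integrable (fun x => WW γ φ (q+1) (itin γ (q+1) x)) mI := by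
  refine Integrable.mono' ((int_uu' (pp γ δ)).const_mul (DD γ δ C)) (itin_meas _ _).aestronglyMeasurable ?_
  filter_upwards [ae_mI] with x hx
  exact WW_bound hγ0 hγ1 hδ h hx

lemma approx (hγ0 : 0 < γ) (hγ1 : γ ≤ 1) {δ : ℝ} (hδ : 0 ≤ δ) {φ : ℝ → ℝ} {C : ℝ} (h : Obs δ φ C)
    {ν : Measure ℝ} (hν : InvM γ ν) (h0 : ∫ x, ZZ γ φ x ∂(muG γ ν) ≤ 0) {η : ℝ} (hη : 0 < η) : 
    ∃ q M : ℕ, ∀ ρ : Measure ℝ, MK γ ρ → ρ univ ≠ ∞ → 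
      ∫ x, WW γ φ (q+1) (itin γ (q+1) x) ∂(ρ.map (GG γ)^[M]) ≤ 2 * η * ρ.real univ := by
  have := muG_fin hν
  have hfin : muG γ ν univ ≠ ∞ := measure_ne_top _ _
  have hmk := muG_MK hγ0 hγ1 hν
  have hpos : 0 < (muG γ ν).real univ := ENNReal.toReal_pos (muG_ne_zero hγ0 hγ1 hν) hfin
  have hae : ∀ᵐ x ∂(muG γ ν), x ∈ Ioc (0:ℝ) 1 := by
    obtain ⟨g, _, _, e⟩ := hmk
    rw [e]
    exact (withDensity_absolutelyContinuous _ _).ae_le ae_mI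
  have ht : Tendsto (fun q => ∫ x, WW γ φ (q+1) (itin γ (q+1) x) ∂(muG γ ν)) atTop (𝓝 (∫ x, ZZ γ φ x ∂(muG γ ν))) := by
    refine tendsto_integral_of_dominated_convergence (fun x => DD γ δ C * uu x ^ pp γ δ) 
      (fun q => (itin_meas _ _).aestronglyMeasurable) (MK_int hmk hfin ((int_uu' (pp γ δ)).const_mul (DD γ δ C))) ?_ ?_
    · intro q
      filter_upwards [hae] with x hx
      exact WW_bound hγ0 hγ1 hδ h hx
    · filter_upwards [hae] with x hx
      exact WW_tendsto hγ0 hγ1 hδ h hx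
  obtain ⟨q, hq⟩ := (ht.eventually (gt_mem_nhds (show _ < η * (muG γ ν).real univ from lt_of_le_of_lt h0 (by positivity)))).exists
  obtain ⟨M, hM⟩ := mix_mu hγ0 hγ1 hν (WW_int (q := q) hγ0 hγ1 hδ h) hη hq.le
  exact ⟨q, M, hM⟩

end

lemma ZZ_neg {φ : ℝ → ℝ} {x : ℝ} : ZZ γ (fun y => - φ y) x = - ZZ γ φ x := by
  simp [ZZ]

lemma Obs.neg {δ : ℝ} {φ : ℝ → ℝ} {C : ℝ} (h : Obs δ φ C) : Obs δ (fun x => - φ x) C :=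
  ⟨h.meas.neg, h.pos, fun x hx => by rw [abs_neg]; exact h.bd x hx, h.cont.neg⟩

lemma logObs_eq {δ : ℝ} {x : ℝ} (hx : x ∈ Ioc (0:ℝ) 1) : logObs δ x = (-Real.log x) ^ δ := by
  rw [logObs, if_neg (not_le.2 hx.1), abs_of_nonpos (Real.log_nonpos hx.1.le hx.2)]

lemma logObs_meas {δ : ℝ} : Measurable (logObs δ) := by
  unfold logObs
  refine Measurable.ite measurableSet_Iic measurable_const ?_
  exact (Real.measurable_log.abs).pow_const δ

lemma logObs_nonneg {δ : ℝ} (x : ℝ) : 0 ≤ logObs δ x := by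
  unfold logObs; split_ifs
  · exact le_rfl
  · positivity

lemma logObs_le {δ : ℝ} (hδ : 0 < δ) {x : ℝ} (hx : x ∈ Ioc (0:ℝ) 1) : |logObs δ x| ≤ 1 * uu x ^ δ := by
  rw [abs_of_nonneg (logObs_nonneg x), logObs_eq hx, one_mul]
  have := Real.log_nonpos hx.1.le hx.2
  refine Real.rpow_le_rpow (by linarith) ?_ hδ.le
  unfold uu; linarith

lemma logObs_obs {δ : ℝ} (hδ : 0 < δ) (A : ℝ) : Obs δ (fun x => logObs δ x - A) (1 + |A|) := by
  refine ⟨logObs_meas.sub_const A, by positivity, ?_, ?_⟩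
  · intro x hx
    have h1 := logObs_le hδ hx
    have h2 : 1 ≤ uu x ^ δ := Real.one_le_rpow (uu_ge hx) hδ.le
    have h3 := abs_sub (logObs δ x) A
    have h4 : |A| * 1 ≤ |A| * uu x ^ δ := by gcongr
    linarith
  · refine ContinuousOn.sub ?_ continuousOn_const
    refine ContinuousOn.congr (f := fun x => (-Real.log x) ^ δ) ?_ (fun x hx => logObs_eq hx)
    refine ContinuousOn.rpow_const ?_ (fun x _ => Or.inr hδ.le)
    exact (Real.continuousOn_log.mono fun x hx => hx.1.ne').neg

lemma ZZ_center (hγ0 : 0 < γ) (hγ1 : γ ≤ 1) {ν : Measure ℝ} (h : InvM γ ν) {δ : ℝ} (hδ : 0 < δ) : 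
    Integrable (logObs δ) ν ∧ ∫ x, ZZ γ (fun x => logObs δ x - ∫ z, logObs δ z ∂ν) x ∂(muG γ ν) = 0 := by
  have := muG_fin h
  have := h.prob
  have h1 := kac_nonneg hγ0 hγ1 h hδ.le logObs_meas zero_le_one (fun x hx => logObs_le hδ hx) logObs_nonneg
  have hb : ∀ x ∈ Ioc (0:ℝ) 1, |(1:ℝ)| ≤ 1 * uu x ^ (0:ℝ) := by intro x hx; simp
  have h2 := kac_nonneg hγ0 hγ1 h le_rfl (φ := fun _ => 1) measurable_const zero_le_one hb (fun _ => zero_le_one)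
  refine ⟨h1.1, ?_⟩
  have hmk := muG_MK hγ0 hγ1 h
  have hfin : muG γ ν univ ≠ ∞ := measure_ne_top _ _
  have i1 := MK_int hmk hfin (ZZ_int hγ0 hγ1 hδ.le logObs_meas zero_le_one (fun x hx => logObs_le hδ hx))
  have i2 := MK_int hmk hfin (ZZ_int (φ := fun _ => 1) hγ0 hγ1 le_rfl measurable_const zero_le_one hb)
  have e : ∀ x, ZZ γ (fun x => logObs δ x - ∫ z, logObs δ z ∂ν) x = 
      ZZ γ (logObs δ) x - (∫ z, logObs δ z ∂ν) * ZZ γ (fun _ => 1) x := by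
    intro x
    simp only [ZZ, Finset.sum_sub_distrib, Finset.mul_sum, mul_one]
  simp_rw [e]
  rw [integral_sub i1 (i2.const_mul _), integral_const_mul, ← h1.2, ← h2.2]
  simp

end LD
end

section
open MeasureTheory Set Filter Topology
open scoped ENNReal

namespace LD

variable {γ : ℝ}

/-- stretched exponential decay -/
def EB (α : ℝ) (f : ℕ → ℝ≥0∞) : Prop :=
  ∃ C κ : ℝ, 0 < C ∧ 0 < κ ∧ ∀ n : ℕ, 1 ≤ n → f n ≤ ENNReal.ofReal (C * Real.exp (-κ * (n:ℝ) ^ α))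

lemma EB.mono {α : ℝ} {f g : ℕ → ℝ≥0∞} (h : EB α g) (hle : ∀ n : ℕ, 1 ≤ n → f n ≤ g n) : EB α f := by
  obtain ⟨C, κ, hC, hκ, h⟩ := h
  exact ⟨C, κ, hC, hκ, fun n hn => (hle n hn).trans (h n hn)⟩

lemma EB.add {α : ℝ} {f g : ℕ → ℝ≥0∞} (h : EB α f) (h' : EB α g) : EB α (fun n => f n + g n) := by
  obtain ⟨C, κ, hC, hκ, h⟩ := h
  obtain ⟨C', κ', hC', hκ', h'⟩ := h'
  refine ⟨C + C', min κ κ', by positivity, lt_min hκ hκ', fun n hn => ?_⟩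
  refine (add_le_add (h n hn) (h' n hn)).trans ?_
  rw [← ENNReal.ofReal_add (by positivity) (by positivity), add_mul]
  have hn0 : 0 ≤ (n:ℝ) ^ α := by positivity
  refine ENNReal.ofReal_le_ofReal (add_le_add ?_ ?_)
  · gcongr; exact min_le_left _ _
  · gcongr; exact min_le_right _ _

lemma EB.const_mul {α : ℝ} {f : ℕ → ℝ≥0∞} (h : EB α f) {c : ℝ≥0∞} (hc : c ≠ ∞) : EB α (fun n => c * f n) := by
  obtain ⟨C, κ, hC, hκ, h⟩ := h
  refine ⟨(c.toReal + 1) * C, κ, by positivity, hκ, fun n hn => ?_⟩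
  rw [mul_assoc, ENNReal.ofReal_mul (by positivity)]
  refine mul_le_mul' ?_ (h n hn)
  calc c = ENNReal.ofReal c.toReal := (ENNReal.ofReal_toReal hc).symm
    _ ≤ _ := ENNReal.ofReal_le_ofReal (by linarith)

lemma EB.nat_mul {α : ℝ} (hα : 0 < α) {f : ℕ → ℝ≥0∞} (h : EB α f) : EB α (fun n => (n : ℝ≥0∞) * f n) := by
  obtain ⟨C, κ, hC, hκ, h⟩ := h
  obtain ⟨D, hD, hb⟩ := rpow_le_exp (r := 1/α) (ε := κ/2) (by positivity)
  refine ⟨D * C, κ/2, by positivity, by positivity, fun n hn => ?_⟩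
  have hn1 : (1:ℝ) ≤ n := by exact_mod_cast hn
  have h1 := hb ((n:ℝ)^α) (Real.one_le_rpow hn1 hα.le)
  rw [← Real.rpow_mul (by linarith), mul_one_div_cancel hα.ne', Real.rpow_one] at h1
  calc (n:ℝ≥0∞) * f n ≤ ENNReal.ofReal n * ENNReal.ofReal (C * Real.exp (-κ * (n:ℝ) ^ α)) := by
        rw [ENNReal.ofReal_natCast]
        gcongr; exact h n hn
    _ = ENNReal.ofReal (n * (C * Real.exp (-κ * (n:ℝ) ^ α))) := by rw [← ENNReal.ofReal_mul (by linarith)]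
    _ ≤ _ := by
      refine ENNReal.ofReal_le_ofReal ?_
      calc _ ≤ D * Real.exp (κ/2 * (n:ℝ)^α) * (C * Real.exp (-κ * (n:ℝ) ^ α)) := by gcongr
        _ = D * C * (Real.exp (κ/2 * (n:ℝ)^α) * Real.exp (-κ * (n:ℝ) ^ α)) := by ring
        _ = _ := by rw [← Real.exp_add]; congr 2; ring

lemma exp_ineq (y : ℝ) : Real.exp y ≤ 1 + y + y^2 * Real.exp (max y 0) := by
  rcases le_total 0 y with h | h
  · rw [max_eq_left h]
    have h1 := Real.one_sub_le_exp_neg y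
    have h2 : Real.exp (-y) * Real.exp y = 1 := by rw [← Real.exp_add]; simp
    have h3 := Real.exp_pos y
    have h4 : (1 - y) * Real.exp y ≤ 1 := (mul_le_mul_of_nonneg_right h1 h3.le).trans h2.le
    nlinarith
  · rw [max_eq_right h, Real.exp_zero, mul_one]
    have h1 := Real.add_one_le_exp (-y)
    have h2 : Real.exp (-y) * Real.exp y = 1 := by rw [← Real.exp_add]; simp
    have h3 := Real.exp_pos y
    have h4 : (-y + 1) * Real.exp y ≤ 1 := (mul_le_mul_of_nonneg_right h1 h3.le).trans h2.le
    have h5 : (1 - y) * (1 + y + y^2) = 1 + (-y)^3 := by ring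
    have h6 : 0 ≤ (-y)^3 := by have : 0 ≤ -y := by linarith
                               positivity
    by_contra hc
    push Not at hc
    nlinarith

lemma lamY {p D s N w u : ℝ} (hp : 1 ≤ p) (hD : 0 < D) (hs : 0 < s) (hsD : s * D ^ (1/p) ≤ 1/2) (hN : 1 ≤ N) (hu : 1 ≤ u)
    (hw : |w| ≤ D * u ^ p) : max (s * N ^ (1/p - 1) * min w N) 0 ≤ u / 2 := by
  have hp0 : 0 < p := by linarith
  refine max_le ?_ (by linarith)
  rcases le_or_gt (min w N) 0 with h | h
  · have : s * N ^ (1/p - 1) * min w N ≤ 0 := mul_nonpos_of_nonneg_of_nonpos (by positivity) h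
    linarith
  set Y := min w N
  have hYN : Y ≤ N := min_le_right _ _
  have hYD : Y ≤ D * u ^ p := (min_le_left _ _).trans ((le_abs_self _).trans hw)
  have e : Y = Y ^ (1/p) * Y ^ (1 - 1/p) := by
    rw [← Real.rpow_add h]; simp
  have hq : 0 ≤ 1 - 1/p := by
    rw [sub_nonneg, div_le_one hp0]; exact hp
  have h1 : Y ^ (1/p) ≤ D ^ (1/p) * u := by
    calc _ ≤ (D * u ^ p) ^ (1/p) := Real.rpow_le_rpow h.le hYD (by positivity)
      _ = _ := by
        rw [Real.mul_rpow hD.le (by positivity), ← Real.rpow_mul (by linarith), mul_one_div_cancel hp0.ne', Real.rpow_one]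
  have h2 : Y ^ (1 - 1/p) ≤ N ^ (1 - 1/p) := Real.rpow_le_rpow h.le hYN hq
  have h3 : N ^ (1/p - 1) * N ^ (1 - 1/p) = 1 := by
    rw [← Real.rpow_add (by linarith)]; simp
  calc s * N ^ (1/p - 1) * Y = s * N ^ (1/p - 1) * (Y ^ (1/p) * Y ^ (1 - 1/p)) := by rw [← e]
    _ ≤ s * N ^ (1/p - 1) * ((D ^ (1/p) * u) * N ^ (1 - 1/p)) := by gcongr
    _ = (s * D ^ (1/p)) * u * (N ^ (1/p - 1) * N ^ (1 - 1/p)) := by ring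
    _ ≤ 1/2 * u * 1 := by rw [h3]; gcongr
    _ = _ := by ring

lemma mom (hγ0 : 0 < γ) (hγ1 : γ ≤ 1) {p D η : ℝ} (hp : 1 ≤ p) (hD : 0 < D) (hη : 0 < η) {Wf : ℝ → ℝ} (hWm : Measurable Wf) 
    (hW : ∀ x ∈ Ioc (0:ℝ) 1, |Wf x| ≤ D * uu x ^ p) {M : ℕ}
    (hM : ∀ ρ : Measure ℝ, MK γ ρ → ρ univ ≠ ∞ → ∫ x, Wf x ∂(ρ.map (GG γ)^[M]) ≤ 2 * η * ρ.real univ) : 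
    ∃ s > 0, ∀ N : ℝ, 1 ≤ N → ∀ ρ : Measure ℝ, MK γ ρ → ρ univ ≠ ∞ → 
      ∫⁻ x, ENNReal.ofReal (Real.exp (s * N ^ (1/p - 1) * min (Wf ((GG γ)^[M] x)) N)) ∂ρ ≤ 
        ENNReal.ofReal (Real.exp (3 * η * (s * N ^ (1/p - 1)))) * ρ univ := by
  have hp0 : 0 < p := by linarith
  have hc := one_le_cD hγ0 hγ1
  set I := ∫ x, uu x ^ (2*p) * Real.exp (uu x / 2) ∂mI with hI
  have hInn : 0 ≤ I := by
    refine integral_nonneg_of_ae ?_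
    filter_upwards [ae_mI] with x hx
    have := uu_ge hx
    simp only [Pi.zero_apply]
    positivity
  set K := D^2 * (2 * cD γ * I) with hK
  have hK0 : 0 ≤ K := by positivity
  have hDp : 0 < D ^ (1/p) := by positivity
  refine ⟨min (1 / (2 * D ^ (1/p))) (η / (K + 1)), lt_min (by positivity) (by positivity), ?_⟩
  intro N hN ρ hρ hf
  set s := min (1 / (2 * D ^ (1/p))) (η / (K + 1))
  have hs : 0 < s := lt_min (by positivity) (by positivity)
  have hs1 : s * D ^ (1/p) ≤ 1/2 := by
    calc _ ≤ 1 / (2 * D ^ (1/p)) * D ^ (1/p) := by gcongr; exact min_le_left _ _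
      _ = _ := by field_simp
  have hs2 : s * K ≤ η := by
    calc _ ≤ η / (K+1) * K := by gcongr; exact min_le_right _ _
      _ = η * (K / (K+1)) := by ring
      _ ≤ η * 1 := by gcongr; rw [div_le_one (by positivity)]; linarith
      _ = η := mul_one _
  set lam := s * N ^ (1/p - 1) with hlam
  have hl0 : 0 < lam := by positivity
  have hls : lam ≤ s := by
    have : N ^ (1/p - 1) ≤ 1 := Real.rpow_le_one_of_one_le_of_nonpos hN (by
      rw [sub_nonpos, div_le_one hp0]; exact hp)
    calc _ ≤ s * 1 := by rw [hlam]; gcongr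
      _ = s := mul_one _
  set σ := ρ.map (GG γ)^[M] with hσ
  have hσK : MK γ σ := push_MK_iter hγ0 hγ1 hρ M
  have hσu : σ univ = ρ univ := map_univ' M
  have hσf : σ univ ≠ ∞ := by rwa [hσu]
  have : IsFiniteMeasure σ := ⟨lt_top_iff_ne_top.2 hσf⟩
  have hσr : σ.real univ = ρ.real univ := by rw [measureReal_def, hσu]; rfl
  have hae : ∀ᵐ x ∂σ, x ∈ Ioc (0:ℝ) 1 := by
    obtain ⟨g, _, _, e⟩ := hσK
    rw [e]
    exact (withDensity_absolutelyContinuous _ _).ae_le ae_mI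
  have hmeas : Measurable (fun x => Real.exp (lam * min (Wf x) N)) := by fun_prop
  have e1 : ∫⁻ x, ENNReal.ofReal (Real.exp (lam * min (Wf ((GG γ)^[M] x)) N)) ∂ρ = 
      ∫⁻ x, ENNReal.ofReal (Real.exp (lam * min (Wf x) N)) ∂σ := by
    rw [hσ, lintegral_map hmeas.ennreal_ofReal (GG_iter_meas M)]
  have iW : Integrable Wf σ := by
    refine MK_int hσK hσf ?_
    refine Integrable.mono' ((int_uu' p).const_mul D) hWm.aestronglyMeasurable ?_
    filter_upwards [ae_mI] with x hx
    exact hW x hx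
  have iU : Integrable (fun x => uu x ^ (2*p) * Real.exp (uu x / 2)) σ := MK_int hσK hσf (int_uu _)
  have iR : Integrable (fun x => 1 + lam * Wf x + (lam^2 * D^2) * (uu x ^ (2*p) * Real.exp (uu x / 2))) σ :=
    ((integrable_const 1).add (iW.const_mul lam)).add (iU.const_mul _)
  have hpt : ∀ᵐ x ∂σ, Real.exp (lam * min (Wf x) N) ≤ 1 + lam * Wf x + (lam^2 * D^2) * (uu x ^ (2*p) * Real.exp (uu x / 2)) := by
    filter_upwards [hae] with x hx
    have hu := uu_ge hx
    have a1 := exp_ineq (lam * min (Wf x) N)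
    have a2 := lamY hp hD hs hs1 hN hu (hW x hx)
    have a3 : lam * min (Wf x) N ≤ lam * Wf x := by gcongr; exact min_le_left _ _
    have a4 : |min (Wf x) N| ≤ D * uu x ^ p := by
      refine le_trans ?_ (hW x hx)
      rcases le_total (Wf x) N with h | h
      · rw [min_eq_left h]
      · rw [min_eq_right h, abs_of_nonneg (by linarith), abs_of_nonneg (by linarith)]; exact h
    have a5 : (min (Wf x) N)^2 ≤ D^2 * uu x ^ (2*p) := by
      rw [← sq_abs]
      calc _ ≤ (D * uu x ^ p)^2 := by gcongr
        _ = D^2 * (uu x ^ p)^2 := by ring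
        _ = _ := by rw [← Real.rpow_natCast (uu x ^ p), ← Real.rpow_mul (by linarith), mul_comm p]; norm_num
    have a6 : (lam * min (Wf x) N)^2 * Real.exp (max (lam * min (Wf x) N) 0) ≤ (lam^2 * D^2) * (uu x ^ (2*p) * Real.exp (uu x / 2)) := by
      calc _ = lam^2 * ((min (Wf x) N)^2 * Real.exp (max (lam * min (Wf x) N) 0)) := by ring
        _ ≤ lam^2 * ((D^2 * uu x ^ (2*p)) * Real.exp (uu x / 2)) := by gcongr
        _ = _ := by ring
    linarith
  have iE : Integrable (fun x => Real.exp (lam * min (Wf x) N)) σ := by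
    refine Integrable.mono' iR hmeas.aestronglyMeasurable ?_
    filter_upwards [hpt] with x hx
    rwa [Real.norm_of_nonneg (Real.exp_pos _).le]
  have hmain : ∫ x, Real.exp (lam * min (Wf x) N) ∂σ ≤ Real.exp (3 * η * lam) * ρ.real univ := by
    have b1 := integral_mono_ae iE iR hpt
    rw [integral_add (f := fun x => 1 + lam * Wf x) ((integrable_const 1).add (iW.const_mul lam)) (iU.const_mul _), 
      integral_add (integrable_const 1) (iW.const_mul lam), integral_const_mul, integral_const_mul, integral_const, hσr, smul_eq_mul, mul_one] at b1
    have b2 := hM ρ hρ hf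
    have b3 : ∫ x, uu x ^ (2*p) * Real.exp (uu x / 2) ∂σ ≤ 2 * cD γ * ρ.real univ * I := by
      rw [← hσr]
      have := integral_mono_measure (MK_le hσK) (f := fun x => uu x ^ (2*p) * Real.exp (uu x / 2)) ?_ ((int_uu _).smul_measure (c := ENNReal.ofReal (2 * cD γ) * σ univ) (ENNReal.mul_ne_top ENNReal.ofReal_ne_top hσf))
      · refine this.trans (le_of_eq ?_)
        rw [integral_smul_measure, ENNReal.toReal_mul, ENNReal.toReal_ofReal (by linarith)]
        rfl
      · refine Measure.ae_smul_measure ?_ _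
        filter_upwards [ae_mI] with x hx
        have := uu_ge hx
        simp only [Pi.zero_apply]
        positivity
    have hw : 0 ≤ ρ.real univ := measureReal_nonneg
    have b4 := Real.add_one_le_exp (3 * η * lam)
    have b5 : lam * ∫ x, Wf x ∂σ ≤ lam * (2 * η * ρ.real univ) := by gcongr
    have b6 : lam^2 * D^2 * ∫ x, uu x ^ (2*p) * Real.exp (uu x / 2) ∂σ ≤ lam * η * ρ.real univ := by
      calc _ ≤ lam^2 * D^2 * (2 * cD γ * ρ.real univ * I) := by gcongr
        _ = lam * (lam * K) * ρ.real univ := by rw [hK]; ring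
        _ ≤ lam * (s * K) * ρ.real univ := by gcongr
        _ ≤ _ := by gcongr
    calc _ ≤ _ := b1
      _ ≤ ρ.real univ + lam * (2 * η * ρ.real univ) + lam * η * ρ.real univ := by linarith
      _ = (3 * η * lam + 1) * ρ.real univ := by ring
      _ ≤ _ := by gcongr
  rw [e1, ← ofReal_integral_eq_lintegral_ofReal iE (Eventually.of_forall fun x => (Real.exp_pos _).le)]
  calc _ ≤ ENNReal.ofReal (Real.exp (3 * η * lam) * ρ.real univ) := ENNReal.ofReal_le_ofReal hmain
    _ = _ := by rw [ENNReal.ofReal_mul (Real.exp_pos _).le, ofReal_measureReal hf]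

lemma iter_cyl (hγ0 : 0 < γ) (hγ1 : γ ≤ 1) {b : ℕ} {V : List ℕ → ℝ≥0∞} (hV : ∀ l, V l ≠ ∞) {B : ℝ≥0∞} (hB : B ≠ ∞)
    (h : ∀ ρ : Measure ℝ, MK γ ρ → ρ univ ≠ ∞ → ∫⁻ x, V (itin γ b x) ∂ρ ≤ B * ρ univ) (J : ℕ) : 
    ∀ ρ : Measure ℝ, MK γ ρ → ρ univ ≠ ∞ → 
      ∫⁻ x, ∏ j ∈ Finset.range J, V (itin γ b ((GG γ)^[b * j] x)) ∂ρ ≤ B ^ J * ρ univ := by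
  induction J with
  | zero => intro ρ _ _; simp
  | succ J ih =>
    intro ρ hρ hf
    have hm : Measurable (fun x => ∏ j ∈ Finset.range J, V (itin γ b ((GG γ)^[b * j] x))) :=
      Finset.measurable_prod _ fun j _ => (itin_meas b V).comp (GG_iter_meas _)
    have e : ∀ x, ∏ j ∈ Finset.range (J+1), V (itin γ b ((GG γ)^[b * j] x)) = 
        V (itin γ b x) * ∏ j ∈ Finset.range J, V (itin γ b ((GG γ)^[b * j] ((GG γ)^[b] x))) := by
      intro x
      rw [Finset.prod_range_succ', mul_comm]
      simp only [mul_zero, Function.iterate_zero, id]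
      congr 1
      refine Finset.prod_congr rfl fun j _ => ?_
      rw [← Function.iterate_add_apply, mul_add, mul_one]
    set σ := (ρ.withDensity (fun x => V (itin γ b x))).map (GG γ)^[b] with hσ
    have hu : σ univ = ∫⁻ x, V (itin γ b x) ∂ρ := by
      rw [hσ, map_univ', withDensity_apply _ MeasurableSet.univ, Measure.restrict_univ]
    have hle := h ρ hρ hf
    have hσf : σ univ ≠ ∞ := by
      rw [hu]
      exact ne_top_of_le_ne_top (ENNReal.mul_ne_top hB hf) hle
    have h1 := ih σ (MK_cyl hγ0 hγ1 b V hV ρ hρ) hσf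
    have h2 : ∫⁻ x, ∏ j ∈ Finset.range J, V (itin γ b ((GG γ)^[b * j] x)) ∂σ = _ :=
      (lintegral_map hm (GG_iter_meas b)).trans (lintegral_withDensity_eq_lintegral_mul ρ (itin_meas (γ := γ) b V) (hm.comp (GG_iter_meas b)))
    rw [h2] at h1
    calc _ = ∫⁻ x, ((fun x => V (itin γ b x)) * fun x => ∏ j ∈ Finset.range J, V (itin γ b ((GG γ)^[b * j] ((GG γ)^[b] x)))) x ∂ρ := 
          lintegral_congr fun x => e x
      _ ≤ B ^ J * σ univ := h1
      _ ≤ B ^ J * (B * ρ univ) := by rw [hu]; gcongr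
      _ = _ := by rw [pow_succ]; ring

end LD
end

section
open MeasureTheory Set Filter Topology
open scoped ENNReal

namespace LD

variable {γ : ℝ}

lemma chern (hγ0 : 0 < γ) (hγ1 : γ ≤ 1) {Q M : ℕ} {F : List ℕ → ℝ} {lam N e : ℝ} (hl : 0 < lam)
    (h : ∀ ρ : Measure ℝ, MK γ ρ → ρ univ ≠ ∞ → 
      ∫⁻ x, ENNReal.ofReal (Real.exp (lam * min (F (itin γ Q ((GG γ)^[M] x))) N)) ∂ρ ≤ 
        ENNReal.ofReal (Real.exp (e * lam)) * ρ univ) (J : ℕ) (t : ℝ) (ρ : Measure ℝ) (hρ : MK γ ρ) (hρ1 : ρ univ = 1) : 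
    ρ {x | t < ∑ j ∈ Finset.range J, min (F (itin γ Q ((GG γ)^[M] ((GG γ)^[(M+Q) * j] x)))) N} ≤ 
      ENNReal.ofReal (Real.exp (lam * (e * J - t))) := by
  set b := M + Q
  set V : List ℕ → ℝ≥0∞ := fun l => ENNReal.ofReal (Real.exp (lam * min (F (l.drop M)) N)) with hV
  have hVe : ∀ x, V (itin γ b x) = ENNReal.ofReal (Real.exp (lam * min (F (itin γ Q ((GG γ)^[M] x))) N)) := by
    intro x
    simp only [hV, itin_drop, b]
  have h1 := iter_cyl hγ0 hγ1 (b := b) (V := V) (fun l => ENNReal.ofReal_ne_top) (B := ENNReal.ofReal (Real.exp (e * lam))) 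
    ENNReal.ofReal_ne_top (by
      intro ρ hρ hf
      simp_rw [hVe]
      exact h ρ hρ hf) J ρ hρ (by rw [hρ1]; simp)
  have hm : Measurable (fun x => ∏ j ∈ Finset.range J, V (itin γ b ((GG γ)^[b * j] x))) :=
      Finset.measurable_prod _ fun j _ => (itin_meas b V).comp (GG_iter_meas _)
  have h2 := mul_meas_ge_le_lintegral (μ := ρ) hm (ENNReal.ofReal (Real.exp (lam * t)))
  have hsub : {x | t < ∑ j ∈ Finset.range J, min (F (itin γ Q ((GG γ)^[M] ((GG γ)^[b * j] x)))) N} ⊆ 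
      {x | ENNReal.ofReal (Real.exp (lam * t)) ≤ ∏ j ∈ Finset.range J, V (itin γ b ((GG γ)^[b * j] x))} := by
    intro x hx
    rw [mem_ofPred_eq] at hx ⊢
    simp_rw [hVe]
    rw [← ENNReal.ofReal_prod_of_nonneg (fun j _ => (Real.exp_pos _).le), ← Real.exp_sum, ← Finset.mul_sum]
    refine ENNReal.ofReal_le_ofReal (Real.exp_le_exp.2 ?_)
    gcongr
  have e1 : ENNReal.ofReal (Real.exp (-(lam * t))) * ENNReal.ofReal (Real.exp (lam * t)) = 1 := by
    rw [← ENNReal.ofReal_mul (Real.exp_pos _).le, ← Real.exp_add]; simp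
  calc _ ≤ ρ {x | ENNReal.ofReal (Real.exp (lam * t)) ≤ ∏ j ∈ Finset.range J, V (itin γ b ((GG γ)^[b * j] x))} := measure_mono hsub
    _ = ENNReal.ofReal (Real.exp (-(lam * t))) * (ENNReal.ofReal (Real.exp (lam * t)) * ρ {x | ENNReal.ofReal (Real.exp (lam * t)) ≤ ∏ j ∈ Finset.range J, V (itin γ b ((GG γ)^[b * j] x))}) := by
      rw [← mul_assoc, e1, one_mul]
    _ ≤ ENNReal.ofReal (Real.exp (-(lam * t))) * (ENNReal.ofReal (Real.exp (e * lam)) ^ J * 1) := by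
      refine mul_le_mul' le_rfl ?_
      rw [← hρ1]
      exact h2.trans h1
    _ = _ := by
      rw [mul_one, ← ENNReal.ofReal_pow (Real.exp_pos _).le, ← Real.exp_nat_mul, ← ENNReal.ofReal_mul (Real.exp_pos _).le, ← Real.exp_add]
      congr 2; ring

lemma sum_blocks (a : ℕ → ℝ) (b J : ℕ) : 
    ∑ i ∈ Finset.range (b * J), a i = ∑ r ∈ Finset.range b, ∑ j ∈ Finset.range J, a (b * j + r) := by
  induction J with
  | zero => simp
  | succ J ih =>
    rw [mul_add, mul_one, Finset.sum_range_add, ih, ← Finset.sum_add_distrib]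
    refine Finset.sum_congr rfl fun r _ => ?_
    rw [Finset.sum_range_succ]

lemma leftover (a : ℕ → ℝ) {B : ℝ} (hB : 0 ≤ B) {n k M b J : ℕ} (ha : ∀ i < n + M + b, |a i| ≤ B) (hk : k ≤ n) 
    (h1 : b * J ≤ k) (h2 : k ≤ b * J + b) : 
    ∑ i ∈ Finset.range k, a i ≤ ∑ i ∈ Finset.range (b * J), a (M + i) + (2 * M + b) * B := by
  have hbd : ∀ (f : ℕ → ℕ) (c : ℕ), (∀ i < c, f i < n + M + b) → |∑ i ∈ Finset.range c, a (f i)| ≤ c * B := by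
    intro f c hf
    refine (Finset.abs_sum_le_sum_abs _ _).trans ?_
    calc _ ≤ ∑ i ∈ Finset.range c, B := Finset.sum_le_sum fun i hi => ha _ (hf i (Finset.mem_range.1 hi))
      _ = _ := by simp
  obtain ⟨c, rfl⟩ := Nat.exists_eq_add_of_le h1
  have hc : c ≤ b := by omega
  rw [Finset.sum_range_add]
  have e1 := Finset.sum_range_add a (b * J) M
  have e2 := Finset.sum_range_add a M (b * J)
  rw [add_comm (b*J) M] at e1
  have k1 := (abs_le.1 (hbd (fun i => b * J + i) c (fun i hi => by omega))).2
  have k2 := (abs_le.1 (hbd (fun i => b * J + i) M (fun i hi => by omega))).1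
  have k3 := (abs_le.1 (hbd (fun i => i) M (fun i hi => by omega))).2
  have k4 : (c:ℝ) * B ≤ b * B := by gcongr
  linarith

lemma map_tail (hγ0 : 0 < γ) (hγ1 : γ ≤ 1) (i : ℕ) (v : ℝ) : 
    mI {x | v < uu ((GG γ)^[i] x)} ≤ ENNReal.ofReal (2 * cD γ) * ENNReal.ofReal (Real.exp (1 - v)) := by
  have hm : MeasurableSet {x | v < uu x} := measurableSet_lt measurable_const uu_meas
  have h := MK_le (push_MK_iter hγ0 hγ1 (MK_mI hγ0 hγ1) i) {x | v < uu x}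
  rw [Measure.map_apply (GG_iter_meas i) hm, map_univ'] at h
  simp only [measure_univ, mul_one, Measure.smul_apply, smul_eq_mul] at h
  exact h.trans (by gcongr; exact uu_tail)

/-- tail of Ψ along orbit -/
lemma tail_EB (hγ0 : 0 < γ) (hγ1 : γ ≤ 1) {p D θ : ℝ} (hp : 1 ≤ p) (hD : 0 < D) (hθ : 0 < θ) (c : ℕ) :
    EB (1/p) (fun n => mI {x | x ∈ Ioc (0:ℝ) 1 ∧ ∃ i < c * n, θ * n < D * uu ((GG γ)^[i] x) ^ p}) := by
  have hp0 : 0 < p := by linarith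
  have key : EB (1/p) (fun n => ENNReal.ofReal (Real.exp (1 - (θ * n / D) ^ (1/p)))) := by
    refine ⟨Real.exp 1, (θ / D) ^ (1/p), Real.exp_pos _, by positivity, fun n hn => ?_⟩
    refine ENNReal.ofReal_le_ofReal ?_
    rw [← Real.exp_add]
    refine Real.exp_le_exp.2 (le_of_eq ?_)
    rw [mul_div_right_comm, Real.mul_rpow (by positivity) (by positivity)]
    ring
  refine EB.mono (((key.nat_mul (by positivity)).const_mul (c := c * ENNReal.ofReal (2 * cD γ)) 
    (ENNReal.mul_ne_top (by simp) ENNReal.ofReal_ne_top))) fun n hn => ?_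
  have hsub : {x | x ∈ Ioc (0:ℝ) 1 ∧ ∃ i < c * n, θ * n < D * uu ((GG γ)^[i] x) ^ p} ⊆ 
      ⋃ i ∈ Finset.range (c * n), {x | (θ * n / D) ^ (1/p) < uu ((GG γ)^[i] x)} := by
    rintro x ⟨hx, i, hi, h⟩
    simp only [mem_iUnion, Finset.mem_range]
    refine ⟨i, hi, ?_⟩
    have hu := uu_ge (GG_iter_mem hγ0 hγ1 hx i)
    show (θ * n / D) ^ (1/p) < uu ((GG γ)^[i] x)
    have h1 : θ * n / D < uu ((GG γ)^[i] x) ^ p := by rw [div_lt_iff₀ hD, mul_comm (_ ^ p)]; exact h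
    have h2 := Real.rpow_lt_rpow (by positivity) h1 (z := 1/p) (by positivity)
    rwa [← Real.rpow_mul (by linarith), mul_one_div_cancel hp0.ne', Real.rpow_one] at h2
  refine (measure_mono hsub).trans ((measure_biUnion_finset_le _ _).trans ?_)
  calc _ ≤ ∑ i ∈ Finset.range (c * n), ENNReal.ofReal (2 * cD γ) * ENNReal.ofReal (Real.exp (1 - (θ * n / D) ^ (1/p))) :=
        Finset.sum_le_sum fun i _ => map_tail hγ0 hγ1 i _
    _ = _ := by
      rw [Finset.sum_const, Finset.card_range, nsmul_eq_mul]
      push_cast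
      ring

lemma LDG (hγ0 : 0 < γ) (hγ1 : γ ≤ 1) {δ : ℝ} (hδ : 0 ≤ δ) {φ : ℝ → ℝ} {C : ℝ} (h : Obs δ φ C) {ν : Measure ℝ} (hν : InvM γ ν) 
    (h0 : ∫ x, ZZ γ φ x ∂(muG γ ν) ≤ 0) {ε : ℝ} (hε : 0 < ε) : 
    EB (1 / pp γ δ) (fun n => ∑ k ∈ Finset.range (n+1), 
      mI {x | x ∈ Ioc (0:ℝ) 1 ∧ ε * n < ∑ i ∈ Finset.range k, ZZ γ φ ((GG γ)^[i] x)}) := by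
  set p := pp γ δ
  have hp : 1 ≤ p := pp_ge hγ0 hγ1 hδ
  have hp0 : 0 < p := by linarith
  set D := DD γ δ C
  have hD : 0 < D := DD_pos hγ0 hγ1 h.pos
  obtain ⟨q, M, hM⟩ := approx hγ0 hγ1 hδ h hν h0 (η := ε / 24) (by positivity)
  set Q := q + 1
  set F := WW γ φ Q
  obtain ⟨s, hs, hmom⟩ := mom hγ0 hγ1 hp hD (by positivity) (itin_meas (γ := γ) Q F) 
    (fun x hx => WW_bound hγ0 hγ1 hδ h hx) hM
  set b := M + Q with hb
  have hb0 : 0 < b := by omega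
  have hbr : (0:ℝ) < b := by exact_mod_cast hb0
  set θ := min 1 (ε / (2 * (2 * M + b))) with hθd
  have hθ : 0 < θ := lt_min one_pos (by positivity)
  have hθ1 : θ ≤ 1 := min_le_left _ _
  have hθ2 : (2 * M + b) * θ ≤ ε / 2 := by
    calc _ ≤ (2 * M + b) * (ε / (2 * (2 * M + b))) := by gcongr; exact min_le_right _ _
      _ = _ := by field_simp
  have T1 := tail_EB (γ := γ) hγ0 hγ1 hp hD hθ (1 + M + b)
  have T2 : EB (1/p) (fun n => ENNReal.ofReal (Real.exp (-(s * ε / (8 * b) * 3) * (n:ℝ) ^ (1/p)))) := 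
    ⟨1, s * ε / (8 * b) * 3, one_pos, by positivity, fun n _ => by rw [one_mul]⟩
  have T3 := T1.add (T2.const_mul (c := b) (by simp))
  refine EB.mono ((T3.nat_mul (by positivity)).const_mul (c := 2) (by simp)) fun n hn => ?_
  have hn1 : (1:ℝ) ≤ n := by exact_mod_cast hn
  have hn0 : (0:ℝ) < n := by linarith
  have main : ∀ k ∈ Finset.range (n+1), mI {x | x ∈ Ioc (0:ℝ) 1 ∧ ε * n < ∑ i ∈ Finset.range k, ZZ γ φ ((GG γ)^[i] x)} ≤ 
      mI {x | x ∈ Ioc (0:ℝ) 1 ∧ ∃ i < (1 + M + b) * n, θ * n < D * uu ((GG γ)^[i] x) ^ p} + 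
        b * ENNReal.ofReal (Real.exp (-(s * ε / (8 * b) * 3) * (n:ℝ) ^ (1/p))) := by
    intro k hk
    have hkn : k ≤ n := by simpa [Nat.lt_succ_iff] using hk
    set J := k / b
    have hJ1 : b * J ≤ k := Nat.mul_div_le k b
    have hJ2 : k ≤ b * J + b := by
      have := Nat.lt_mul_div_succ k hb0
      rw [mul_add, mul_one] at this
      exact this.le
    set lam := s * (n:ℝ) ^ (1/p - 1) with hlam
    have hl : 0 < lam := by positivity
    set t := ε * n / (2 * b) with ht
    set S : ℕ → Set ℝ := fun r => {x | t < ∑ j ∈ Finset.range J, min (F (itin γ Q ((GG γ)^[M] ((GG γ)^[b * j] x)))) n} with hS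
    have hSm : ∀ r, MeasurableSet (S r) := by
      intro r
      refine measurableSet_lt measurable_const (Finset.measurable_sum _ fun j _ => ?_)
      exact Measurable.min ((itin_meas Q F).comp ((GG_iter_meas M).comp (GG_iter_meas _))) measurable_const
    have hsub : {x | x ∈ Ioc (0:ℝ) 1 ∧ ε * n < ∑ i ∈ Finset.range k, ZZ γ φ ((GG γ)^[i] x)} ⊆ 
        {x | x ∈ Ioc (0:ℝ) 1 ∧ ∃ i < (1 + M + b) * n, θ * n < D * uu ((GG γ)^[i] x) ^ p} ∪ 
          ⋃ r ∈ Finset.range b, (GG γ)^[r] ⁻¹' (S r) := by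
      rintro x ⟨hx, hsum⟩
      by_cases hg : ∃ i < (1 + M + b) * n, θ * n < D * uu ((GG γ)^[i] x) ^ p
      · left; exact ⟨hx, hg⟩
      right
      push Not at hg
      have hlt : n + M + b ≤ (1 + M + b) * n := by nlinarith
      have hZ : ∀ i < n + M + b, |ZZ γ φ ((GG γ)^[i] x)| ≤ θ * n := fun i hi => 
        (ZZ_cyl hγ0 hγ1 hδ h (GG_iter_mem hγ0 hγ1 hx i) (GG_iter_mem hγ0 hγ1 hx i) rfl).trans (hg i (by omega))
      have h1 := leftover (fun i => ZZ γ φ ((GG γ)^[i] x)) (by positivity) hZ hkn hJ1 hJ2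
      have h2 : (2 * M + b) * (θ * n) ≤ ε / 2 * n := by rw [← mul_assoc]; gcongr
      have h3 : ∑ i ∈ Finset.range (b * J), ZZ γ φ ((GG γ)^[M+i] x) ≤ 
          ∑ i ∈ Finset.range (b * J), min (F (itin γ Q ((GG γ)^[M+i] x))) n := by
        refine Finset.sum_le_sum fun i hi => ?_
        have hi' : i < b * J := Finset.mem_range.1 hi
        refine le_min (ZZ_le_WW hγ0 hγ1 hδ h (GG_iter_mem hγ0 hγ1 hx _)) ?_
        have := (abs_le.1 (hZ (M+i) (by omega))).2
        nlinarith
      rw [sum_blocks (fun i => min (F (itin γ Q ((GG γ)^[M+i] x))) (n:ℝ))] at h3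
      have h4 : ∑ r ∈ Finset.range b, t < ∑ r ∈ Finset.range b, ∑ j ∈ Finset.range J, min (F (itin γ Q ((GG γ)^[M+(b*j+r)] x))) (n:ℝ) := by
        rw [Finset.sum_const, Finset.card_range, nsmul_eq_mul]
        have : (b:ℝ) * t = ε * n / 2 := by rw [ht]; field_simp
        rw [this]
        linarith
      obtain ⟨r, hr, hlt⟩ := Finset.exists_lt_of_sum_lt h4
      simp only [mem_iUnion]
      refine ⟨r, hr, ?_⟩
      show t < _
      simpa only [← Function.iterate_add_apply, add_assoc] using hlt
    refine (measure_mono hsub).trans ((measure_union_le _ _).trans ?_)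
    gcongr
    refine (measure_biUnion_finset_le _ _).trans ?_
    calc _ ≤ ∑ r ∈ Finset.range b, ENNReal.ofReal (Real.exp (-(s * ε / (8 * b) * 3) * (n:ℝ) ^ (1/p))) := by
          refine Finset.sum_le_sum fun r _ => ?_
          rw [← Measure.map_apply (GG_iter_meas r) (hSm r)]
          refine (chern hγ0 hγ1 hl (hmom n hn1) J t _ (push_MK_iter hγ0 hγ1 (MK_mI hγ0 hγ1) r) (by rw [map_univ']; simp)).trans ?_
          refine ENNReal.ofReal_le_ofReal (Real.exp_le_exp.2 ?_)
          have hJr : (J:ℝ) ≤ n / b := by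
            rw [le_div_iff₀ hbr, mul_comm]
            exact_mod_cast hJ1.trans hkn
          have e1 : (n:ℝ) ^ (1/p) = (n:ℝ) ^ (1/p - 1) * n := by
            rw [Real.rpow_sub_one hn0.ne']; field_simp
          calc lam * (3 * (ε/24) * J - t) ≤ lam * (3 * (ε/24) * (n/b) - t) := by gcongr
            _ = _ := by rw [hlam, ht, e1]; field_simp; ring
      _ = _ := by rw [Finset.sum_const, Finset.card_range, nsmul_eq_mul]
  refine (Finset.sum_le_sum main).trans ?_
  rw [Finset.sum_const, Finset.card_range, nsmul_eq_mul, ← mul_assoc]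
  gcongr
  have : n + 1 ≤ 2 * n := by omega
  exact_mod_cast this

end LD
end

section
open MeasureTheory Set Filter Topology
open scoped ENNReal

namespace LD

variable {γ : ℝ}

lemma decomp (hγ0 : 0 < γ) (hγ1 : γ ≤ 1) {δ : ℝ} (hδ : 0 ≤ δ) {φ : ℝ → ℝ} {C : ℝ} (h : Obs δ φ C) (n : ℕ) : 
    ∀ x ∈ Ioc (0:ℝ) 1, ∃ N ≤ n, |∑ j ∈ Finset.range n, φ ((Tmap γ)^[j] x) - ∑ i ∈ Finset.range N, ZZ γ φ ((GG γ)^[i] x)| 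
      ≤ DD γ δ C * uu ((GG γ)^[N] x) ^ pp γ δ := by
  have hK := K0_ge hγ0 hγ1
  have hp := pp_ge hγ0 hγ1 hδ
  induction n using Nat.strong_induction_on with
  | _ n ih =>
    intro x hx
    rcases le_or_gt n (kk γ x + 1) with hn | hn
    · refine ⟨0, Nat.zero_le _, ?_⟩
      simp only [Finset.range_zero, Finset.sum_empty, sub_zero, Function.iterate_zero, id]
      refine (grow hγ0 hγ1 hδ h.pos.le h.bd n x hx hn).trans ?_
      have hu := uu_ge hx
      have h2 : (1:ℝ) ≤ 2 ^ pp γ δ := Real.one_le_rpow (by norm_num) (by linarith)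
      have hC := h.pos
      unfold DD
      calc C * (K0 γ * uu x ^ pp γ δ) = C * (K0 γ * 1) * uu x ^ pp γ δ := by ring
        _ ≤ _ := by gcongr
    · obtain ⟨m, rfl⟩ := Nat.exists_eq_add_of_le hn.le
      obtain ⟨N, hN, hb⟩ := ih m (by omega) _ (GG_mem hγ0 hγ1 hx)
      refine ⟨N + 1, by omega, ?_⟩
      rw [Finset.sum_range_add, Finset.sum_range_succ' _ N]
      have e1 : ∑ j ∈ Finset.range m, φ ((Tmap γ)^[kk γ x + 1 + j] x) = ∑ j ∈ Finset.range m, φ ((Tmap γ)^[j] (GG γ x)) := by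
        refine Finset.sum_congr rfl fun j _ => ?_
        rw [add_comm, Function.iterate_add_apply]; rfl
      rw [e1]
      simp only [Function.iterate_succ_apply, Function.iterate_zero, id]
      have e2 : ∑ j ∈ Finset.range (kk γ x + 1), φ ((Tmap γ)^[j] x) = ZZ γ φ x := rfl
      rw [e2, add_comm _ (ZZ γ φ x), add_sub_add_left_eq_sub]
      exact hb

lemma LDT (hγ0 : 0 < γ) (hγ1 : γ ≤ 1) {δ : ℝ} (hδ : 0 ≤ δ) {φ : ℝ → ℝ} {C : ℝ} (h : Obs δ φ C) {ν : Measure ℝ} (hν : InvM γ ν) 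
    (h0 : ∫ x, ZZ γ φ x ∂(muG γ ν) = 0) {ε : ℝ} (hε : 0 < ε) : 
    EB (1 / pp γ δ) (fun n => 
      mI {x | x ∈ Ioc (0:ℝ) 1 ∧ ε * n < |∑ j ∈ Finset.range n, φ ((Tmap γ)^[j] x)|}) := by
  have hp := pp_ge hγ0 hγ1 hδ
  have A1 := LDG hγ0 hγ1 hδ h hν h0.le (half_pos hε)
  have A2 := LDG hγ0 hγ1 hδ h.neg hν (by simp_rw [ZZ_neg]; rw [integral_neg, h0]; simp) (half_pos hε)
  have A3 := tail_EB (γ := γ) hγ0 hγ1 hp (DD_pos hγ0 hγ1 (δ := δ) h.pos) (half_pos hε) 2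
  refine EB.mono (A3.add (A1.add A2)) fun n hn => ?_
  have hsub : {x | x ∈ Ioc (0:ℝ) 1 ∧ ε * n < |∑ j ∈ Finset.range n, φ ((Tmap γ)^[j] x)|} ⊆ 
      {x | x ∈ Ioc (0:ℝ) 1 ∧ ∃ i < 2 * n, ε / 2 * n < DD γ δ C * uu ((GG γ)^[i] x) ^ pp γ δ} ∪ 
      ((⋃ k ∈ Finset.range (n+1), {x | x ∈ Ioc (0:ℝ) 1 ∧ ε / 2 * n < ∑ i ∈ Finset.range k, ZZ γ φ ((GG γ)^[i] x)}) ∪ 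
       (⋃ k ∈ Finset.range (n+1), {x | x ∈ Ioc (0:ℝ) 1 ∧ ε / 2 * n < ∑ i ∈ Finset.range k, ZZ γ (fun y => - φ y) ((GG γ)^[i] x)})) := by
    rintro x ⟨hx, hs⟩
    obtain ⟨N, hN, hb⟩ := decomp hγ0 hγ1 hδ h n x hx
    by_cases hg : ε / 2 * n < DD γ δ C * uu ((GG γ)^[N] x) ^ pp γ δ
    · left; exact ⟨hx, N, by omega, hg⟩
    right
    push Not at hg
    have h1 := abs_le.1 (hb.trans hg)
    rcases lt_abs.1 hs with h2 | h2
    · left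
      simp only [mem_iUnion, Finset.mem_range]
      exact ⟨N, by omega, hx, by linarith⟩
    · right
      simp only [mem_iUnion, Finset.mem_range]
      refine ⟨N, by omega, hx, ?_⟩
      simp only [ZZ_neg, Finset.sum_neg_distrib]
      linarith
  refine (measure_mono hsub).trans ((measure_union_le _ _).trans ?_)
  gcongr
  refine (measure_union_le _ _).trans ?_
  gcongr <;> exact measure_biUnion_finset_le _ _

lemma push_left_le (hγ0 : 0 < γ) (hγ1 : γ ≤ 1) {E : Set ℝ} (hE : MeasurableSet E) : 
    mI (Tmap γ ⁻¹' E ∩ Ioc 0 (1/2)) ≤ mI E := by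
  have hβ := be_nonneg hγ0 hγ1
  have himg := T_image hγ0 hγ1
  have hinj := T_injOn hγ0 hγ1
  set S : ℝ → ℝ := Function.invFunOn (Tmap γ) (Ioc 0 (1/2))
  have hS : ∀ x ∈ Ioc (0:ℝ) 1, S x ∈ Ioc (0:ℝ) (1/2) := by
    intro x hx
    rw [← himg] at hx
    exact Function.invFunOn_mem hx
  have hST : ∀ y ∈ Ioc (0:ℝ) (1/2), S (Tmap γ y) = y := fun y hy => hinj.leftInvOn_invFunOn hy
  have hsub : Ioc (0:ℝ) (1/2) ⊆ Ioc 0 1 := Ioc_subset_Ioc_right (by norm_num)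
  have hd : ∀ y ∈ Ioc (0:ℝ) (1/2), 1 < dF (be γ) (- Real.log y) := fun y hy => 
    dF_pos hβ (log2_pos.trans_le (neglog_ge hy))
  have hp := push_branch (γ := γ) measurableSet_Ioc hsub (fun y hy => T_deriv hy) (fun y hy => one_pos.trans (hd y hy)) hinj himg 
    (g := fun _ => 1) (g' := fun x => ENNReal.ofReal (dF (be γ) (- Real.log (S x)))⁻¹) (by
      intro y hy
      have := hd y hy
      rw [hST y hy, ← ENNReal.ofReal_mul (by linarith), mul_inv_cancel₀ (by linarith)]
      simp)
  have e1 : mI.withDensity (fun _ => (1:ℝ≥0∞)) = mI := by simp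
  rw [e1] at hp
  have e2 : mI (Tmap γ ⁻¹' E ∩ Ioc 0 (1/2)) = ((mI.restrict (Ioc 0 (1/2))).map (Tmap γ)) E := by
    rw [Measure.map_apply T_meas hE, Measure.restrict_apply (T_meas hE)]
  rw [e2, hp, withDensity_apply _ hE]
  calc _ ≤ ∫⁻ x in E, 1 ∂mI := by
        refine lintegral_mono_ae (ae_restrict_of_ae ?_)
        filter_upwards [ae_mI] with x hx
        have := hd _ (hS x hx)
        rw [ENNReal.ofReal_le_one]
        exact inv_le_one_of_one_le₀ this.le
    _ = _ := by simp

lemma AA_le (hγ0 : 0 < γ) (hγ1 : γ ≤ 1) {E : Set ℝ} (hE : MeasurableSet E) (j : ℕ) : mI (AA γ E j) ≤ mI E := by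
  induction j with
  | zero => simp [AA]
  | succ j ih =>
    rw [← measure_inter_conull (s := AA γ E (j+1)) mI_compl, ← AA_succ hγ0 hγ1]
    exact (push_left_le hγ0 hγ1 (AA_meas hE j)).trans ih

lemma kk_bound (hγ0 : 0 < γ) (hγ1 : γ ≤ 1) {δ : ℝ} (hδ : 0 ≤ δ) {x : ℝ} (hx : x ∈ Ioc (0:ℝ) 1) : 
    (kk γ x : ℝ) + 1 ≤ K0 γ * uu x ^ pp γ δ := by
  have hu := uu_ge hx
  have h1 := grow hγ0 hγ1 (φ := fun _ => 1) (C := 1) hδ zero_le_one (fun y hy => by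
    rw [abs_one, one_mul]; exact Real.one_le_rpow (uu_ge hy) hδ) _ x hx le_rfl
  simp only [Finset.sum_const, Finset.card_range, nsmul_eq_mul, mul_one, one_mul] at h1
  rw [abs_of_nonneg (by positivity)] at h1
  push_cast at h1
  exact h1

lemma kk_tail (hγ0 : 0 < γ) (hγ1 : γ ≤ 1) {δ : ℝ} (hδ : 0 ≤ δ) : 
    EB (1 / pp γ δ) (fun n => ∫⁻ x, ((kk γ x + 1 : ℕ) : ℝ≥0∞) * {x | n ≤ kk γ x}.indicator 1 x ∂mI) := by
  set p := pp γ δ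
  have hp : 1 ≤ p := pp_ge hγ0 hγ1 hδ
  have hp0 : 0 < p := by linarith
  have hK := K0_ge hγ0 hγ1
  set I := ∫ x, uu x ^ p * Real.exp (uu x / 2) ∂mI
  refine ⟨K0 γ * (I + 1), (1 / K0 γ) ^ (1/p) / 2, ?_, by positivity, fun n hn => ?_⟩
  · have : 0 ≤ I := by
      refine integral_nonneg_of_ae ?_
      filter_upwards [ae_mI] with x hx
      have := uu_ge hx
      simp only [Pi.zero_apply]
      positivity
    positivity
  set w := Real.exp (-((1 / K0 γ) ^ (1/p) / 2) * (n:ℝ) ^ (1/p))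
  have hinteg : Integrable (fun x => K0 γ * w * (uu x ^ p * Real.exp (uu x / 2))) mI := (int_uu p).const_mul _
  calc _ ≤ ∫⁻ x, ENNReal.ofReal (K0 γ * w * (uu x ^ p * Real.exp (uu x / 2))) ∂mI := by
        refine lintegral_mono_ae ?_
        filter_upwards [ae_mI] with x hx
        have hu := uu_ge hx
        by_cases hk : n ≤ kk γ x
        · rw [indicator_of_mem (by exact hk), Pi.one_apply, mul_one, ← ENNReal.ofReal_natCast]
          refine ENNReal.ofReal_le_ofReal ?_
          have h1 := kk_bound hγ0 hγ1 hδ hx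
          have h2 : (n:ℝ) ≤ kk γ x := by exact_mod_cast hk
          have h3 : (1 / K0 γ) * n ≤ uu x ^ p := by
            rw [one_div_mul_eq_div, div_le_iff₀ (by linarith), mul_comm]
            linarith
          have h4 := Real.rpow_le_rpow (by positivity) h3 (z := 1/p) (by positivity)
          rw [← Real.rpow_mul (by linarith), mul_one_div_cancel hp0.ne', Real.rpow_one, Real.mul_rpow (by positivity) (by positivity)] at h4
          have h5 : 1 ≤ w * Real.exp (uu x / 2) := by
            rw [← Real.exp_add, Real.one_le_exp_iff]
            linarith
          push_cast
          calc (kk γ x : ℝ) + 1 ≤ K0 γ * uu x ^ p * 1 := by rw [mul_one]; exact h1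
            _ ≤ K0 γ * uu x ^ p * (w * Real.exp (uu x / 2)) := by gcongr
            _ = _ := by ring
        · rw [indicator_of_notMem (by exact hk), mul_zero]
          exact zero_le
    _ = ENNReal.ofReal (K0 γ * w * I) := by
      rw [← ofReal_integral_eq_lintegral_ofReal hinteg, integral_const_mul]
      filter_upwards [ae_mI] with x hx
      have := uu_ge hx
      simp only [Pi.zero_apply]
      positivity
    _ ≤ _ := by
      refine ENNReal.ofReal_le_ofReal ?_
      have : K0 γ * (I + 1) * w = K0 γ * w * I + K0 γ * w := by ring
      rw [this]
      have : 0 < K0 γ * w := by positivity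
      linarith

lemma nu_upper (hγ0 : 0 < γ) (hγ1 : γ ≤ 1) {δ : ℝ} (hδ : 0 ≤ δ) {ν : Measure ℝ} (hν : InvM γ ν) {B : ℕ → Set ℝ} 
    (hB : ∀ n, MeasurableSet (B n)) (hEB : EB (1 / pp γ δ) (fun n => mI (B n))) : EB (1 / pp γ δ) (fun n => ν (B n)) := by
  have hp := pp_ge hγ0 hγ1 hδ
  have := muG_fin hν
  have hmk := MK_le (muG_MK hγ0 hγ1 hν)
  set c := ENNReal.ofReal (2 * cD γ) * (muG γ ν) univ
  have hc : c ≠ ∞ := ENNReal.mul_ne_top ENNReal.ofReal_ne_top (measure_ne_top _ _)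
  refine EB.mono (((hEB.nat_mul (by positivity)).add (kk_tail hγ0 hγ1 hδ)).const_mul hc) fun n hn => ?_
  have h1 := kac_lintegral hγ0 hγ1 hν (u := (B n).indicator 1) (measurable_one.indicator (hB n))
  rw [lintegral_indicator_one (hB n)] at h1
  rw [h1]
  refine (lintegral_mono' hmk le_rfl).trans ?_
  rw [lintegral_smul_measure, smul_eq_mul]
  refine mul_le_mul' le_rfl ?_
  calc _ ≤ ∫⁻ x, (∑ j ∈ Finset.range n, (AA γ (B n) j).indicator 1 x) + ((kk γ x + 1 : ℕ) : ℝ≥0∞) * {x | n ≤ kk γ x}.indicator 1 x ∂mI := by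
        refine lintegral_mono fun x => ?_
        dsimp only
        by_cases hk : n ≤ kk γ x
        · rw [indicator_of_mem (s := {x | n ≤ kk γ x}) (by exact hk), Pi.one_apply, mul_one]
          refine le_add_of_nonneg_of_le zero_le ?_
          calc _ ≤ ∑ j ∈ Finset.range (kk γ x + 1), (1:ℝ≥0∞) := Finset.sum_le_sum fun j _ => (indicator_le_self (B n) (1 : ℝ → ℝ≥0∞) ((Tmap γ)^[j] x))
            _ = ((kk γ x + 1 : ℕ) : ℝ≥0∞) := by simp
        · refine le_add_of_le_of_nonneg ?_ zero_le
          push Not at hk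
          calc _ = ∑ j ∈ Finset.range (kk γ x + 1), (AA γ (B n) j).indicator (1 : ℝ → ℝ≥0∞) x := by
                refine Finset.sum_congr rfl fun j hj => ?_
                have hj' : j ≤ kk γ x := by simpa [Nat.lt_succ_iff] using hj
                by_cases hb : (Tmap γ)^[j] x ∈ B n
                · rw [indicator_of_mem hb, indicator_of_mem (s := AA γ (B n) j) (by exact ⟨hb, hj'⟩)]; rfl
                · rw [indicator_of_notMem hb, indicator_of_notMem (s := AA γ (B n) j) (fun h => hb h.1)]
            _ ≤ _ := Finset.sum_le_sum_of_subset (Finset.range_mono (by omega))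
    _ = ∑ j ∈ Finset.range n, mI (AA γ (B n) j) + ∫⁻ x, ((kk γ x + 1 : ℕ) : ℝ≥0∞) * {x | n ≤ kk γ x}.indicator 1 x ∂mI := by
      rw [lintegral_add_left, lintegral_finsetSum]
      · congr 1
        refine Finset.sum_congr rfl fun j _ => ?_
        rw [lintegral_indicator_one (AA_meas (hB n) j)]
      · exact fun j _ => measurable_one.indicator (AA_meas (hB n) j)
      · exact Finset.measurable_sum _ fun j _ => measurable_one.indicator (AA_meas (hB n) j)
    _ ≤ _ := by
      gcongr
      calc _ ≤ ∑ j ∈ Finset.range n, mI (B n) := Finset.sum_le_sum fun j _ => AA_le hγ0 hγ1 (hB n) j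
        _ = _ := by simp

end LD
end

section
open MeasureTheory Set Filter Topology
open scoped ENNReal

namespace LD

variable {γ : ℝ}

lemma slow (hγ0 : 0 < γ) (hγ1 : γ ≤ 1) {x L : ℝ} (hx : x ∈ Ioc (0:ℝ) 1) (hL : 2 ≤ L) (hxL : L ≤ - Real.log x) (j : ℕ) 
    (hj : j * sF (be γ) (L/2) ≤ L/2) : L - j * sF (be γ) (L/2) ≤ - Real.log ((Tmap γ)^[j] x) := by
  have hβ := be_nonneg hγ0 hγ1
  set d := sF (be γ) (L/2) with hd
  have hd0 : 0 < d := sF_pos _ (by linarith)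
  induction j with
  | zero => simpa using hxL
  | succ j ih =>
    push_cast at hj ⊢
    have hj' : j * d ≤ L/2 := by linarith
    have h1 := ih hj'
    set y := (Tmap γ)^[j] x with hy
    have hym : y ∈ Ioc (0:ℝ) 1 := T_iter_mem hγ0 hγ1 hx j
    have h2 : L/2 ≤ - Real.log y := by linarith
    have hyh : y ≤ 1/2 := by
      have h3 : Real.log y ≤ Real.log (1/2) := by
        rw [one_div, Real.log_inv]; linarith [log2_lt]
      exact (Real.log_le_log_iff hym.1 (by norm_num)).1 h3
    have h4 := neglog_T (γ := γ) ⟨hym.1, hyh⟩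
    rw [Function.iterate_succ_apply', h4]
    have h5 : sF (be γ) (- Real.log y) ≤ d := sF_anti hβ (by linarith) h2
    have h6 := sF_pos (be γ) (show 0 < - Real.log y by linarith)
    have h7 := Real.log_le_sub_one_of_pos (show 0 < 1 + sF (be γ) (- Real.log y) by linarith)
    linarith

lemma sum_big (hγ0 : 0 < γ) (hγ1 : γ ≤ 1) {δ : ℝ} (hδ : 0 < δ) {x K : ℝ} (hx : x ∈ Ioc (0:ℝ) 1) (hK : 2 ≤ K) {n : ℕ} (hn : 1 ≤ n) 
    (hxL : K * (n:ℝ) ^ (1 / pp γ δ) ≤ - Real.log x) : 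
    n * (K/2) ^ δ ≤ ∑ j ∈ Finset.range n, logObs δ ((Tmap γ)^[j] x) := by
  have hβ := be_nonneg hγ0 hγ1
  have hp : 1 ≤ pp γ δ := pp_ge hγ0 hγ1 hδ.le
  have hn1 : (1:ℝ) ≤ n := by exact_mod_cast hn
  have hna : 1 ≤ (n:ℝ) ^ (1 / pp γ δ) := Real.one_le_rpow hn1 (by positivity)
  set L := - Real.log x
  have hKL : K ≤ L := by nlinarith
  have hL : 2 ≤ L := by linarith
  set d := sF (be γ) (L/2) with hd
  have hd0 : 0 < d := sF_pos _ (by linarith)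
  set J := ⌊(L/2)/d⌋₊ + 1
  have hJ : (L/2)/d ≤ J := by
    have := Nat.lt_floor_add_one ((L/2)/d)
    push_cast [J]; exact this.le
  have hterm : ∀ j < J, (L/2) ^ δ ≤ logObs δ ((Tmap γ)^[j] x) := by
    intro j hj
    have h1 : (j:ℝ) ≤ (L/2)/d := by
      have : j ≤ ⌊(L/2)/d⌋₊ := by omega
      exact (Nat.cast_le.2 this).trans (Nat.floor_le (by positivity))
    have h2 : j * d ≤ L/2 := (le_div_iff₀ hd0).1 h1
    have h3 := slow hγ0 hγ1 hx hL le_rfl j h2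
    rw [logObs_eq (T_iter_mem hγ0 hγ1 hx j)]
    exact Real.rpow_le_rpow (by linarith) (by linarith) hδ.le
  have hs : ∀ m ≤ n, m ≤ J → m * (L/2) ^ δ ≤ ∑ j ∈ Finset.range n, logObs δ ((Tmap γ)^[j] x) := by
    intro m hm hmJ
    calc _ = ∑ j ∈ Finset.range m, (L/2) ^ δ := by simp
      _ ≤ ∑ j ∈ Finset.range m, logObs δ ((Tmap γ)^[j] x) := 
        Finset.sum_le_sum fun j hj => hterm j (by have := Finset.mem_range.1 hj; omega)
      _ ≤ _ := Finset.sum_le_sum_of_subset_of_nonneg (Finset.range_mono hm) fun j _ _ => logObs_nonneg _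
  rcases le_total n J with h | h
  · refine le_trans ?_ (hs n le_rfl h)
    gcongr
  · refine le_trans ?_ (hs J h le_rfl)
    have a1 : (L/2) ^ (1 + be γ) ≤ J := by
      refine le_trans ?_ hJ
      rw [le_div_iff₀ hd0, hd, sF, Real.rpow_add (by linarith), Real.rpow_one]
      have : 0 < (L/2) ^ be γ := by positivity
      have h2 : (Real.log 2) ^ be γ ≤ 1 := Real.rpow_le_one log2_pos.le log2_lt.le hβ
      calc _ = L / 2 * (Real.log 2) ^ be γ := by field_simp
        _ ≤ L / 2 * 1 := by gcongr
        _ = _ := mul_one _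
    have a2 : (K/2 * (n:ℝ) ^ (1 / pp γ δ)) ^ pp γ δ ≤ (L/2) ^ pp γ δ := 
      Real.rpow_le_rpow (by positivity) (by linarith) (by linarith)
    rw [Real.mul_rpow (by positivity) (by positivity), ← Real.rpow_mul (by linarith), one_div_mul_cancel (by linarith), Real.rpow_one] at a2
    have a3 : (K/2) ^ δ ≤ (K/2) ^ pp γ δ := Real.rpow_le_rpow_of_exponent_le (by linarith) (by unfold pp; linarith)
    calc n * (K/2) ^ δ ≤ n * (K/2) ^ pp γ δ := by gcongr
      _ = (K/2) ^ pp γ δ * n := mul_comm _ _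
      _ ≤ (L/2) ^ pp γ δ := a2
      _ = (L/2) ^ (1 + be γ) * (L/2) ^ δ := by rw [pp, Real.rpow_add (by linarith)]
      _ ≤ _ := by gcongr

lemma nu_lower (hγ0 : 0 < γ) (hγ1 : γ ≤ 1) {ν : Measure ℝ} (hν : InvM γ ν) : 
    ∃ c > 0, ∀ t : ℝ, 0 ≤ t → ENNReal.ofReal (c * Real.exp (-t)) ≤ ν (Ioc 0 (Real.exp (-t))) := by
  have := muG_fin hν
  have hc := one_le_cD hγ0 hγ1
  have hpos : 0 < (muG γ ν).real univ := ENNReal.toReal_pos (muG_ne_zero hγ0 hγ1 hν) (measure_ne_top _ _)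
  refine ⟨(muG γ ν).real univ / (2 * cD γ), by positivity, fun t ht => ?_⟩
  refine le_trans ?_ (muG_le_nu hγ0 hγ1 hν measurableSet_Ioc)
  have h1 := MK_ge (muG_MK hγ0 hγ1 hν) (Ioc 0 (Real.exp (-t)))
  simp only [Measure.smul_apply, smul_eq_mul] at h1
  have e1 : mI (Ioc 0 (Real.exp (-t))) = ENNReal.ofReal (Real.exp (-t)) := by
    have : Ioc 0 (Real.exp (-t)) ∩ Ioc 0 1 = Ioc 0 (Real.exp (-t)) := 
      inter_eq_left.2 (Ioc_subset_Ioc_right (Real.exp_le_one_iff.2 (by linarith)))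
    rw [mI, Measure.restrict_apply measurableSet_Ioc, this, Real.volume_Ioc, sub_zero]
  rw [e1] at h1
  have e2 : ENNReal.ofReal ((muG γ ν).real univ / (2 * cD γ) * Real.exp (-t)) = 
      ENNReal.ofReal (2 * cD γ)⁻¹ * (muG γ ν univ * ENNReal.ofReal (Real.exp (-t))) := by
    rw [← ofReal_measureReal (μ := muG γ ν) (s := univ), ← ENNReal.ofReal_mul hpos.le, ← ENNReal.ofReal_mul (by positivity)]
    congr 1; field_simp
  rw [e2]
  refine (mul_le_mul' le_rfl h1).trans (le_of_eq ?_)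
  rw [← mul_assoc, ← ENNReal.ofReal_mul (by positivity), inv_mul_cancel₀ (by positivity), ENNReal.ofReal_one, one_mul]

lemma alpha_eq (hγ0 : 0 < γ) {δ : ℝ} (hδ : 0 < δ) : γ / (1 + γ * δ) = 1 / pp γ δ := by
  have : pp γ δ = (1 + γ * δ) / γ := by
    unfold pp be; field_simp; ring
  rw [this, one_div_div]

lemma final (hγ0 : 0 < γ) (hγ1 : γ ≤ 1) {δ : ℝ} (hδ : 0 < δ) {ν : Measure ℝ} (hν : InvM γ ν) : 
    Integrable (logObs δ) ν ∧
    ∃ c1 c2 κ1 κ2 : ℝ, 0 < c1 ∧ 0 < c2 ∧ 0 < κ1 ∧ 0 < κ2 ∧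
      ∀ n : ℕ, 1 ≤ n →
        ENNReal.ofReal (c1 * Real.exp (-κ1 * (n : ℝ) ^ (γ / (1 + γ * δ)))) ≤
          ν {x ∈ Set.Icc (0 : ℝ) 1 |
            (n : ℝ) <
              |(∑ k ∈ Finset.range n, logObs δ ((Tmap γ)^[k] x)) - n * ∫ z, logObs δ z ∂ν|} ∧
        ν {x ∈ Set.Icc (0 : ℝ) 1 |
            (n : ℝ) <
              |(∑ k ∈ Finset.range n, logObs δ ((Tmap γ)^[k] x)) - n * ∫ z, logObs δ z ∂ν|} ≤
          ENNReal.ofReal (c2 * Real.exp (-κ2 * (n : ℝ) ^ (γ / (1 + γ * δ)))) := by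
  obtain ⟨hinteg, hcen⟩ := ZZ_center hγ0 hγ1 hν hδ
  refine ⟨hinteg, ?_⟩
  rw [alpha_eq hγ0 hδ]
  set A := ∫ z, logObs δ z ∂ν with hA
  have hA0 : 0 ≤ A := integral_nonneg logObs_nonneg
  have hobs := logObs_obs hδ A
  have hT := LDT hγ0 hγ1 hδ.le hobs hν hcen one_pos
  have hU := nu_upper hγ0 hγ1 hδ.le hν (B := fun n => {x | x ∈ Ioc (0:ℝ) 1 ∧ 1 * (n:ℝ) < |∑ j ∈ Finset.range n, (logObs δ ((Tmap γ)^[j] x) - A)|})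
    (fun n => measurableSet_Ioc.inter (measurableSet_lt measurable_const 
      (Finset.measurable_sum _ fun j _ => hobs.meas.comp (T_iter_meas j)).abs)) hT
  obtain ⟨c2, κ2, hc2, hκ2, hU⟩ := hU
  obtain ⟨c1, hc1, hLo⟩ := nu_lower hγ0 hγ1 hν
  set K := 2 * (2 + A) ^ (1/δ) with hK
  have hK2 : 2 ≤ K := by
    have : 1 ≤ (2 + A) ^ (1/δ) := Real.one_le_rpow (by linarith) (by positivity)
    linarith
  have hKδ : (K/2) ^ δ = 2 + A := by
    rw [hK, mul_div_cancel_left₀ _ (by norm_num), ← Real.rpow_mul (by linarith), one_div_mul_cancel hδ.ne', Real.rpow_one]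
  refine ⟨c1, c2, K, κ2, hc1, hc2, by linarith, hκ2, fun n hn => ⟨?_, ?_⟩⟩
  · have hn1 : (1:ℝ) ≤ n := by exact_mod_cast hn
    rw [neg_mul]
    refine (hLo _ (by positivity)).trans (measure_mono ?_)
    intro x hx
    have hx1 : x ∈ Ioc (0:ℝ) 1 := ⟨hx.1, hx.2.trans (Real.exp_le_one_iff.2 (by simp only [neg_nonpos]; positivity))⟩
    have hl : K * (n:ℝ) ^ (1 / pp γ δ) ≤ - Real.log x := by
      have := (Real.log_le_iff_le_exp hx.1).2 hx.2
      linarith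
    have hb := sum_big hγ0 hγ1 hδ hx1 hK2 hn hl
    rw [hKδ] at hb
    refine ⟨⟨hx1.1.le, hx1.2⟩, ?_⟩
    refine lt_of_lt_of_le ?_ (le_abs_self _)
    nlinarith
  · refine le_trans ?_ (hU n hn)
    rw [← measure_inter_conull (s := {x ∈ Set.Icc (0 : ℝ) 1 | (n : ℝ) < |(∑ k ∈ Finset.range n, logObs δ ((Tmap γ)^[k] x)) - n * A|}) hν.supp]
    refine measure_mono ?_
    rintro x ⟨⟨_, h2⟩, h3⟩
    refine ⟨h3, ?_⟩
    rw [one_mul, Finset.sum_sub_distrib, Finset.sum_const, Finset.card_range, nsmul_eq_mul]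
    exact h2

lemma mkInv {ν : Measure ℝ} [IsProbabilityMeasure ν]
    (hsupp : ν (Set.Icc (0 : ℝ) 1)ᶜ = 0) (hac : ν ≪ volume)
    (hinv : ∀ A : Set ℝ, MeasurableSet A → ν (Tmap γ ⁻¹' A) = ν A) : InvM γ ν := by
  refine ⟨inferInstance, ?_, hac, hinv⟩
  have h0 : ν {0} = 0 := hac (by simp)
  refine measure_mono_null (t := (Set.Icc (0 : ℝ) 1)ᶜ ∪ {0}) ?_ (measure_union_null hsupp h0)
  intro x hx
  by_cases h : x = 0
  · right; exact h
  · left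
    intro h1
    exact hx ⟨lt_of_le_of_ne h1.1 (Ne.symm h), h1.2⟩

end LD
end

/-- For `f(x) = |log x|^δ`, `f ∈ L¹(ν)` and there are `c1, c2, κ1, κ2 > 0` such that for
all `n ≥ 1`, `c1 e^{-κ1 n^{γ/(1+γδ)}} ≤ ν(|S_n(f)| > n) ≤ c2 e^{-κ2 n^{γ/(1+γδ)}}`,
where `S_n(f)(x) = ∑_{k<n} f(T^k x) - n ∫ f dν`. -/
theorem stmt7 (γ : ℝ) (hγ0 : 0 < γ) (hγ1 : γ ≤ 1) (δ : ℝ) (hδ : 0 < δ)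
    (ν : Measure ℝ) [IsProbabilityMeasure ν]
    (hsupp : ν (Set.Icc (0 : ℝ) 1)ᶜ = 0) (hac : ν ≪ volume)
    (hinv : ∀ A : Set ℝ, MeasurableSet A → ν (Tmap γ ⁻¹' A) = ν A) :
    Integrable (logObs δ) ν ∧
    ∃ c1 c2 κ1 κ2 : ℝ, 0 < c1 ∧ 0 < c2 ∧ 0 < κ1 ∧ 0 < κ2 ∧
      ∀ n : ℕ, 1 ≤ n →
        ENNReal.ofReal (c1 * Real.exp (-κ1 * (n : ℝ) ^ (γ / (1 + γ * δ)))) ≤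
          ν {x ∈ Set.Icc (0 : ℝ) 1 |
            (n : ℝ) <
              |(∑ k ∈ Finset.range n, logObs δ ((Tmap γ)^[k] x)) - n * ∫ z, logObs δ z ∂ν|} ∧
        ν {x ∈ Set.Icc (0 : ℝ) 1 |
            (n : ℝ) <
              |(∑ k ∈ Finset.range n, logObs δ ((Tmap γ)^[k] x)) - n * ∫ z, logObs δ z ∂ν|} ≤
          ENNReal.ofReal (c2 * Real.exp (-κ2 * (n : ℝ) ^ (γ / (1 + γ * δ)))) := by
  exact LD.final hγ0 hγ1 hδ (LD.mkInv hsupp hac hinv)
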